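/- The value function v is the unique minimax C_f-solution of the HJB terminal-value problem: −∂_t u − H(t,x,u,∂_x u) = 0 on [0,T)×Ω with u(T,·) = h, where H(t,x,y,z) = inf_{a∈A} [ℓ(t,x,a) + f(t,x,a)·z − λ(t,x,a) y]. That is, v is a minimax C_f-solution, and any minimax C_f-solution equals v. -/

import Mathlib

open MeasureTheory Set Filter Topology
open scoped InnerProductSpace

noncomputable section

namespace PHJ

/-- The Euclidean state space `ℝ^d`. -/
abbrev E (d : ℕ) := EuclideanSpace ℝ (Fin d)

/-- A path; only its values on `[0, T]` are relevant. -/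
abbrev Path (d : ℕ) := ℝ → E d

/-- The set `Ω = D([0,T], ℝ^d)` of paths that are right-continuous on `[0,T)` and have
left limits on `(0,T]`. -/
def Cadlag (T : ℝ) (d : ℕ) : Set (Path d) :=
  {x | (∀ t ∈ Ico (0 : ℝ) T, ContinuousWithinAt x (Ici t) t) ∧
       (∀ t ∈ Ioc (0 : ℝ) T, ∃ l : E d, Tendsto x (nhdsWithin t (Iio t)) (nhds l))}

/-- The running supremum `sup_{0 ≤ s ≤ t} |x(s)|`. -/
def runSup (d : ℕ) (x : Path d) (t : ℝ) : ℝ :=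
  sSup ((fun s => ‖x s‖) '' Icc 0 t)

/-- The supremum distance `sup_{0 ≤ s ≤ T} |x(s) − y(s)|`. -/
def supDist (T : ℝ) (d : ℕ) (x y : Path d) : ℝ :=
  sSup ((fun s => ‖x s - y s‖) '' Icc 0 T)

/-- The stopped supremum distance `sup_{0 ≤ r ≤ T} |x(r ∧ t) − y(r ∧ s)|`. -/
def stopDist (T : ℝ) (d : ℕ) (t : ℝ) (x : Path d) (s : ℝ) (y : Path d) : ℝ :=
  sSup ((fun r => ‖x (min r t) - y (min r s)‖) '' Icc 0 T)

/-- The pseudometric `d_∞` on `[0,T] × Ω`. -/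
def dInf (T : ℝ) (d : ℕ) (p q : ℝ × Path d) : ℝ :=
  |p.1 - q.1| + stopDist T d p.1 p.2 q.1 q.2

/-- `g` is an integrable a.e.-derivative of `x` on `[s₀, T]` (so that `x` is absolutely
continuous there) satisfying the growth bound `|x′(t)| ≤ L (1 + sup_{s ≤ t} |x(s)|)` a.e. -/
def XDeriv (T : ℝ) (d : ℕ) (L s₀ : ℝ) (x g : Path d) : Prop :=
  IntegrableOn g (Icc s₀ T) volume ∧
  (∀ t ∈ Icc s₀ T, x t = x s₀ + ∫ s in s₀..t, g s) ∧
  (∀ᵐ t ∂(volume.restrict (Ioo s₀ T)), ‖g t‖ ≤ L * (1 + runSup d x t))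

/-- The set `X^L(s₀, x₀)` of "Lipschitz-like" paths. -/
def XSet (T : ℝ) (d : ℕ) (L s₀ : ℝ) (x₀ : Path d) : Set (Path d) :=
  {x | x ∈ Cadlag T d ∧ (∀ t ∈ Icc 0 s₀, x t = x₀ t) ∧ ∃ g, XDeriv T d L s₀ x g}

/-- Type of Hamiltonians `H(t, x, y, z)`. -/
abbrev Ham (d : ℕ) := ℝ → Path d → ℝ → E d → ℝ

/-- The set `Y^L(s₀, x₀, y₀, z)` of characteristic pairs `(x, y)`. -/
def YSet (T : ℝ) (d : ℕ) (H : Ham d) (L s₀ : ℝ) (x₀ : Path d) (y₀ : ℝ) (z : E d) :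
    Set (Path d × (ℝ → ℝ)) :=
  {p | p.1 ∈ Cadlag T d ∧ (∀ t ∈ Icc 0 s₀, p.1 t = x₀ t) ∧
       ContinuousOn p.2 (Icc s₀ T) ∧
       ∃ g, XDeriv T d L s₀ p.1 g ∧
         IntegrableOn (fun s => ⟪g s, z⟫_ℝ - H s p.1 (p.2 s) z) (Icc s₀ T) volume ∧
         ∀ t ∈ Icc s₀ T, p.2 t = y₀ + ∫ s in s₀..t, (⟪g s, z⟫_ℝ - H s p.1 (p.2 s) z)}

/-- Assumption (i): for a.e. `t`, `(x, y, z) ↦ H(t, x, y, z)` is continuous. -/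
def HamCont (T : ℝ) (d : ℕ) (H : Ham d) : Prop :=
  ∀ᵐ t ∂(volume.restrict (Ioo (0 : ℝ) T)),
    ∀ x ∈ Cadlag T d, ∀ (y : ℝ) (z : E d), ∀ ε > (0 : ℝ), ∃ δ > (0 : ℝ),
      ∀ x' ∈ Cadlag T d, ∀ (y' : ℝ) (z' : E d),
        supDist T d x x' < δ → |y - y'| < δ → ‖z - z'‖ < δ →
        |H t x y z - H t x' y' z'| < ε

/-- Assumption (ii): `t ↦ H(t, x, y, z)` is Borel measurable. -/
def HamMeas (d : ℕ) (H : Ham d) : Prop :=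
  ∀ (x : Path d) (y : ℝ) (z : E d), Measurable fun t => H t x y z

/-- Assumption (iii): Lipschitz continuity in `z` with constant `L_H (1 + sup_{s≤t} |x(s)|)`. -/
def HamLipZ (T : ℝ) (d : ℕ) (H : Ham d) (LH : ℝ) : Prop :=
  0 ≤ LH ∧ ∀ᵐ t ∂(volume.restrict (Ioo (0 : ℝ) T)),
    ∀ x ∈ Cadlag T d, ∀ (y : ℝ) (z z' : E d),
      |H t x y z - H t x y z'| ≤ LH * (1 + runSup d x t) * ‖z - z'‖

/-- Assumption (iv): local Lipschitz continuity in `x` along `X^L`-paths,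
with constant `M L`. -/
def HamLipX (T : ℝ) (d : ℕ) (H : Ham d) (M : ℝ → ℝ) : Prop :=
  ∀ L ≥ (0 : ℝ), 0 ≤ M L ∧
    ∀ t₀ ∈ Ico (0 : ℝ) T, ∀ x₀ ∈ Cadlag T d,
      ∀ x ∈ XSet T d L t₀ x₀, ∀ x' ∈ XSet T d L t₀ x₀, ∀ (y : ℝ) (z : E d),
        ∀ᵐ t ∂(volume.restrict (Ioo t₀ T)),
          |H t x y z - H t x' y z| ≤
            M L * (1 + |y| + ‖z‖) * sSup ((fun s => ‖x s - x' s‖) '' Icc 0 t)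

/-- Assumption (v): `y ↦ H(t, x, y, z)` is non-increasing. -/
def HamMono (T : ℝ) (d : ℕ) (H : Ham d) : Prop :=
  ∀ᵐ t ∂(volume.restrict (Ioo (0 : ℝ) T)),
    ∀ x ∈ Cadlag T d, ∀ (z : E d) (y y' : ℝ), y ≤ y' → H t x y' z ≤ H t x y z

/-- Assumption (vi): growth bound `|H(t, x, y, 0)| ≤ C_H (1 + sup_{s≤t}|x(s)| + |y|)`. -/
def HamBound (T : ℝ) (d : ℕ) (H : Ham d) (CH : ℝ) : Prop :=
  0 ≤ CH ∧ ∀ᵐ t ∂(volume.restrict (Ioo (0 : ℝ) T)),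
    ∀ x ∈ Cadlag T d, ∀ y : ℝ, |H t x y 0| ≤ CH * (1 + runSup d x t + |y|)

/-- Lower semicontinuity on `[0,T] × Ω` with respect to `d_∞`. -/
def LscOn (T : ℝ) (d : ℕ) (u : ℝ → Path d → ℝ) : Prop :=
  ∀ t₀ ∈ Icc (0 : ℝ) T, ∀ x₀ ∈ Cadlag T d, ∀ c : ℝ, c < u t₀ x₀ →
    ∃ δ > (0 : ℝ), ∀ t ∈ Icc (0 : ℝ) T, ∀ x ∈ Cadlag T d,
      dInf T d (t₀, x₀) (t, x) < δ → c < u t x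

/-- Upper semicontinuity on `[0,T] × Ω` with respect to `d_∞`. -/
def UscOn (T : ℝ) (d : ℕ) (u : ℝ → Path d → ℝ) : Prop :=
  ∀ t₀ ∈ Icc (0 : ℝ) T, ∀ x₀ ∈ Cadlag T d, ∀ c : ℝ, u t₀ x₀ < c →
    ∃ δ > (0 : ℝ), ∀ t ∈ Icc (0 : ℝ) T, ∀ x ∈ Cadlag T d,
      dInf T d (t₀, x₀) (t, x) < δ → u t x < c

/-- Continuity of the terminal condition `h` with respect to the sup norm. -/
def TermCont (T : ℝ) (d : ℕ) (h : Path d → ℝ) : Prop :=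
  ∀ x ∈ Cadlag T d, ∀ ε > (0 : ℝ), ∃ δ > (0 : ℝ), ∀ x' ∈ Cadlag T d,
    supDist T d x x' < δ → |h x' - h x| < ε

/-- `u` is a minimax `L`-supersolution of the terminal-value problem (TVP). -/
def MinimaxSuper (T : ℝ) (d : ℕ) (H : Ham d) (h : Path d → ℝ) (L : ℝ)
    (u : ℝ → Path d → ℝ) : Prop :=
  LscOn T d u ∧ (∀ x ∈ Cadlag T d, h x ≤ u T x) ∧
  ∀ s₀ ∈ Ico (0 : ℝ) T, ∀ x₀ ∈ Cadlag T d, ∀ (z : E d) (y₀ : ℝ), u s₀ x₀ ≤ y₀ →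
    ∃ p ∈ YSet T d H L s₀ x₀ y₀ z, ∀ t ∈ Icc s₀ T, u t p.1 ≤ p.2 t

/-- `u` is a minimax `L`-subsolution of the terminal-value problem (TVP). -/
def MinimaxSub (T : ℝ) (d : ℕ) (H : Ham d) (h : Path d → ℝ) (L : ℝ)
    (u : ℝ → Path d → ℝ) : Prop :=
  UscOn T d u ∧ (∀ x ∈ Cadlag T d, u T x ≤ h x) ∧
  ∀ s₀ ∈ Ico (0 : ℝ) T, ∀ x₀ ∈ Cadlag T d, ∀ (z : E d) (y₀ : ℝ), y₀ ≤ u s₀ x₀ →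
    ∃ p ∈ YSet T d H L s₀ x₀ y₀ z, ∀ t ∈ Icc s₀ T, p.2 t ≤ u t p.1

/-- `u` is a minimax `L`-solution of the terminal-value problem (TVP). -/
def MinimaxSol (T : ℝ) (d : ℕ) (H : Ham d) (h : Path d → ℝ) (L : ℝ)
    (u : ℝ → Path d → ℝ) : Prop :=
  MinimaxSuper T d H h L u ∧ MinimaxSub T d H h L u

/-- Embedding of a path into the space of functions on `[0,T]` with the topology of
uniform convergence (i.e. the sup-norm topology). -/
def toUnif (T : ℝ) (d : ℕ) (x : Path d) : UniformFun (Icc (0 : ℝ) T) (E d) :=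
  UniformFun.ofFun fun s => x s.1

/-- Embedding of a real-valued function into the space of functions on `[s₀,T]` with the
topology of uniform convergence. -/
def toUnifR (T s₀ : ℝ) (y : ℝ → ℝ) : UniformFun (Icc s₀ T) ℝ :=
  UniformFun.ofFun fun s => y s.1


/-- Continuity on `[0,T] × Ω` with respect to `d_∞`. -/
def Cont2 (T : ℝ) (d : ℕ) (u : ℝ → Path d → ℝ) : Prop :=
  ∀ t₀ ∈ Icc (0 : ℝ) T, ∀ x₀ ∈ Cadlag T d, ∀ ε > (0 : ℝ), ∃ δ > (0 : ℝ),
    ∀ t ∈ Icc (0 : ℝ) T, ∀ x ∈ Cadlag T d,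
      dInf T d (t₀, x₀) (t, x) < δ → |u t x - u t₀ x₀| < ε

/-- `A` is a countable union of compact metrizable subsets. -/
def SigmaCompactMetrizable (A : Type*) [TopologicalSpace A] : Prop :=
  ∃ K : ℕ → Set A, (∀ n, IsCompact (K n)) ∧
    (∀ n, TopologicalSpace.MetrizableSpace (K n)) ∧ (⋃ n, K n) = univ

section Control

variable (T : ℝ) (d : ℕ) (A : Type*) [TopologicalSpace A] [MeasurableSpace A]

/-- The set `𝒜` of Borel measurable controls. -/
def CtrlSet : Set (ℝ → A) := {α | Measurable α}

variable {A}

/-- Assumption (i) on the data: joint continuity in `(x, a)` for a.e. `t`. -/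
def DocCont (f : ℝ → Path d → A → E d) (lam ell : ℝ → Path d → A → ℝ) : Prop :=
  ∀ᵐ t ∂(volume.restrict (Ioo (0 : ℝ) T)),
    ∀ x ∈ Cadlag T d, ∀ a : A, ∀ ε > (0 : ℝ), ∃ δ > (0 : ℝ), ∃ U ∈ nhds a,
      ∀ x' ∈ Cadlag T d, ∀ a' ∈ U, supDist T d x x' < δ →
        ‖f t x a - f t x' a'‖ < ε ∧ |lam t x a - lam t x' a'| < ε ∧
          |ell t x a - ell t x' a'| < ε

/-- Assumption (ii) on the data: Borel measurability in `t`. -/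
def DocMeas (f : ℝ → Path d → A → E d) (lam ell : ℝ → Path d → A → ℝ) : Prop :=
  ∀ (x : Path d) (a : A), Measurable (fun t => f t x a) ∧
    Measurable (fun t => lam t x a) ∧ Measurable (fun t => ell t x a)

/-- Assumption (iii) on the data: growth bounds with constants `C_f` and `C_λ`;
also `λ ≥ 0`. -/
def DocBound (f : ℝ → Path d → A → E d) (lam ell : ℝ → Path d → A → ℝ)
    (Cf Clam : ℝ) : Prop :=
  0 ≤ Cf ∧ 0 ≤ Clam ∧
  ∀ᵐ t ∂(volume.restrict (Ioo (0 : ℝ) T)), ∀ x ∈ Cadlag T d, ∀ a : A,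
    ‖f t x a‖ + |ell t x a| ≤ Cf * (1 + runSup d x t) ∧
      0 ≤ lam t x a ∧ lam t x a ≤ Clam

/-- Assumption (iv) on the data: Lipschitz continuity in `x` with constant `L_f`. -/
def DocLip (f : ℝ → Path d → A → E d) (lam ell : ℝ → Path d → A → ℝ) (Lf : ℝ) : Prop :=
  0 ≤ Lf ∧
  ∀ᵐ t ∂(volume.restrict (Ioo (0 : ℝ) T)), ∀ x ∈ Cadlag T d, ∀ x' ∈ Cadlag T d, ∀ a : A,
    ‖f t x a - f t x' a‖ + |ell t x a - ell t x' a| + |lam t x a - lam t x' a| ≤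
      Lf * sSup ((fun s => ‖x s - x' s‖) '' Icc 0 t)

/-- `φ` is the controlled trajectory started at `(t₀, x₀)` under the control `α`:
`φ = x₀` on `[0,t₀]`, `φ` is absolutely continuous on `[t₀,T]`, and
`φ′(t) = f(t, φ, α(t))` a.e. on `(t₀,T)`. -/
def IsTraj (f : ℝ → Path d → A → E d) (t₀ : ℝ) (x₀ : Path d) (α : ℝ → A)
    (φ : Path d) : Prop :=
  (∀ t ∈ Icc 0 t₀, φ t = x₀ t) ∧
  IntegrableOn (fun s => f s φ (α s)) (Icc t₀ T) volume ∧
  ∀ t ∈ Icc t₀ T, φ t = x₀ t₀ + ∫ s in t₀..t, f s φ (α s)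

/-- The discount factor `χ^{s,x,α}(t) = exp(−∫_s^t λ(r, φ^{s,x,α}, α(r)) dr)`, where the
trajectory map `Φ` assigns to `(s, x, α)` the trajectory `φ^{s,x,α}`. -/
def chi (lam : ℝ → Path d → A → ℝ) (Φ : ℝ → Path d → (ℝ → A) → Path d)
    (s : ℝ) (x : Path d) (α : ℝ → A) (t : ℝ) : ℝ :=
  Real.exp (-∫ r in s..t, lam r (Φ s x α) (α r))

/-- The cost functional of the control problem. -/
def cost (lam ell : ℝ → Path d → A → ℝ) (h : Path d → ℝ)
    (Φ : ℝ → Path d → (ℝ → A) → Path d) (s : ℝ) (x : Path d) (α : ℝ → A) : ℝ :=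
  (∫ t in s..T, chi d lam Φ s x α t * ell t (Φ s x α) (α t)) +
    chi d lam Φ s x α T * h (Φ s x α)

variable (A)

/-- The value function `v(s,x) = inf_{α ∈ 𝒜} cost(s,x,α)`. -/
def value (lam ell : ℝ → Path d → A → ℝ) (h : Path d → ℝ)
    (Φ : ℝ → Path d → (ℝ → A) → Path d) (s : ℝ) (x : Path d) : ℝ :=
  sInf ((fun α => cost T d lam ell h Φ s x α) '' CtrlSet A)

variable {A}

/-- The HJB Hamiltonian `H(t,x,y,z) = inf_{a ∈ A} [ℓ(t,x,a) + f(t,x,a)·z − λ(t,x,a) y]`. -/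
def Hctrl (f : ℝ → Path d → A → E d) (lam ell : ℝ → Path d → A → ℝ) : Ham d :=
  fun t x y z => sInf (Set.range fun a : A => ell t x a + ⟪f t x a, z⟫_ℝ - lam t x a * y)

end Control

section Paths

variable {T : ℝ} {d : ℕ}

lemma Cadlag.exists_bound {x : Path d} (hx : x ∈ Cadlag T d) :
    ∃ R, 0 ≤ R ∧ ∀ s ∈ Icc (0 : ℝ) T, ‖x s‖ ≤ R := by
  have key : ∃ R, ∀ s ∈ Icc (0 : ℝ) T, ‖x s‖ ≤ R := by
    refine isCompact_Icc.induction_on (p := fun S => ∃ R, ∀ s ∈ S, ‖x s‖ ≤ R)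
      ⟨0, by simp⟩ ?_ ?_ ?_
    · rintro s t hst ⟨R, hR⟩
      exact ⟨R, fun r hr => hR r (hst hr)⟩
    · rintro s t ⟨R, hR⟩ ⟨R', hR'⟩
      refine ⟨max R R', ?_⟩
      rintro r (hr | hr)
      · exact (hR r hr).trans (le_max_left _ _)
      · exact (hR' r hr).trans (le_max_right _ _)
    · intro t ht
      have hbdd : ∀ {l : Filter ℝ} {c : E d}, Tendsto x l (𝓝 c) →
          ∀ᶠ s in l, ‖x s‖ ≤ ‖c‖ + 1 := fun h => by
        filter_upwards [h.norm.eventually (gt_mem_nhds (lt_add_one _))] with s hs using hs.le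
      have hleft : ∃ R, ∀ᶠ s in 𝓝[<] t, s ∈ Icc (0 : ℝ) T → ‖x s‖ ≤ R := by
        rcases ht.1.eq_or_lt with h0 | h0
        · refine ⟨0, ?_⟩
          filter_upwards [self_mem_nhdsWithin] with s hs hs'
          exact absurd hs'.1 (not_le.2 (h0 ▸ hs))
        · obtain ⟨l, hl⟩ := hx.2 t ⟨h0, ht.2⟩
          exact ⟨_, (hbdd hl).mono fun s hs _ => hs⟩
      have hright : ∃ R, ∀ᶠ s in 𝓝[≥] t, s ∈ Icc (0 : ℝ) T → ‖x s‖ ≤ R := by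
        rcases ht.2.eq_or_lt with h0 | h0
        · refine ⟨‖x t‖, ?_⟩
          filter_upwards [self_mem_nhdsWithin] with s hs hs'
          rw [le_antisymm (hs'.2.trans h0.ge) hs]
        · exact ⟨_, (hbdd (hx.1 t ⟨ht.1, h0⟩)).mono fun s hs _ => hs⟩
      obtain ⟨R, hR⟩ := hleft
      obtain ⟨R', hR'⟩ := hright
      refine ⟨{s | s ∈ Icc (0 : ℝ) T → ‖x s‖ ≤ max R R'} ∩ Icc 0 T, ?_, max R R', ?_⟩
      · refine inter_mem (mem_nhdsWithin_of_mem_nhds ?_) self_mem_nhdsWithin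
        have h1 : {s | s ∈ Icc (0 : ℝ) T → ‖x s‖ ≤ max R R'} ∈ 𝓝[<] t ⊔ 𝓝[≥] t :=
          ⟨hR.mono fun s hs h => (hs h).trans (le_max_left _ _),
            hR'.mono fun s hs h => (hs h).trans (le_max_right _ _)⟩
        rwa [← nhdsWithin_union, Iio_union_Ici, nhdsWithin_univ] at h1
      · exact fun s hs => hs.1 hs.2
  obtain ⟨R, hR⟩ := key
  exact ⟨max R 0, le_max_right _ _, fun s hs => (hR s hs).trans (le_max_left _ _)⟩

lemma Cadlag.sub {x x' : Path d} (hx : x ∈ Cadlag T d) (hx' : x' ∈ Cadlag T d) :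
    x - x' ∈ Cadlag T d := by
  refine ⟨fun t ht => (hx.1 t ht).sub (hx'.1 t ht), fun t ht => ?_⟩
  obtain ⟨l, hl⟩ := hx.2 t ht
  obtain ⟨l', hl'⟩ := hx'.2 t ht
  exact ⟨_, hl.sub hl'⟩

lemma Cadlag.splice {x x' : Path d} (hx : x ∈ Cadlag T d) {s : ℝ}
    (heq : ∀ t ∈ Icc 0 s, x' t = x t) (hc : ContinuousOn x' (Icc s T)) : x' ∈ Cadlag T d := by
  constructor
  · intro t ht
    rcases lt_or_ge t s with hts | hts
    · refine (hx.1 t ht).congr_of_eventuallyEq ?_ (heq t ⟨ht.1, hts.le⟩)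
      filter_upwards [self_mem_nhdsWithin, mem_nhdsWithin_of_mem_nhds (gt_mem_nhds hts)]
        with r hr hr'
      exact heq r ⟨ht.1.trans hr, hr'.le⟩
    · refine (hc t ⟨hts, ht.2.le⟩).mono_of_mem_nhdsWithin ?_
      filter_upwards [self_mem_nhdsWithin, mem_nhdsWithin_of_mem_nhds (gt_mem_nhds ht.2)]
        with r hr hr'
      exact ⟨hts.trans hr, hr'.le⟩
  · intro t ht
    rcases le_or_gt t s with hts | hts
    · obtain ⟨l, hl⟩ := hx.2 t ht
      refine ⟨l, hl.congr' ?_⟩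
      filter_upwards [self_mem_nhdsWithin, mem_nhdsWithin_of_mem_nhds (lt_mem_nhds ht.1)]
        with r hr hr'
      exact (heq r ⟨hr'.le, hr.le.trans hts⟩).symm
    · refine ⟨x' t, (hc t ⟨hts.le, ht.2⟩).mono_left ?_⟩
      refine nhdsWithin_le_iff.2 ?_
      filter_upwards [self_mem_nhdsWithin, mem_nhdsWithin_of_mem_nhds (lt_mem_nhds hts)]
        with r hr hr'
      exact ⟨hr'.le, hr.le.trans ht.2⟩

lemma Cadlag.le_runSup {x : Path d} (hx : x ∈ Cadlag T d) {s t : ℝ} (hs : s ∈ Icc 0 t)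
    (ht : t ≤ T) : ‖x s‖ ≤ runSup d x t := by
  obtain ⟨R, -, hR⟩ := Cadlag.exists_bound hx
  refine le_csSup ⟨R, ?_⟩ (mem_image_of_mem _ hs)
  rintro _ ⟨r, hr, rfl⟩
  exact hR r ⟨hr.1, hr.2.trans ht⟩

lemma runSup_le {x : Path d} {t R : ℝ} (hR : 0 ≤ R) (h : ∀ s ∈ Icc 0 t, ‖x s‖ ≤ R) :
    runSup d x t ≤ R := by
  refine Real.sSup_le ?_ hR
  rintro _ ⟨r, hr, rfl⟩
  exact h r hr

lemma runSup_nonneg (x : Path d) (t : ℝ) : 0 ≤ runSup d x t :=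
  Real.sSup_nonneg (by rintro _ ⟨r, -, rfl⟩; exact norm_nonneg _)

lemma Cadlag.runSup_mono {x : Path d} (hx : x ∈ Cadlag T d) {s t : ℝ} (hst : s ≤ t)
    (ht : t ≤ T) : runSup d x s ≤ runSup d x t :=
  runSup_le (runSup_nonneg _ _) fun _ hr => Cadlag.le_runSup hx ⟨hr.1, hr.2.trans hst⟩ ht

lemma supDist_eq (x y : Path d) : supDist T d x y = runSup d (x - y) T := rfl

lemma supDist_self (x : Path d) : supDist T d x x = 0 :=
  le_antisymm (by rw [supDist_eq]; exact runSup_le le_rfl (by simp)) (runSup_nonneg _ _)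

lemma supDist_le {x y : Path d} {R : ℝ} (hR : 0 ≤ R) (h : ∀ s ∈ Icc 0 T, ‖x s - y s‖ ≤ R) :
    supDist T d x y ≤ R :=
  runSup_le hR h

lemma Cadlag.le_supDist {x y : Path d} (hx : x ∈ Cadlag T d) (hy : y ∈ Cadlag T d) {s : ℝ}
    (hs : s ∈ Icc 0 T) : ‖x s - y s‖ ≤ supDist T d x y :=
  Cadlag.le_runSup (Cadlag.sub hx hy) hs le_rfl

lemma supDist_comm (x y : Path d) : supDist T d x y = supDist T d y x :=
  congrArg sSup (image_congr fun _ _ => norm_sub_rev _ _)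

lemma Cadlag.supDist_triangle {x y z : Path d} (hx : x ∈ Cadlag T d) (hy : y ∈ Cadlag T d)
    (hz : z ∈ Cadlag T d) : supDist T d x z ≤ supDist T d x y + supDist T d y z := by
  refine supDist_le (add_nonneg (runSup_nonneg _ _) (runSup_nonneg _ _)) fun s hs => ?_
  calc ‖x s - z s‖ = ‖(x s - y s) + (y s - z s)‖ := by congr 1; abel
    _ ≤ _ := (norm_add_le _ _).trans
      (add_le_add (Cadlag.le_supDist hx hy hs) (Cadlag.le_supDist hy hz hs))

end Paths

section Gronwall

lemma integral_weight_le {K s t : ℝ} :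
    ∫ r in s..t, K * Real.exp (2 * K * r) ≤ Real.exp (2 * K * t) / 2 := by
  have h : ∀ r ∈ uIcc s t, HasDerivAt (fun r => Real.exp (2 * K * r) / 2)
      (K * Real.exp (2 * K * r)) r := by
    intro r _
    have := (((hasDerivAt_id r).const_mul (2 * K)).exp).div_const 2
    exact this.congr_deriv (by simp only [id]; ring)
  rw [intervalIntegral.integral_eq_sub_of_hasDerivAt h
    (Continuous.intervalIntegrable (by fun_prop) _ _)]
  have := Real.exp_pos (2 * K * s)
  linarith

/-- A weighted bound on the integrand gives a weighted bound on the integral with half the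
constant. -/
lemma norm_integral_le_weight {V : Type*} [NormedAddCommGroup V] [NormedSpace ℝ V]
    {F : ℝ → V} {K S s t : ℝ} (hS : 0 ≤ S) (hst : s ≤ t)
    (h : ∀ᵐ r, r ∈ Ioc s t → ‖F r‖ ≤ K * (S * Real.exp (2 * K * r))) :
    ‖∫ r in s..t, F r‖ ≤ S / 2 * Real.exp (2 * K * t) := by
  refine (intervalIntegral.norm_integral_le_of_norm_le hst h
    (Continuous.intervalIntegrable (by fun_prop) _ _)).trans ?_
  have : (fun r => K * (S * Real.exp (2 * K * r))) = fun r => S * (K * Real.exp (2 * K * r)) := by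
    funext r; ring
  rw [this, intervalIntegral.integral_const_mul]
  have := mul_le_mul_of_nonneg_left (integral_weight_le (K := K) (s := s) (t := t)) hS
  linarith

/-- A Gronwall inequality for bounded functions, in weighted form. -/
lemma gronwall_weight {ι : Type*} {D w : ι → ℝ} {a B : ℝ} (ha : 0 ≤ a) (hw : ∀ i, 1 ≤ w i)
    (hB : ∀ i, D i ≤ B)
    (h : ∀ S, 0 ≤ S → (∀ i, D i ≤ S * w i) → ∀ i, D i ≤ (a + S / 2) * w i) (i : ι) :
    D i ≤ 2 * a * w i := by
  have key : ∀ n : ℕ, ∀ i, D i ≤ (2 * a + |B| / 2 ^ n) * w i := by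
    intro n
    induction n with
    | zero =>
      intro i
      have h1 := hw i
      have h2 := le_abs_self B
      have h3 := abs_nonneg B
      have := hB i
      simp only [pow_zero, div_one]
      nlinarith [mul_nonneg ha (by linarith : 0 ≤ w i)]
    | succ n ih =>
      intro i
      refine (h _ (by positivity) ih i).trans (le_of_eq ?_)
      rw [pow_succ]; field_simp; ring
  have hlim : Tendsto (fun n : ℕ => (2 * a + |B| / 2 ^ n) * w i) atTop
      (𝓝 ((2 * a + |B| * 0) * w i)) := by
    refine (tendsto_const_nhds.add (Tendsto.const_mul _ ?_)).mul_const _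
    have := tendsto_pow_atTop_nhds_zero_of_lt_one (r := (1 / 2 : ℝ)) (by norm_num) (by norm_num)
    refine this.congr fun n => by simp
  simpa using ge_of_tendsto' hlim fun n => key n i

end Gronwall

section Caratheodory

variable {A : Type*} [TopologicalSpace A]

/-- A countable family of continuous functions which approximates every continuous function
uniformly on finitely many of the compact pieces. -/
lemma exists_approx_family (hA : SigmaCompactMetrizable A) (V : Type*) [NormedAddCommGroup V]
    [SecondCountableTopology V] :
    ∃ (K : ℕ → Set A) (S : ℕ → Set A) (φ : ℕ → C(A, V)), (⋃ n, K n) = univ ∧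
      (∀ n, (S n).Countable ∧ S n ⊆ K n ∧ K n ⊆ closure (S n)) ∧
      ∀ (g : C(A, V)) (m : ℕ) (ε : ℝ), 0 < ε →
        ∃ j, ∀ n ≤ m, ∀ a ∈ K n, ‖g a - φ j a‖ < ε := by
  obtain ⟨K, hK, hM, hU⟩ := hA
  have hcs : ∀ n, CompactSpace (K n) := fun n => isCompact_iff_compactSpace.1 (hK n)
  have hsc : ∀ n, SecondCountableTopology (K n) := fun n => by
    let _ := TopologicalSpace.metrizableSpaceMetric (K n)
    infer_instance
  have hS : ∀ n, ∃ S : Set A, S.Countable ∧ S ⊆ K n ∧ K n ⊆ closure S := by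
    intro n
    obtain ⟨s, hs, hd⟩ := TopologicalSpace.exists_countable_dense (K n)
    refine ⟨Subtype.val '' s, hs.image _, by rintro _ ⟨a, -, rfl⟩; exact a.2, ?_⟩
    intro a ha
    exact image_closure_subset_closure_image continuous_subtype_val
      ⟨⟨a, ha⟩, hd ⟨a, ha⟩, rfl⟩
  choose S hS using hS
  let R : C(A, V) → ∀ n, C(K n, V) := fun g n => g.restrict (K n)
  obtain ⟨c, hc, hcd⟩ := TopologicalSpace.exists_countable_dense (range R)
  have hne : c.Nonempty := by
    have : (range R).Nonempty := ⟨R 0, mem_range_self _⟩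
    have := this.to_subtype
    exact hcd.nonempty
  obtain ⟨e, rfl⟩ := hc.exists_eq_range hne
  choose φ hφ using fun j => (e j).2
  refine ⟨K, S, φ, hU, hS, fun g m ε hε => ?_⟩
  have hopen : IsOpen {p : range R | ∀ n ∈ Iic m, dist (R g n) (p.1 n) < ε} := by
    have : {p : range R | ∀ n ∈ Iic m, dist (R g n) (p.1 n) < ε} =
        ⋂ n ∈ Iic m, {p : range R | dist (R g n) (p.1 n) < ε} := by
      ext; simp
    rw [this]
    refine (finite_Iic m).isOpen_biInter fun n _ => ?_
    exact isOpen_lt (continuous_const.dist ((continuous_apply n).comp continuous_subtype_val))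
      continuous_const
  obtain ⟨_, ⟨j, rfl⟩, hp⟩ := hcd.exists_mem_open hopen
    ⟨⟨R g, mem_range_self _⟩, fun n _ => by simpa using hε⟩
  refine ⟨j, fun n hn a ha => ?_⟩
  have h1 := hp n hn
  rw [← hφ j] at h1
  have h2 := (ContinuousMap.dist_lt_iff hε).1 h1 ⟨a, ha⟩
  rwa [dist_eq_norm] at h2

lemma SigmaCompactMetrizable.separableSpace (hA : SigmaCompactMetrizable A) :
    TopologicalSpace.SeparableSpace A := by
  obtain ⟨K, S, -, hU, hS, -⟩ := exists_approx_family hA ℝ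
  refine ⟨⋃ n, S n, countable_iUnion fun n => (hS n).1, fun a => ?_⟩
  obtain ⟨n, hn⟩ := mem_iUnion.1 (hU ▸ mem_univ a)
  exact closure_mono (subset_iUnion S n) ((hS n).2.2 hn)

/-- Measurable choice of the first index satisfying a property, when there is one. -/
lemma exists_measurable_index {X : Type*} [MeasurableSpace X] (p : X → ℕ → Prop)
    (hp : ∀ k, MeasurableSet {x | p x k}) :
    ∃ k : X → ℕ, Measurable k ∧ ∀ x, (∃ j, p x j) → p x (k x) := by
  classical
  have hq : ∀ x, ∃ N, p x N ∨ ∀ j, ¬ p x j := fun x => by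
    by_cases h : ∃ j, p x j
    · exact h.imp fun j hj => Or.inl hj
    · exact ⟨0, Or.inr (not_exists.1 h)⟩
  refine ⟨fun x => Nat.find (hq x), ?_, fun x hx => ?_⟩
  · refine measurable_find hq fun k => ?_
    refine (hp k).union ?_
    have : {x | ∀ j, ¬ p x j} = ⋂ j, {x | p x j}ᶜ := by ext; simp
    exact (congrArg MeasurableSet this).mpr (MeasurableSet.iInter fun j => (hp j).compl)
  · rcases Nat.find_spec (hq x) with h | h
    · exact h
    · obtain ⟨j, hj⟩ := hx
      exact absurd hj (h j)

variable [MeasurableSpace A] [BorelSpace A]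

/-- Carathéodory functions are superpositionally measurable. -/
lemma aemeasurable_caratheodory (hA : SigmaCompactMetrizable A) {V : Type*}
    [NormedAddCommGroup V] [SecondCountableTopology V] [MeasurableSpace V] [BorelSpace V]
    {μ : Measure ℝ} {g : ℝ → A → V} (hg : ∀ a, Measurable fun t => g t a)
    (hc : ∀ᵐ t ∂μ, Continuous (g t)) {α : ℝ → A} (hα : Measurable α) :
    AEMeasurable (fun t => g t (α t)) μ := by
  obtain ⟨K, S, φ, hU, hS, hφ⟩ := exists_approx_family hA V
  have hk : ∀ m : ℕ, ∃ k : ℝ → ℕ, Measurable k ∧ ∀ t,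
      (∃ j, ∀ n ≤ m, ∀ a ∈ S n, ‖g t a - φ j a‖ ≤ 1 / ((m : ℝ) + 1)) →
      ∀ n ≤ m, ∀ a ∈ S n, ‖g t a - φ (k t) a‖ ≤ 1 / ((m : ℝ) + 1) := by
    intro m
    refine exists_measurable_index
      (fun t j => ∀ n ≤ m, ∀ a ∈ S n, ‖g t a - φ j a‖ ≤ 1 / ((m : ℝ) + 1)) fun j => ?_
    have : {t | ∀ n ≤ m, ∀ a ∈ S n, ‖g t a - φ j a‖ ≤ 1 / ((m : ℝ) + 1)} =
        ⋂ n ∈ Iic m, ⋂ a ∈ S n, {t | ‖g t a - φ j a‖ ≤ 1 / ((m : ℝ) + 1)} := by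
      ext; simp
    rw [this]
    refine MeasurableSet.biInter (to_countable _) fun n _ =>
      MeasurableSet.biInter (hS n).1 fun a _ => ?_
    exact measurableSet_le ((hg a).sub_const _).norm measurable_const
  choose k hkm hk using hk
  refine aemeasurable_of_tendsto_metrizable_ae atTop (f := fun m t => φ (k m t) (α t))
    (fun m => Measurable.aemeasurable ?_) ?_
  · have h1 : Measurable fun p : ℕ × A => φ p.1 p.2 :=
      measurable_from_prod_countable_right fun j => (φ j).continuous.measurable
    exact h1.comp ((hkm m).prodMk hα)
  · filter_upwards [hc] with t ht
    obtain ⟨n, hn⟩ := mem_iUnion.1 (hU ▸ mem_univ (α t))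
    rw [tendsto_iff_norm_sub_tendsto_zero]
    refine squeeze_zero' (Eventually.of_forall fun _ => norm_nonneg _) ?_
      (tendsto_one_div_add_atTop_nhds_zero_nat (𝕜 := ℝ))
    filter_upwards [eventually_ge_atTop n] with m hm
    have hm1 : (0 : ℝ) < 1 / ((m : ℝ) + 1) := by positivity
    obtain ⟨j, hj⟩ := hφ ⟨g t, ht⟩ m _ hm1
    have h2 := hk m t ⟨j, fun n hn a ha => (hj n hn a ((hS n).2.1 ha)).le⟩ n hm
    have h3 : IsClosed {a | ‖g t a - φ (k m t) a‖ ≤ 1 / ((m : ℝ) + 1)} :=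
      isClosed_le (ht.sub (φ _).continuous).norm continuous_const
    rw [norm_sub_rev]
    exact closure_minimal h2 h3 ((hS n).2.2 hn)

end Caratheodory

section Selection

variable {A : Type*} [TopologicalSpace A]

lemma ciInf_dense [TopologicalSpace.SeparableSpace A] [Nonempty A] {g : A → ℝ}
    (hg : Continuous g) (hb : BddBelow (range g)) :
    ⨅ a, g a = ⨅ k, g (TopologicalSpace.denseSeq A k) := by
  have hb' : BddBelow (range fun k => g (TopologicalSpace.denseSeq A k)) :=
    hb.mono (range_comp_subset_range _ _)
  refine le_antisymm (le_ciInf fun k => ciInf_le hb _) (le_ciInf fun a => ?_)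
  have hcl : IsClosed {a | ⨅ k, g (TopologicalSpace.denseSeq A k) ≤ g a} :=
    isClosed_le continuous_const hg
  have := closure_minimal (s := range (TopologicalSpace.denseSeq A))
    (by rintro _ ⟨k, rfl⟩; exact ciInf_le hb' k) hcl
  exact this (TopologicalSpace.denseRange_denseSeq A a)

/-- Measurable near-minimizers with values in a countable dense set. -/
lemma exists_measurable_near_min [MeasurableSpace A]
    [TopologicalSpace.SeparableSpace A] [Nonempty A] {μ : Measure ℝ} {g : ℝ → A → ℝ}
    (hg : ∀ a, Measurable fun t => g t a)
    (hc : ∀ᵐ t ∂μ, Continuous (g t) ∧ BddBelow (range (g t))) {ε : ℝ} (hε : 0 < ε) :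
    ∃ β : ℝ → A, Measurable β ∧ ∀ᵐ t ∂μ, g t (β t) ≤ (⨅ a, g t a) + ε := by
  obtain ⟨k, hk, hk'⟩ := exists_measurable_index
    (fun t j => g t (TopologicalSpace.denseSeq A j) ≤
      (⨅ i, g t (TopologicalSpace.denseSeq A i)) + ε)
    fun j => measurableSet_le (hg _) ((Measurable.iInf fun i => hg _).add_const _)
  refine ⟨fun t => TopologicalSpace.denseSeq A (k t), (measurable_from_nat).comp hk, ?_⟩
  filter_upwards [hc] with t ht
  rw [ciInf_dense ht.1 ht.2]
  refine hk' t ?_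
  obtain ⟨i, hi⟩ := exists_lt_of_ciInf_lt
    (lt_add_of_pos_right (⨅ i, g t (TopologicalSpace.denseSeq A i)) hε)
  exact ⟨i, hi.le⟩

end Selection

section LipschitzPaths

variable {T : ℝ} {d : ℕ} {L s : ℝ}

lemma LipschitzWith.intervalIntegrable_deriv {X : Path d} {K : NNReal} (hX : LipschitzWith K X)
    (a b : ℝ) : IntervalIntegrable (deriv X) volume a b := by
  refine (intervalIntegrable_const (c := (K : ℝ))).mono_fun
    (measurable_deriv X).aestronglyMeasurable (Eventually.of_forall fun t => ?_)
  simpa using norm_deriv_le_of_lipschitz hX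

lemma LipschitzWith.integral_deriv {X : Path d} {K : NNReal} (hX : LipschitzWith K X) (a b : ℝ) :
    ∫ t in a..b, deriv X t = X b - X a := by
  ext i
  let P : E d →L[ℝ] ℝ := EuclideanSpace.proj i
  have h1 : P (∫ t in a..b, deriv X t) = ∫ t in a..b, P (deriv X t) :=
    (ContinuousLinearMap.intervalIntegral_comp_comm P
      (LipschitzWith.intervalIntegrable_deriv hX a b)).symm
  have h2 : LipschitzOnWith (‖P‖₊ * K) (fun t => P (X t)) (uIcc a b) :=
    (P.lipschitz.comp hX).lipschitzOnWith
  have h3 := h2.absolutelyContinuousOnInterval.integral_deriv_eq_sub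
  have h4 : ∫ t in a..b, P (deriv X t) = ∫ t in a..b, deriv (fun t => P (X t)) t := by
    refine intervalIntegral.integral_congr_ae ?_
    filter_upwards [hX.ae_differentiableAt] with t ht _
    exact ((P.hasFDerivAt.comp_hasDerivAt t ht.hasDerivAt).deriv).symm
  exact h1.trans (h4.trans h3)

/-- The increments of `x` on `[s, T]` obey the growth bound of `X^L`. -/
def LipPath (T : ℝ) (d : ℕ) (L s : ℝ) (x : Path d) : Prop :=
  ∀ t t', s ≤ t → t ≤ t' → t' ≤ T → ‖x t' - x t‖ ≤ L * (1 + runSup d x t') * (t' - t)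

lemma XDeriv.intervalIntegrable {x g : Path d} (hg : XDeriv T d L s x g) {t t' : ℝ}
    (h1 : s ≤ t) (h2 : t ≤ t') (h3 : t' ≤ T) : IntervalIntegrable g volume t t' :=
  (intervalIntegrable_iff_integrableOn_Icc_of_le h2).2 (hg.1.mono_set (Icc_subset_Icc h1 h3))

lemma XDeriv.sub_eq {x g : Path d} (hg : XDeriv T d L s x g) {t t' : ℝ}
    (h1 : s ≤ t) (h2 : t ≤ t') (h3 : t' ≤ T) : x t' - x t = ∫ r in t..t', g r := by
  rw [hg.2.1 t' ⟨h1.trans h2, h3⟩, hg.2.1 t ⟨h1, h2.trans h3⟩,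
    ← intervalIntegral.integral_add_adjacent_intervals
      (XDeriv.intervalIntegrable hg le_rfl h1 (h2.trans h3))
      (XDeriv.intervalIntegrable hg h1 h2 h3)]
  abel

lemma ae_Ioc_of_restrict_Ioo {p : ℝ → Prop} {a b : ℝ}
    (h : ∀ᵐ t ∂(volume.restrict (Ioo a b)), p t) : ∀ᵐ t : ℝ, t ∈ Ioc a b → p t := by
  rw [restrict_Ioo_eq_restrict_Ioc] at h
  exact (ae_restrict_iff' measurableSet_Ioc).1 h

lemma XDeriv.ae_bound {x g : Path d} (hg : XDeriv T d L s x g) :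
    ∀ᵐ t : ℝ, t ∈ Ioc s T → ‖g t‖ ≤ L * (1 + runSup d x t) :=
  ae_Ioc_of_restrict_Ioo hg.2.2

lemma XDeriv.lipPath {x g : Path d} (hL : 0 ≤ L) (hx : x ∈ Cadlag T d)
    (hg : XDeriv T d L s x g) : LipPath T d L s x := by
  intro t t' h1 h2 h3
  rw [XDeriv.sub_eq hg h1 h2 h3]
  have : ‖∫ r in t..t', g r‖ ≤ L * (1 + runSup d x t') * |t' - t| := by
    refine intervalIntegral.norm_integral_le_of_norm_le_const_ae ?_
    filter_upwards [XDeriv.ae_bound hg] with r hr hr'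
    rw [uIoc_of_le h2] at hr'
    refine (hr ⟨h1.trans_lt hr'.1, hr'.2.trans h3⟩).trans ?_
    have := Cadlag.runSup_mono hx hr'.2 h3
    gcongr
  rwa [abs_of_nonneg (sub_nonneg.2 h2)] at this

lemma LipPath.norm_sub_le {x : Path d} {B : ℝ} (hL : 0 ≤ L) (hx : x ∈ Cadlag T d)
    (h : LipPath T d L s x) (hB : 1 + runSup d x T ≤ B) {t t' : ℝ} (ht : t ∈ Icc s T)
    (ht' : t' ∈ Icc s T) : ‖x t' - x t‖ ≤ L * B * |t' - t| := by
  wlog htt : t ≤ t' generalizing t t'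
  · rw [norm_sub_rev, abs_sub_comm]
    exact this ht' ht (le_of_not_ge htt)
  refine (h t t' ht.1 htt ht'.2).trans ?_
  have := Cadlag.runSup_mono hx ht'.2 le_rfl
  rw [abs_of_nonneg (sub_nonneg.2 htt)]
  have := sub_nonneg.2 htt
  gcongr
  linarith

lemma LipPath.exists_xDeriv {x : Path d} (hL : 0 ≤ L) (hs : s ≤ T) (hx : x ∈ Cadlag T d)
    (h : LipPath T d L s x) : ∃ g, XDeriv T d L s x g := by
  let X : Path d := fun r => x (projIcc s T hs r)
  have hXx : ∀ r ∈ Icc s T, X r = x r := fun r hr => by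
    simp only [X, projIcc_of_mem hs hr]
  have hB : 0 ≤ 1 + runSup d x T := by linarith [runSup_nonneg x T]
  have hX : LipschitzWith (Real.toNNReal (L * (1 + runSup d x T))) X := by
    refine LipschitzWith.of_dist_le_mul fun a b => ?_
    rw [Real.coe_toNNReal _ (by positivity), dist_eq_norm]
    refine (LipPath.norm_sub_le hL hx h le_rfl (projIcc s T hs b).2 (projIcc s T hs a).2).trans ?_
    gcongr
    exact abs_projIcc_sub_projIcc hs
  refine ⟨deriv X, ?_, ?_, ?_⟩
  · exact (intervalIntegrable_iff_integrableOn_Icc_of_le hs).1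
      (LipschitzWith.intervalIntegrable_deriv hX s T)
  · intro t ht
    rw [LipschitzWith.integral_deriv hX, hXx t ht, hXx s ⟨le_rfl, hs⟩]
    abel
  · refine (ae_restrict_iff' measurableSet_Ioo).2 ?_
    filter_upwards [hX.ae_differentiableAt] with t ht htI
    have h1 := (hasDerivAt_iff_tendsto_slope_left_right.1 ht.hasDerivAt).1
    refine le_of_tendsto h1.norm ?_
    filter_upwards [self_mem_nhdsWithin, mem_nhdsWithin_of_mem_nhds (lt_mem_nhds htI.1)]
      with r hr hr'
    have hrt : (0 : ℝ) < t - r := sub_pos.2 hr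
    rw [slope_def_module, norm_smul, norm_inv, Real.norm_eq_abs, abs_sub_comm, abs_of_pos hrt,
      inv_mul_le_iff₀ hrt, mul_comm, hXx r ⟨le_of_lt hr', (le_of_lt hr).trans htI.2.le⟩,
      hXx t ⟨htI.1.le, htI.2.le⟩, norm_sub_rev]
    exact h r t (le_of_lt hr') (le_of_lt hr) htI.2.le

lemma mem_XSet_iff {x₀ x : Path d} (hL : 0 ≤ L) (hs : s ≤ T) :
    x ∈ XSet T d L s x₀ ↔
      x ∈ Cadlag T d ∧ (∀ t ∈ Icc 0 s, x t = x₀ t) ∧ LipPath T d L s x := by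
  constructor
  · rintro ⟨hx, h0, g, hg⟩
    exact ⟨hx, h0, XDeriv.lipPath hL hx hg⟩
  · rintro ⟨hx, h0, h⟩
    exact ⟨hx, h0, LipPath.exists_xDeriv hL hs hx h⟩

/-- A priori bound on the paths in `X^L`. -/
lemma XSet.runSup_le {x₀ x : Path d} {R : ℝ} (hL : 0 ≤ L) (hs : s ∈ Icc 0 T)
    (hR : 0 ≤ R) (hx₀ : ∀ t ∈ Icc 0 s, ‖x₀ t‖ ≤ R) (hx : x ∈ XSet T d L s x₀) :
    1 + runSup d x T ≤ 2 * (1 + R) * Real.exp (2 * L * T) := by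
  obtain ⟨hxc, h0, g, hg⟩ := hx
  obtain ⟨B, hB0, hB⟩ := Cadlag.exists_bound hxc
  have hT : 0 ≤ T := hs.1.trans hs.2
  have hw : ∀ t : ℝ, 0 ≤ t → 1 ≤ Real.exp (2 * L * t) := fun t ht =>
    Real.one_le_exp (by positivity)
  have key : ∀ t : Icc (0 : ℝ) T, 1 + ‖x t‖ ≤ 2 * (1 + R) * Real.exp (2 * L * t) := by
    refine gronwall_weight (D := fun t : Icc (0 : ℝ) T => 1 + ‖x t‖)
      (w := fun t => Real.exp (2 * L * t)) (B := 1 + B) (by linarith) (fun t => hw t t.2.1)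
      (fun t => by linarith [hB t t.2]) ?_
    intro S hS hD ⟨t, ht⟩
    rcases le_total t s with hts | hts
    · have := hx₀ t ⟨ht.1, hts⟩
      have h1 := hw t ht.1
      simp only [h0 t ⟨ht.1, hts⟩]
      nlinarith
    · have h1 : ‖∫ r in s..t, g r‖ ≤ S / 2 * Real.exp (2 * L * t) := by
        refine norm_integral_le_weight hS hts ?_
        filter_upwards [XDeriv.ae_bound hg] with r hr hr'
        refine (hr ⟨hr'.1, hr'.2.trans ht.2⟩).trans ?_
        have hr0 : 0 ≤ r := hs.1.trans hr'.1.le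
        have h3 : runSup d x r ≤ S * Real.exp (2 * L * r) - 1 := by
          refine PHJ.runSup_le ?_ fun q hq => ?_
          · have := hD ⟨0, le_rfl, hT⟩
            have h4 := norm_nonneg (x 0)
            have h5 := hw r hr0
            simp only [mul_zero, Real.exp_zero, mul_one] at this
            nlinarith
          · have := hD ⟨q, hq.1, hq.2.trans (hr'.2.trans ht.2)⟩
            have h4 : Real.exp (2 * L * q) ≤ Real.exp (2 * L * r) :=
              Real.exp_le_exp.2 (by have := hq.2; gcongr)
            have := mul_le_mul_of_nonneg_left h4 hS
            simp only at *
            linarith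
        gcongr
        linarith
      have h2 : ‖x t‖ ≤ R + ‖∫ r in s..t, g r‖ := by
        rw [hg.2.1 t ⟨hts, ht.2⟩]
        refine (norm_add_le _ _).trans ?_
        have := hx₀ s ⟨hs.1, le_rfl⟩
        rw [h0 s ⟨hs.1, le_rfl⟩]
        linarith
      have h3 := hw t ht.1
      simp only
      nlinarith
  have h1 := hw T hT
  have : runSup d x T ≤ 2 * (1 + R) * Real.exp (2 * L * T) - 1 := by
    refine PHJ.runSup_le (by nlinarith) fun t ht => ?_
    have h2 := key ⟨t, ht⟩
    have h4 : Real.exp (2 * L * t) ≤ Real.exp (2 * L * T) :=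
      Real.exp_le_exp.2 (by have := ht.2; gcongr)
    have := mul_le_mul_of_nonneg_left h4 (by positivity : 0 ≤ 2 * (1 + R))
    simp only at h2
    linarith
  linarith

lemma runSup_congr {x x' : Path d} {t : ℝ} (h : ∀ r ∈ Icc 0 t, x r = x' r) :
    runSup d x t = runSup d x' t :=
  congrArg sSup (image_congr fun r hr => by rw [h r hr])

/-- Concatenation of paths in `X^L`. -/
lemma XSet.trans {x₀ x x' : Path d} {t : ℝ} (hL : 0 ≤ L) (hst : s ≤ t) (ht : t ≤ T)
    (hs : 0 ≤ s) (hx : x ∈ XSet T d L s x₀) (hx' : x' ∈ XSet T d L t x) :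
    x' ∈ XSet T d L s x₀ := by
  rw [mem_XSet_iff hL (hst.trans ht)] at hx ⊢
  rw [mem_XSet_iff hL ht] at hx'
  obtain ⟨hc', h0', hl'⟩ := hx'
  refine ⟨hc', fun r hr => (h0' r ⟨hr.1, hr.2.trans hst⟩).trans (hx.2.1 r hr), ?_⟩
  have hleft : ∀ a b, s ≤ a → a ≤ b → b ≤ t →
      ‖x' b - x' a‖ ≤ L * (1 + runSup d x' b) * (b - a) := by
    intro a b h1 h2 h3
    rw [h0' a ⟨hs.trans h1, h2.trans h3⟩, h0' b ⟨hs.trans (h1.trans h2), h3⟩,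
      runSup_congr fun r hr => h0' r ⟨hr.1, hr.2.trans h3⟩]
    exact hx.2.2 a b h1 h2 (h3.trans ht)
  intro a b h1 h2 h3
  rcases le_total b t with hb | hb
  · exact hleft a b h1 h2 hb
  rcases le_total t a with ha | ha
  · exact hl' a b ha h2 h3
  · have e1 := hl' t b le_rfl hb h3
    have e2 := hleft a t h1 ha le_rfl
    have e3 := Cadlag.runSup_mono hc' hb h3
    have e4 : ‖x' b - x' a‖ ≤ ‖x' b - x' t‖ + ‖x' t - x' a‖ :=
      norm_sub_le_norm_sub_add_norm_sub _ _ _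
    have e5 : L * (1 + runSup d x' t) * (t - a) ≤ L * (1 + runSup d x' b) * (t - a) := by
      have := sub_nonneg.2 ha
      gcongr
    linarith

/-- Sequential compactness of `X^L(s, x₀)`. -/
lemma XSet.exists_tendsto_subseq {x₀ : Path d} (hL : 0 ≤ L) (hs : s ∈ Icc 0 T)
    (hx₀ : x₀ ∈ Cadlag T d) {x : ℕ → Path d} (hx : ∀ n, x n ∈ XSet T d L s x₀) :
    ∃ x' ∈ XSet T d L s x₀, ∃ φ : ℕ → ℕ, StrictMono φ ∧
      Tendsto (fun n => supDist T d (x (φ n)) x') atTop (𝓝 0) := by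
  obtain ⟨R, hR0, hR⟩ := Cadlag.exists_bound hx₀
  set B := 2 * (1 + R) * Real.exp (2 * L * T) with hBdef
  have hB : ∀ n, 1 + runSup d (x n) T ≤ B := fun n =>
    XSet.runSup_le hL hs hR0 (fun t ht => hR t ⟨ht.1, ht.2.trans hs.2⟩) (hx n)
  have hB0 : 0 ≤ B := by positivity
  have hx' := fun n => (mem_XSet_iff hL hs.2).1 (hx n)
  let K : NNReal := Real.toNNReal (L * B)
  have hK : (K : ℝ) = L * B := Real.coe_toNNReal _ (by positivity)
  have hlip : ∀ n, LipschitzWith K fun t : Icc s T => x n t := fun n =>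
    LipschitzWith.of_dist_le_mul fun a b => by
      rw [hK, dist_eq_norm, Subtype.dist_eq, Real.dist_eq]
      exact LipPath.norm_sub_le hL (hx' n).1 (hx' n).2.2 (hB n) b.2 a.2
  let F : ℕ → BoundedContinuousFunction (Icc s T) (E d) := fun n =>
    BoundedContinuousFunction.mkOfCompact ⟨_, (hlip n).continuous⟩
  have hcomp : IsCompact (closure (range F)) := by
    refine BoundedContinuousFunction.arzela_ascoli (Metric.closedBall 0 B)
      (isCompact_closedBall _ _) (range F) ?_ ?_
    · rintro _ t ⟨n, rfl⟩
      rw [mem_closedBall_zero_iff]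
      have h1 : ‖x n t‖ ≤ runSup d (x n) T :=
        Cadlag.le_runSup (hx' n).1 ⟨hs.1.trans t.2.1, t.2.2⟩ le_rfl
      have h2 := hB n
      exact h1.trans (by linarith)
    · refine (LipschitzWith.uniformEquicontinuous _ K ?_).equicontinuous
      rintro ⟨_, n, rfl⟩
      exact hlip n
  obtain ⟨G, -, φ, hφ, hlim⟩ := hcomp.tendsto_subseq fun n => subset_closure (mem_range_self n)
  let y : Path d := fun t => if t ≤ s then x₀ t else G (projIcc s T hs.2 t)
  have hGs : G ⟨s, le_rfl, hs.2⟩ = x₀ s := by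
    have h1 : Tendsto (fun n => F (φ n) ⟨s, le_rfl, hs.2⟩) atTop (𝓝 (G ⟨s, le_rfl, hs.2⟩)) :=
      ((continuous_eval_const _).tendsto G).comp hlim
    refine tendsto_nhds_unique h1 (tendsto_const_nhds.congr fun n => ?_)
    exact ((hx' (φ n)).2.1 s ⟨hs.1, le_rfl⟩).symm
  have hyG : ∀ t (ht : t ∈ Icc s T), y t = G ⟨t, ht⟩ := fun t ht => by
    rcases ht.1.eq_or_lt with h | h
    · subst h; simp only [y, le_refl, if_true, hGs]
    · simp only [y, not_le.2 h, if_false, projIcc_of_mem hs.2 ht]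
  have hyx : ∀ t ∈ Icc 0 s, y t = x₀ t := fun t ht => by simp only [y, ht.2, if_true]
  have hyc : y ∈ Cadlag T d := by
    refine Cadlag.splice hx₀ hyx ?_
    rw [continuousOn_iff_continuous_domRestrict]
    exact G.continuous.congr fun t => (hyG t t.2).symm
  have hd : Tendsto (fun n => supDist T d (x (φ n)) y) atTop (𝓝 0) := by
    have h1 := tendsto_iff_dist_tendsto_zero.1 hlim
    refine squeeze_zero (fun n => runSup_nonneg _ _) (fun n => ?_) h1
    refine supDist_le dist_nonneg fun t ht => ?_
    rcases le_total t s with hts | hts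
    · rw [(hx' (φ n)).2.1 t ⟨ht.1, hts⟩, hyx t ⟨ht.1, hts⟩, sub_self, norm_zero]
      exact dist_nonneg
    · rw [hyG t ⟨hts, ht.2⟩, ← dist_eq_norm]
      exact BoundedContinuousFunction.dist_coe_le_dist (f := F (φ n)) (g := G) ⟨t, hts, ht.2⟩
  refine ⟨y, (mem_XSet_iff hL hs.2).2 ⟨hyc, hyx, ?_⟩, φ, hφ, hd⟩
  intro t t' h1 h2 h3
  have hpt : ∀ r ∈ Icc 0 T, Tendsto (fun n => x (φ n) r) atTop (𝓝 (y r)) := fun r hr => by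
    rw [tendsto_iff_norm_sub_tendsto_zero]
    exact squeeze_zero (fun n => norm_nonneg _)
      (fun n => Cadlag.le_supDist (hx' (φ n)).1 hyc hr) hd
  have ht0 : 0 ≤ t := hs.1.trans h1
  have hrs : ∀ n, runSup d (x (φ n)) t' ≤ runSup d y t' + supDist T d (x (φ n)) y := fun n => by
    refine PHJ.runSup_le (add_nonneg (runSup_nonneg _ _) (runSup_nonneg _ _)) fun r hr => ?_
    have e1 := Cadlag.le_runSup hyc hr h3
    have e2 := Cadlag.le_supDist (hx' (φ n)).1 hyc (s := r) ⟨hr.1, hr.2.trans h3⟩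
    have e3 := norm_le_norm_add_norm_sub' (x (φ n) r) (y r)
    linarith
  have hlim2 : Tendsto (fun n => L * (1 + (runSup d y t' + supDist T d (x (φ n)) y)) * (t' - t))
      atTop (𝓝 (L * (1 + (runSup d y t' + 0)) * (t' - t))) :=
    ((((hd.const_add _).const_add _).const_mul _).mul_const _)
  rw [add_zero] at hlim2
  refine le_of_tendsto_of_tendsto'
    ((hpt t' ⟨ht0.trans h2, h3⟩).sub (hpt t ⟨ht0, h2.trans h3⟩)).norm hlim2 fun n => ?_
  refine ((hx' (φ n)).2.2 t t' h1 h2 h3).trans ?_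
  have := hrs n
  have := sub_nonneg.2 h2
  gcongr

/-- A continuous functional is uniformly continuous near, and bounded on, `X^L(s, x₀)`. -/
lemma TermCont.uniform {h : Path d → ℝ} (hh : TermCont T d h) {x₀ : Path d} (hL : 0 ≤ L)
    (hs : s ∈ Icc 0 T) (hx₀ : x₀ ∈ Cadlag T d) {ε : ℝ} (hε : 0 < ε) :
    ∃ δ > 0, ∀ x ∈ XSet T d L s x₀, ∀ x' ∈ Cadlag T d, supDist T d x x' < δ →
      |h x - h x'| < ε := by
  by_contra! hcon
  choose x hx x' hx' hd hε' using fun n : ℕ => hcon (1 / ((n : ℝ) + 1)) (by positivity)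
  obtain ⟨y, hy, φ, hφ, hlim⟩ := XSet.exists_tendsto_subseq hL hs hx₀ hx
  obtain ⟨δ, hδ, H⟩ := hh y hy.1 (ε / 2) (by positivity)
  have h1 : Tendsto (fun n => supDist T d (x (φ n)) y + 1 / ((φ n : ℝ) + 1)) atTop (𝓝 (0 + 0)) :=
    hlim.add ((tendsto_one_div_add_atTop_nhds_zero_nat (𝕜 := ℝ)).comp hφ.tendsto_atTop)
  rw [add_zero] at h1
  obtain ⟨n, hn⟩ := (h1.eventually (gt_mem_nhds hδ)).exists
  have hp : 0 < 1 / ((φ n : ℝ) + 1) := by positivity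
  have e1 := H (x (φ n)) (hx _).1 (by rw [supDist_comm]; linarith)
  have e2 := H (x' (φ n)) (hx' _) (by
    have := Cadlag.supDist_triangle hy.1 (hx (φ n)).1 (hx' (φ n))
    rw [supDist_comm y (x (φ n))] at this
    linarith [hd (φ n)])
  have e3 := hε' (φ n)
  have e4 := abs_sub_le (h (x (φ n))) (h y) (h (x' (φ n)))
  rw [abs_sub_comm (h y)] at e4
  linarith

lemma TermCont.bounded {h : Path d → ℝ} (hh : TermCont T d h) {x₀ : Path d} (hL : 0 ≤ L)
    (hs : s ∈ Icc 0 T) (hx₀ : x₀ ∈ Cadlag T d) :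
    ∃ C, 0 ≤ C ∧ ∀ x ∈ XSet T d L s x₀, |h x| ≤ C := by
  by_contra! hcon
  choose x hx hC using fun n : ℕ => hcon n (by positivity)
  obtain ⟨y, hy, φ, hφ, hlim⟩ := XSet.exists_tendsto_subseq hL hs hx₀ hx
  obtain ⟨δ, hδ, H⟩ := hh y hy.1 1 one_pos
  obtain ⟨m, hm⟩ := exists_nat_gt (|h y| + 1)
  obtain ⟨n, hn, hn'⟩ := ((hlim.eventually (gt_mem_nhds hδ)).and (eventually_ge_atTop m)).exists
  have e1 := H (x (φ n)) (hx _).1 (by rwa [supDist_comm])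
  have e2 := hC (φ n)
  have e3 : (m : ℝ) ≤ φ n := by exact_mod_cast hn'.trans (hφ.id_le n)
  have e4 := abs_sub_abs_le_abs_sub (h (x (φ n))) (h y)
  linarith

end LipschitzPaths

section ControlData

set_option linter.unusedSectionVars false

variable {T : ℝ} {d : ℕ} {A : Type*} [TopologicalSpace A]
  {f : ℝ → Path d → A → E d} {lam ell : ℝ → Path d → A → ℝ} {h : Path d → ℝ} {Cf Clam Lf : ℝ}

/-- The standing assumptions on the data of the control problem. -/
structure Data (T : ℝ) (d : ℕ) {A : Type*} [TopologicalSpace A]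
    (f : ℝ → Path d → A → E d) (lam ell : ℝ → Path d → A → ℝ) (h : Path d → ℝ)
    (Cf Clam Lf : ℝ) : Prop where
  sigma : SigmaCompactMetrizable A
  cont : DocCont T d f lam ell
  meas : DocMeas d f lam ell
  bound : DocBound T d f lam ell Cf Clam
  lip : DocLip T d f lam ell Lf
  term : TermCont T d h

/-- The times at which the assumptions on the data hold. -/
structure Good (T : ℝ) (d : ℕ) {A : Type*} [TopologicalSpace A]
    (f : ℝ → Path d → A → E d) (lam ell : ℝ → Path d → A → ℝ) (Cf Clam Lf t : ℝ) : Prop where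
  contF : ∀ x ∈ Cadlag T d, Continuous (f t x)
  contLam : ∀ x ∈ Cadlag T d, Continuous (lam t x)
  contEll : ∀ x ∈ Cadlag T d, Continuous (ell t x)
  f_le : ∀ x ∈ Cadlag T d, ∀ a, ‖f t x a‖ ≤ Cf * (1 + runSup d x t)
  ell_le : ∀ x ∈ Cadlag T d, ∀ a, |ell t x a| ≤ Cf * (1 + runSup d x t)
  lam_nonneg : ∀ x ∈ Cadlag T d, ∀ a, 0 ≤ lam t x a
  lam_le : ∀ x ∈ Cadlag T d, ∀ a, lam t x a ≤ Clam
  f_lip : ∀ x ∈ Cadlag T d, ∀ x' ∈ Cadlag T d, ∀ a,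
    ‖f t x a - f t x' a‖ ≤ Lf * runSup d (x - x') t
  ell_lip : ∀ x ∈ Cadlag T d, ∀ x' ∈ Cadlag T d, ∀ a,
    |ell t x a - ell t x' a| ≤ Lf * runSup d (x - x') t
  lam_lip : ∀ x ∈ Cadlag T d, ∀ x' ∈ Cadlag T d, ∀ a,
    |lam t x a - lam t x' a| ≤ Lf * runSup d (x - x') t

namespace Data

lemma ae_good (D : Data T d f lam ell h Cf Clam Lf) :
    ∀ᵐ t : ℝ, t ∈ Ioc 0 T → Good T d f lam ell Cf Clam Lf t := by
  have h1 := ae_Ioc_of_restrict_Ioo D.cont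
  have h2 := ae_Ioc_of_restrict_Ioo D.bound.2.2
  have h3 := ae_Ioc_of_restrict_Ioo D.lip.2
  filter_upwards [h1, h2, h3] with t h1 h2 h3 ht
  replace h1 := h1 ht
  replace h2 := h2 ht
  replace h3 := h3 ht
  have key : ∀ x ∈ Cadlag T d, ∀ a : A, ∀ ε > (0 : ℝ), ∀ᶠ a' in 𝓝 a,
      ‖f t x a - f t x a'‖ < ε ∧ |lam t x a - lam t x a'| < ε ∧ |ell t x a - ell t x a'| < ε := by
    intro x hx a ε hε
    obtain ⟨δ, hδ, U, hU, H⟩ := h1 x hx a ε hε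
    filter_upwards [hU] with a' ha'
    exact H x hx a' ha' (by rwa [supDist_self])
  refine ⟨fun x hx => ?_, fun x hx => ?_, fun x hx => ?_, fun x hx a => ?_, fun x hx a => ?_,
    fun x hx a => (h2 x hx a).2.1, fun x hx a => (h2 x hx a).2.2, fun x hx x' hx' a => ?_,
    fun x hx x' hx' a => ?_, fun x hx x' hx' a => ?_⟩
  · refine continuous_iff_continuousAt.2 fun a => Metric.tendsto_nhds.2 fun ε hε => ?_
    filter_upwards [key x hx a ε hε] with a' ha'
    rw [dist_comm, dist_eq_norm]; exact ha'.1
  · refine continuous_iff_continuousAt.2 fun a => Metric.tendsto_nhds.2 fun ε hε => ?_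
    filter_upwards [key x hx a ε hε] with a' ha'
    rw [dist_comm, Real.dist_eq]; exact ha'.2.1
  · refine continuous_iff_continuousAt.2 fun a => Metric.tendsto_nhds.2 fun ε hε => ?_
    filter_upwards [key x hx a ε hε] with a' ha'
    rw [dist_comm, Real.dist_eq]; exact ha'.2.2
  · linarith [(h2 x hx a).1, abs_nonneg (ell t x a)]
  · linarith [(h2 x hx a).1, norm_nonneg (f t x a)]
  all_goals
    have e1 := norm_nonneg (f t x a - f t x' a)
    have e2 := abs_nonneg (ell t x a - ell t x' a)
    have e3 := abs_nonneg (lam t x a - lam t x' a)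
    have e4 : _ ≤ Lf * runSup d (x - x') t := h3 x hx x' hx' a
    linarith

lemma ae_good_Ioc (D : Data T d f lam ell h Cf Clam Lf) {s t : ℝ} (hs : 0 ≤ s) (ht : t ≤ T) :
    ∀ᵐ r : ℝ, r ∈ Ioc s t → Good T d f lam ell Cf Clam Lf r :=
  D.ae_good.mono fun _ hr hr' => hr ⟨hs.trans_lt hr'.1, hr'.2.trans ht⟩

lemma ae_good_restrict (D : Data T d f lam ell h Cf Clam Lf) :
    ∀ᵐ t ∂(volume.restrict (Ioc 0 T)), Good T d f lam ell Cf Clam Lf t :=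
  (ae_restrict_iff' measurableSet_Ioc).2 D.ae_good

end Data

lemma intervalIntegrable_of_ae_bound {V : Type*} [NormedAddCommGroup V] {F : ℝ → V} {C s t : ℝ}
    (hF : AEStronglyMeasurable F (volume.restrict (Ioc 0 T))) (hs : 0 ≤ s) (hst : s ≤ t)
    (ht : t ≤ T) (hb : ∀ᵐ r : ℝ, r ∈ Ioc s t → ‖F r‖ ≤ C) : IntervalIntegrable F volume s t := by
  refine (intervalIntegrable_const (c := C)).mono_fun ?_ ?_
  · rw [uIoc_of_le hst]
    exact hF.mono_measure (Measure.restrict_mono (Ioc_subset_Ioc hs ht) le_rfl)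
  · rw [uIoc_of_le hst]
    refine (ae_restrict_iff' measurableSet_Ioc).2 (hb.mono fun r hr hr' => ?_)
    exact (hr hr').trans (le_abs_self C)

/-- The discount factor along an arbitrary path. -/
def disc (lam : ℝ → Path d → A → ℝ) (s : ℝ) (x : Path d) (α : ℝ → A) (t : ℝ) : ℝ :=
  Real.exp (-∫ r in s..t, lam r x (α r))

/-- The discounted running cost along an arbitrary path. -/
def runCost (lam ell : ℝ → Path d → A → ℝ) (s : ℝ) (x : Path d) (α : ℝ → A) (t : ℝ) : ℝ :=
  ∫ r in s..t, disc lam s x α r * ell r x (α r)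

/-- The cost along an arbitrary path. -/
def pathCost (T : ℝ) (lam ell : ℝ → Path d → A → ℝ) (h : Path d → ℝ) (s : ℝ) (x : Path d)
    (α : ℝ → A) : ℝ :=
  runCost lam ell s x α T + disc lam s x α T * h x

lemma abs_exp_neg_sub_le {a b : ℝ} (ha : 0 ≤ a) (hb : 0 ≤ b) :
    |Real.exp (-a) - Real.exp (-b)| ≤ |a - b| := by
  wlog hab : a ≤ b generalizing a b
  · rw [abs_sub_comm, abs_sub_comm a]
    exact this hb ha (le_of_not_ge hab)
  have h1 : Real.exp (-b) ≤ Real.exp (-a) := Real.exp_le_exp.2 (by linarith)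
  rw [abs_of_nonneg (by linarith), abs_sub_comm, abs_of_nonneg (by linarith)]
  have h2 : Real.exp (-b) = Real.exp (-a) * Real.exp (-(b - a)) := by
    rw [← Real.exp_add]; congr 1; ring
  have h3 := Real.add_one_le_exp (-(b - a))
  have h4 : Real.exp (-a) ≤ 1 := Real.exp_le_one_iff.2 (by linarith)
  have h5 := Real.exp_pos (-a)
  rw [h2]
  nlinarith

lemma disc_congr_ctrl {x : Path d} {α β : ℝ → A} {s t : ℝ} (hst : s ≤ t)
    (hα : ∀ r ∈ Ioo s t, α r = β r) : disc lam s x α t = disc lam s x β t := by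
  refine congrArg (fun I => Real.exp (-I))
    (intervalIntegral.integral_congr_Ioo_of_le hst fun r hr => ?_)
  simp only [hα r hr]

lemma runCost_congr_ctrl {x : Path d} {α β : ℝ → A} {s t : ℝ} (hst : s ≤ t)
    (hα : ∀ r ∈ Ioo s t, α r = β r) : runCost lam ell s x α t = runCost lam ell s x β t := by
  unfold runCost
  refine intervalIntegral.integral_congr_Ioo_of_le hst fun r hr => ?_
  rw [hα r hr, disc_congr_ctrl hr.1.le fun q hq => hα q ⟨hq.1, hq.2.trans hr.2⟩]

lemma disc_self {x : Path d} {α : ℝ → A} {s : ℝ} : disc lam s x α s = 1 := by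
  simp [disc]

lemma disc_pos {x : Path d} {α : ℝ → A} {s t : ℝ} : 0 < disc lam s x α t :=
  Real.exp_pos _

variable [MeasurableSpace A] [BorelSpace A]

namespace Data

variable {x x' : Path d} {α : ℝ → A} {s t t' : ℝ}

lemma intervalIntegrable_f (D : Data T d f lam ell h Cf Clam Lf) (hx : x ∈ Cadlag T d)
    (hα : Measurable α) (hs : 0 ≤ s) (hst : s ≤ t) (ht : t ≤ T) :
    IntervalIntegrable (fun r => f r x (α r)) volume s t := by
  refine intervalIntegrable_of_ae_bound (C := Cf * (1 + runSup d x T))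
    (aemeasurable_caratheodory D.sigma (fun a => (D.meas x a).1)
      (D.ae_good_restrict.mono fun t ht => ht.contF x hx) hα).aestronglyMeasurable hs hst ht ?_
  filter_upwards [D.ae_good_Ioc hs ht] with r hr hr'
  refine ((hr hr').f_le x hx _).trans ?_
  have := Cadlag.runSup_mono hx (hr'.2.trans ht) le_rfl
  have := D.bound.1
  gcongr

lemma intervalIntegrable_lam (D : Data T d f lam ell h Cf Clam Lf) (hx : x ∈ Cadlag T d)
    (hα : Measurable α) (hs : 0 ≤ s) (hst : s ≤ t) (ht : t ≤ T) :
    IntervalIntegrable (fun r => lam r x (α r)) volume s t := by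
  refine intervalIntegrable_of_ae_bound (C := Clam)
    (aemeasurable_caratheodory D.sigma (fun a => (D.meas x a).2.1)
      (D.ae_good_restrict.mono fun t ht => ht.contLam x hx) hα).aestronglyMeasurable hs hst ht ?_
  filter_upwards [D.ae_good_Ioc hs ht] with r hr hr'
  rw [Real.norm_eq_abs, abs_of_nonneg ((hr hr').lam_nonneg x hx _)]
  exact (hr hr').lam_le x hx _

lemma intervalIntegrable_ell (D : Data T d f lam ell h Cf Clam Lf) (hx : x ∈ Cadlag T d)
    (hα : Measurable α) (hs : 0 ≤ s) (hst : s ≤ t) (ht : t ≤ T) :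
    IntervalIntegrable (fun r => ell r x (α r)) volume s t := by
  refine intervalIntegrable_of_ae_bound (C := Cf * (1 + runSup d x T))
    (aemeasurable_caratheodory D.sigma (fun a => (D.meas x a).2.2)
      (D.ae_good_restrict.mono fun t ht => ht.contEll x hx) hα).aestronglyMeasurable hs hst ht ?_
  filter_upwards [D.ae_good_Ioc hs ht] with r hr hr'
  refine ((hr hr').ell_le x hx _).trans ?_
  have := Cadlag.runSup_mono hx (hr'.2.trans ht) le_rfl
  have := D.bound.1
  gcongr

lemma lam_integral_nonneg (D : Data T d f lam ell h Cf Clam Lf) (hx : x ∈ Cadlag T d)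
    (hs : 0 ≤ s) (hst : s ≤ t) (ht : t ≤ T) : 0 ≤ ∫ r in s..t, lam r x (α r) := by
  rw [intervalIntegral.integral_of_le hst]
  refine integral_nonneg_of_ae ((ae_restrict_iff' measurableSet_Ioc).2 ?_)
  filter_upwards [D.ae_good_Ioc hs ht] with r hr hr'
  exact (hr hr').lam_nonneg x hx _

lemma lam_integral_abs_le (D : Data T d f lam ell h Cf Clam Lf) (hx : x ∈ Cadlag T d)
    (hs : 0 ≤ s) (hst : s ≤ t) (ht : t ≤ T) :
    |∫ r in s..t, lam r x (α r)| ≤ Clam * (t - s) := by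
  rw [← abs_of_nonneg (sub_nonneg.2 hst), ← Real.norm_eq_abs]
  refine intervalIntegral.norm_integral_le_of_norm_le_const_ae ?_
  rw [uIoc_of_le hst]
  filter_upwards [D.ae_good_Ioc hs ht] with r hr hr'
  rw [Real.norm_eq_abs, abs_of_nonneg ((hr hr').lam_nonneg x hx _)]
  exact (hr hr').lam_le x hx _

lemma disc_le_one (D : Data T d f lam ell h Cf Clam Lf) (hx : x ∈ Cadlag T d)
    (hs : 0 ≤ s) (hst : s ≤ t) (ht : t ≤ T) : disc lam s x α t ≤ 1 :=
  Real.exp_le_one_iff.2 (neg_nonpos.2 (D.lam_integral_nonneg hx hs hst ht))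

lemma one_sub_disc_le (D : Data T d f lam ell h Cf Clam Lf) (hx : x ∈ Cadlag T d)
    (hs : 0 ≤ s) (hst : s ≤ t) (ht : t ≤ T) : 1 - disc lam s x α t ≤ Clam * (t - s) := by
  have h1 := Real.add_one_le_exp (-∫ r in s..t, lam r x (α r))
  have h2 := (le_abs_self _).trans (D.lam_integral_abs_le (α := α) hx hs hst ht)
  unfold disc
  linarith

lemma le_disc (D : Data T d f lam ell h Cf Clam Lf) (hx : x ∈ Cadlag T d)
    (hs : 0 ≤ s) (hst : s ≤ t) (ht : t ≤ T) : Real.exp (-(Clam * T)) ≤ disc lam s x α t := by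
  have h2 := (le_abs_self _).trans (D.lam_integral_abs_le (α := α) hx hs hst ht)
  have h3 : Clam * (t - s) ≤ Clam * T := mul_le_mul_of_nonneg_left (by linarith) D.bound.2.1
  exact Real.exp_le_exp.2 (by linarith)

lemma disc_mul (D : Data T d f lam ell h Cf Clam Lf) (hx : x ∈ Cadlag T d) (hα : Measurable α)
    (hs : 0 ≤ s) (hst : s ≤ t) (htt : t ≤ t') (ht : t' ≤ T) :
    disc lam s x α t * disc lam t x α t' = disc lam s x α t' := by
  unfold disc
  rw [← Real.exp_add, ← intervalIntegral.integral_add_adjacent_intervals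
    (D.intervalIntegrable_lam hx hα hs hst (htt.trans ht))
    (D.intervalIntegrable_lam hx hα (hs.trans hst) htt ht)]
  congr 1
  ring

lemma disc_lipschitz (D : Data T d f lam ell h Cf Clam Lf) (hx : x ∈ Cadlag T d)
    (hα : Measurable α) (hs : 0 ≤ s) :
    LipschitzOnWith (Real.toNNReal Clam) (disc lam s x α) (Icc s T) := by
  refine LipschitzOnWith.of_dist_le_mul fun a ha b hb => ?_
  rw [Real.coe_toNNReal _ D.bound.2.1]
  wlog hab : a ≤ b generalizing a b
  · rw [dist_comm, dist_comm a]
    exact this b hb a ha (le_of_not_ge hab)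
  have h1 := D.disc_mul hx hα hs ha.1 hab hb.2
  have h2 := D.one_sub_disc_le (α := α) hx (hs.trans ha.1) hab hb.2
  have h3 := D.disc_le_one (α := α) hx (hs.trans ha.1) hab hb.2
  have h4 := D.disc_le_one (α := α) hx hs ha.1 ha.2
  have h5 : 0 < disc lam s x α a := disc_pos
  rw [Real.dist_eq, Real.dist_eq, ← h1, abs_of_nonneg (by nlinarith), abs_sub_comm,
    abs_of_nonneg (sub_nonneg.2 hab)]
  nlinarith

/-- The product of the discount factor with an absolutely continuous function. -/
lemma disc_mul_sub (D : Data T d f lam ell h Cf Clam Lf) (hx : x ∈ Cadlag T d)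
    (hα : Measurable α) (hs : 0 ≤ s) (hst : s ≤ t) (ht : t ≤ T) {y q : ℝ → ℝ} {y₀ : ℝ}
    (hq : IntervalIntegrable q volume s t) (hy : ∀ r ∈ Icc s t, y r = y₀ + ∫ r' in s..r, q r') :
    disc lam s x α t * y t - y₀ =
      ∫ r in s..t, disc lam s x α r * (q r - lam r x (α r) * y r) := by
  have hl := D.intervalIntegrable_lam hx hα hs hst ht
  let Y : ℝ → ℝ := fun r => y₀ + ∫ r' in s..r, q r'
  have hac1 : AbsolutelyContinuousOnInterval (disc lam s x α) s t := by
    refine LipschitzOnWith.absolutelyContinuousOnInterval (K := Real.toNNReal Clam) ?_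
    rw [uIcc_of_le hst]
    exact (D.disc_lipschitz hx hα hs).mono (Icc_subset_Icc le_rfl ht)
  have hac2 : AbsolutelyContinuousOnInterval Y s t := by
    have h1 : AbsolutelyContinuousOnInterval (fun _ : ℝ => y₀) s t :=
      (LipschitzWith.const y₀).lipschitzOnWith.absolutelyContinuousOnInterval
    exact h1.add (hq.absolutelyContinuousOnInterval_intervalIntegral left_mem_uIcc)
  have h1 := (hac1.mul hac2).integral_deriv_eq_sub
  have h2 : disc lam s x α s * Y s = y₀ := by simp [disc_self, Y]
  rw [hy t ⟨hst, le_rfl⟩]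
  simp only [Pi.mul_apply] at h1
  rw [h2] at h1
  rw [← h1]
  refine intervalIntegral.integral_congr_ae ?_
  filter_upwards [hl.ae_hasDerivAt_integral, hq.ae_hasDerivAt_integral] with r h3 h4 hr
  have hr' : r ∈ uIcc s t := uIoc_subset_uIcc hr
  have h5 := (h3 hr' s left_mem_uIcc).neg.exp
  have h6 := (h4 hr' s left_mem_uIcc).const_add y₀
  have h7 := (h5.mul h6).deriv
  rw [uIcc_of_le hst] at hr'
  rw [hy r hr']
  refine Eq.trans h7 ?_
  simp only [disc, Pi.neg_apply]
  ring

end Data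

end ControlData

section CostEstimates

set_option linter.unusedSectionVars false

variable {T : ℝ} {d : ℕ} {A : Type*} [TopologicalSpace A]
  {f : ℝ → Path d → A → E d} {lam ell : ℝ → Path d → A → ℝ} {h : Path d → ℝ} {Cf Clam Lf : ℝ}
  [MeasurableSpace A] [BorelSpace A] {x x' : Path d} {α : ℝ → A} {s t t' : ℝ}

namespace Data

lemma runSup_sub_le (hx : x ∈ Cadlag T d) (hx' : x' ∈ Cadlag T d) (ht : t ≤ T) :
    runSup d (x - x') t ≤ supDist T d x x' :=
  Cadlag.runSup_mono (Cadlag.sub hx hx') ht le_rfl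

lemma disc_continuousOn (D : Data T d f lam ell h Cf Clam Lf) (hx : x ∈ Cadlag T d)
    (hα : Measurable α) (hs : 0 ≤ s) : ContinuousOn (disc lam s x α) (Icc s T) :=
  (D.disc_lipschitz hx hα hs).continuousOn

lemma intervalIntegrable_disc_mul (D : Data T d f lam ell h Cf Clam Lf) (hx : x ∈ Cadlag T d)
    (hα : Measurable α) (hs : 0 ≤ s) (hst : s ≤ t) (htt : t ≤ t') (ht : t' ≤ T) {F : ℝ → ℝ}
    (hF : IntervalIntegrable F volume t t') :
    IntervalIntegrable (fun r => disc lam s x α r * F r) volume t t' := by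
  refine hF.continuousOn_mul ((D.disc_continuousOn hx hα hs).mono ?_)
  rw [uIcc_of_le htt]
  exact Icc_subset_Icc hst ht

lemma runCost_add (D : Data T d f lam ell h Cf Clam Lf) (hx : x ∈ Cadlag T d)
    (hα : Measurable α) (hs : 0 ≤ s) (hst : s ≤ t) (htt : t ≤ t') (ht : t' ≤ T) :
    runCost lam ell s x α t' =
      runCost lam ell s x α t + disc lam s x α t * runCost lam ell t x α t' := by
  unfold runCost
  rw [← intervalIntegral.integral_add_adjacent_intervals
    (D.intervalIntegrable_disc_mul hx hα hs le_rfl hst (htt.trans ht)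
      (D.intervalIntegrable_ell hx hα hs hst (htt.trans ht)))
    (D.intervalIntegrable_disc_mul hx hα hs hst htt ht
      (D.intervalIntegrable_ell hx hα (hs.trans hst) htt ht)),
    ← intervalIntegral.integral_const_mul]
  congr 1
  refine intervalIntegral.integral_congr_Ioo_of_le htt fun r hr => ?_
  rw [← D.disc_mul hx hα hs hst hr.1.le (hr.2.le.trans ht), mul_assoc]

lemma abs_ell_le (D : Data T d f lam ell h Cf Clam Lf) (hx : x ∈ Cadlag T d) (ht : t ∈ Ioc 0 T)
    (hg : Good T d f lam ell Cf Clam Lf t) (a : A) :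
    |ell t x a| ≤ Cf * (1 + runSup d x T) := by
  refine (hg.ell_le x hx _).trans ?_
  have := Cadlag.runSup_mono hx ht.2 le_rfl
  have := D.bound.1
  gcongr

lemma abs_runCost_le (D : Data T d f lam ell h Cf Clam Lf) (hx : x ∈ Cadlag T d)
    (hs : 0 ≤ s) (hst : s ≤ t) (ht : t ≤ T) :
    |runCost lam ell s x α t| ≤ Cf * (1 + runSup d x T) * (t - s) := by
  rw [← abs_of_nonneg (sub_nonneg.2 hst), ← Real.norm_eq_abs]
  refine intervalIntegral.norm_integral_le_of_norm_le_const_ae ?_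
  rw [uIoc_of_le hst]
  filter_upwards [D.ae_good_Ioc hs ht] with r hr hr'
  have h0 : 0 < disc lam s x α r := disc_pos
  rw [norm_mul, Real.norm_eq_abs, Real.norm_eq_abs, abs_of_pos h0]
  have h1 := D.disc_le_one (α := α) hx hs hr'.1.le (hr'.2.trans ht)
  have h2 := D.abs_ell_le hx ⟨hs.trans_lt hr'.1, hr'.2.trans ht⟩ (hr hr') (α r)
  have h3 := abs_nonneg (ell r x (α r))
  nlinarith

lemma pathCost_eq_add (D : Data T d f lam ell h Cf Clam Lf) (hx : x ∈ Cadlag T d)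
    (hα : Measurable α) (hs : 0 ≤ s) (hst : s ≤ t) (ht : t ≤ T) :
    pathCost T lam ell h s x α =
      runCost lam ell s x α t + disc lam s x α t * pathCost T lam ell h t x α := by
  unfold pathCost
  rw [D.runCost_add hx hα hs hst ht le_rfl, ← D.disc_mul hx hα hs hst ht le_rfl]
  ring

lemma abs_pathCost_le (D : Data T d f lam ell h Cf Clam Lf) (hx : x ∈ Cadlag T d)
    (hs : s ∈ Icc 0 T) :
    |pathCost T lam ell h s x α| ≤ Cf * (1 + runSup d x T) * T + |h x| := by
  have h1 := D.abs_runCost_le (α := α) hx hs.1 hs.2 le_rfl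
  have h2 := D.disc_le_one (α := α) hx hs.1 hs.2 le_rfl
  have h3 : 0 < disc lam s x α T := disc_pos
  refine (abs_add_le _ _).trans (add_le_add (h1.trans ?_) ?_)
  · have := D.bound.1
    have := runSup_nonneg x T
    have := hs.1
    gcongr
    linarith
  · rw [abs_mul, abs_of_pos h3]
    nlinarith [abs_nonneg (h x)]

lemma abs_disc_sub_le (D : Data T d f lam ell h Cf Clam Lf) (hx : x ∈ Cadlag T d)
    (hx' : x' ∈ Cadlag T d) (hα : Measurable α) (hs : 0 ≤ s) (hst : s ≤ t) (ht : t ≤ T) :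
    |disc lam s x α t - disc lam s x' α t| ≤ Lf * supDist T d x x' * T := by
  refine (abs_exp_neg_sub_le (D.lam_integral_nonneg hx hs hst ht)
    (D.lam_integral_nonneg hx' hs hst ht)).trans ?_
  rw [← intervalIntegral.integral_sub (D.intervalIntegrable_lam hx hα hs hst ht)
    (D.intervalIntegrable_lam hx' hα hs hst ht)]
  have : ‖∫ r in s..t, (lam r x (α r) - lam r x' (α r))‖ ≤ Lf * supDist T d x x' * |t - s| := by
    refine intervalIntegral.norm_integral_le_of_norm_le_const_ae ?_
    rw [uIoc_of_le hst]
    filter_upwards [D.ae_good_Ioc hs ht] with r hr hr'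
    refine ((hr hr').lam_lip x hx x' hx' _).trans ?_
    have := runSup_sub_le hx hx' (hr'.2.trans ht)
    have := D.lip.1
    gcongr
  refine this.trans ?_
  have h1 := D.lip.1
  have h2 : 0 ≤ supDist T d x x' := runSup_nonneg _ _
  rw [abs_of_nonneg (sub_nonneg.2 hst)]
  gcongr
  linarith

lemma abs_pathCost_sub_le (D : Data T d f lam ell h Cf Clam Lf) (hx : x ∈ Cadlag T d)
    (hx' : x' ∈ Cadlag T d) (hα : Measurable α) (hs : s ∈ Icc 0 T) :
    |pathCost T lam ell h s x α - pathCost T lam ell h s x' α| ≤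
      (Lf * T + Lf * T * (Cf * (1 + runSup d x T)) * T + Lf * T * |h x|) * supDist T d x x' +
        |h x - h x'| := by
  have hT : 0 ≤ T := hs.1.trans hs.2
  have hL := D.lip.1
  have hρ : 0 ≤ supDist T d x x' := runSup_nonneg _ _
  have hC : 0 ≤ Cf * (1 + runSup d x T) :=
    mul_nonneg D.bound.1 (by linarith [runSup_nonneg x T])
  set ρ := supDist T d x x'
  have h1 : |runCost lam ell s x α T - runCost lam ell s x' α T| ≤
      (Lf * ρ + Lf * ρ * T * (Cf * (1 + runSup d x T))) * T := by
    unfold runCost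
    rw [← intervalIntegral.integral_sub
      (D.intervalIntegrable_disc_mul hx hα hs.1 le_rfl hs.2 le_rfl
        (D.intervalIntegrable_ell hx hα hs.1 hs.2 le_rfl))
      (D.intervalIntegrable_disc_mul hx' hα hs.1 le_rfl hs.2 le_rfl
        (D.intervalIntegrable_ell hx' hα hs.1 hs.2 le_rfl))]
    have : ‖∫ r in s..T, (disc lam s x α r * ell r x (α r) - disc lam s x' α r * ell r x' (α r))‖
        ≤ (Lf * ρ + Lf * ρ * T * (Cf * (1 + runSup d x T))) * |T - s| := by
      refine intervalIntegral.norm_integral_le_of_norm_le_const_ae ?_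
      rw [uIoc_of_le hs.2]
      filter_upwards [D.ae_good_Ioc hs.1 le_rfl] with r hr hr'
      have e1 := D.abs_disc_sub_le hx hx' hα hs.1 hr'.1.le hr'.2
      have e2 := D.abs_ell_le hx ⟨hs.1.trans_lt hr'.1, hr'.2⟩ (hr hr') (α r)
      have e3 : 0 < disc lam s x' α r := disc_pos
      have e4 := D.disc_le_one (α := α) hx' hs.1 hr'.1.le hr'.2
      have e5 : |ell r x (α r) - ell r x' (α r)| ≤ Lf * ρ :=
        ((hr hr').ell_lip x hx x' hx' _).trans
          (mul_le_mul_of_nonneg_left (runSup_sub_le hx hx' hr'.2) hL)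
      have e6 : disc lam s x α r * ell r x (α r) - disc lam s x' α r * ell r x' (α r) =
          (disc lam s x α r - disc lam s x' α r) * ell r x (α r) +
            disc lam s x' α r * (ell r x (α r) - ell r x' (α r)) := by ring
      rw [e6, Real.norm_eq_abs]
      refine (abs_add_le _ _).trans ?_
      rw [abs_mul, abs_mul, abs_of_pos e3]
      have e7 := mul_le_mul e1 e2 (abs_nonneg _) (by positivity)
      have e8 : disc lam s x' α r * |ell r x (α r) - ell r x' (α r)| ≤ Lf * ρ := by
        nlinarith [abs_nonneg (ell r x (α r) - ell r x' (α r))]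
      linarith
    refine this.trans ?_
    rw [abs_of_nonneg (sub_nonneg.2 hs.2)]
    gcongr
    linarith [hs.1]
  have h2 : |disc lam s x α T * h x - disc lam s x' α T * h x'| ≤
      Lf * ρ * T * |h x| + |h x - h x'| := by
    have e1 := D.abs_disc_sub_le hx hx' hα hs.1 hs.2 le_rfl
    have e3 : 0 < disc lam s x' α T := disc_pos
    have e4 := D.disc_le_one (α := α) hx' hs.1 hs.2 le_rfl
    have e6 : disc lam s x α T * h x - disc lam s x' α T * h x' =
        (disc lam s x α T - disc lam s x' α T) * h x + disc lam s x' α T * (h x - h x') := by ring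
    rw [e6]
    refine (abs_add_le _ _).trans ?_
    rw [abs_mul, abs_mul, abs_of_pos e3]
    have := mul_le_mul_of_nonneg_right e1 (abs_nonneg (h x))
    nlinarith [abs_nonneg (h x - h x')]
  have h3 : pathCost T lam ell h s x α - pathCost T lam ell h s x' α =
      (runCost lam ell s x α T - runCost lam ell s x' α T) +
        (disc lam s x α T * h x - disc lam s x' α T * h x') := by unfold pathCost; ring
  rw [h3]
  refine (abs_add_le _ _).trans ((add_le_add h1 h2).trans (le_of_eq ?_))
  ring

/-- The cost depends on the path uniformly continuously near `X^L(s, x₀)`, uniformly in the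
control and in the starting time. -/
lemma pathCost_uniform (D : Data T d f lam ell h Cf Clam Lf) {x₀ : Path d} (hs : s ∈ Icc 0 T)
    (hx₀ : x₀ ∈ Cadlag T d) {ε : ℝ} (hε : 0 < ε) :
    ∃ δ > 0, ∀ x ∈ XSet T d Cf s x₀, ∀ x' ∈ Cadlag T d, supDist T d x x' < δ →
      ∀ α : ℝ → A, Measurable α → ∀ t ∈ Icc 0 T,
        |pathCost T lam ell h t x α - pathCost T lam ell h t x' α| < ε := by
  have hT : 0 ≤ T := hs.1.trans hs.2
  obtain ⟨δ, hδ, H⟩ := D.term.uniform D.bound.1 hs hx₀ (half_pos hε)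
  obtain ⟨C, hC0, hC⟩ := D.term.bounded D.bound.1 hs hx₀
  obtain ⟨R, hR0, hR⟩ := Cadlag.exists_bound hx₀
  have hL := D.lip.1
  have hf := D.bound.1
  set B := 2 * (1 + R) * Real.exp (2 * Cf * T)
  have hB0 : 0 ≤ B := by positivity
  set M := Lf * T + Lf * T * (Cf * B) * T + Lf * T * C
  have hM : 0 ≤ M := by positivity
  refine ⟨min δ (ε / (2 * (M + 1))), by positivity, fun x hx x' hx' hd α hα t ht => ?_⟩
  refine (D.abs_pathCost_sub_le hx.1 hx' hα ht).trans_lt ?_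
  have h1 := H x hx x' hx' (hd.trans_le (min_le_left _ _))
  have h2 := XSet.runSup_le hf hs hR0 (fun t ht => hR t ⟨ht.1, ht.2.trans hs.2⟩) hx
  have h3 := hC x hx
  have h4 : Lf * T + Lf * T * (Cf * (1 + runSup d x T)) * T + Lf * T * |h x| ≤ M := by
    have h5 := runSup_nonneg x T
    change _ ≤ Lf * T + Lf * T * (Cf * B) * T + Lf * T * C
    gcongr
  have h5 : 0 ≤ supDist T d x x' := runSup_nonneg _ _
  have h6 := mul_le_mul_of_nonneg_right h4 h5
  have h7 : (M + 1) * supDist T d x x' ≤ ε / 2 := by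
    have := (hd.trans_le (min_le_right _ _)).le
    rw [le_div_iff₀ (by positivity)] at this
    linarith
  nlinarith

lemma pathCost_congr (D : Data T d f lam ell h Cf Clam Lf) (hx : x ∈ Cadlag T d)
    (hx' : x' ∈ Cadlag T d) (hα : Measurable α) (hs : s ∈ Icc 0 T)
    (heq : ∀ t ∈ Icc 0 T, x t = x' t) :
    pathCost T lam ell h s x α = pathCost T lam ell h s x' α := by
  have h0 : supDist T d x x' = 0 :=
    le_antisymm (supDist_le le_rfl fun t ht => by simp [heq t ht]) (runSup_nonneg _ _)
  have h1 : h x = h x' := by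
    refine eq_of_abs_sub_le_all fun ε hε => ?_
    obtain ⟨δ, hδ, H⟩ := D.term x hx ε hε
    rw [abs_sub_comm]
    exact (H x' hx' (by rwa [h0])).le
  have h2 := D.abs_pathCost_sub_le hx hx' hα hs
  rw [h0, h1] at h2
  simp only [mul_zero, sub_self, abs_zero, add_zero] at h2
  exact sub_eq_zero.1 (abs_nonpos_iff.1 h2)

end Data

end CostEstimates

section Trajectories

set_option linter.unusedSectionVars false

variable {T : ℝ} {d : ℕ} {A : Type*} [TopologicalSpace A]
  {f : ℝ → Path d → A → E d} {lam ell : ℝ → Path d → A → ℝ} {h : Path d → ℝ} {Cf Clam Lf : ℝ}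
  [MeasurableSpace A] [BorelSpace A] {x x' φ φ' : Path d} {α α' : ℝ → A} {s t t' : ℝ}

namespace Data

lemma traj_mem_cadlag (hs : s ∈ Icc 0 T) (hx : x ∈ Cadlag T d) (hφ : IsTraj T d f s x α φ) :
    φ ∈ Cadlag T d := by
  refine Cadlag.splice hx hφ.1 ?_
  have h1 : ContinuousOn (fun t => x s + ∫ r in s..t, f r φ (α r)) (Icc s T) := by
    refine continuousOn_const.add ?_
    have := intervalIntegral.continuousOn_primitive_interval (a := s) (b := T) (μ := volume)
      (f := fun r => f r φ (α r)) (by rw [uIcc_of_le hs.2]; exact hφ.2.1)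
    rwa [uIcc_of_le hs.2] at this
  exact h1.congr fun t ht => hφ.2.2 t ht

lemma traj_xDeriv (D : Data T d f lam ell h Cf Clam Lf) (hs : s ∈ Icc 0 T) (hx : x ∈ Cadlag T d)
    (hφ : IsTraj T d f s x α φ) : XDeriv T d Cf s φ fun r => f r φ (α r) := by
  have hc := traj_mem_cadlag hs hx hφ
  refine ⟨hφ.2.1, fun t ht => ?_, ?_⟩
  · rw [hφ.2.2 t ht, hφ.1 s ⟨hs.1, le_rfl⟩]
  · refine (ae_restrict_iff' measurableSet_Ioo).2 ?_
    filter_upwards [D.ae_good_Ioc hs.1 le_rfl] with r hr hr'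
    exact (hr (Ioo_subset_Ioc_self hr')).f_le φ hc _

lemma traj_mem_xSet (D : Data T d f lam ell h Cf Clam Lf) (hs : s ∈ Icc 0 T)
    (hx : x ∈ Cadlag T d) (hφ : IsTraj T d f s x α φ) : φ ∈ XSet T d Cf s x :=
  ⟨traj_mem_cadlag hs hx hφ, hφ.1, _, D.traj_xDeriv hs hx hφ⟩

lemma traj_sub_eq (D : Data T d f lam ell h Cf Clam Lf) (hs : s ∈ Icc 0 T)
    (hx : x ∈ Cadlag T d) (hφ : IsTraj T d f s x α φ) (hst : s ≤ t) (htt : t ≤ t') (ht : t' ≤ T) :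
    φ t' - φ t = ∫ r in t..t', f r φ (α r) :=
  XDeriv.sub_eq (D.traj_xDeriv hs hx hφ) hst htt ht

/-- Stability of solutions of the controlled equation. -/
lemma norm_sub_le_of_integral_eq (D : Data T d f lam ell h Cf Clam Lf) (hφ : φ ∈ Cadlag T d)
    (hφ' : φ' ∈ Cadlag T d) (hα : Measurable α) (hs : 0 ≤ s) (ht : t ≤ T)
    (he : ∀ r ∈ Icc s t, φ r - φ s = ∫ q in s..r, f q φ (α q))
    (he' : ∀ r ∈ Icc s t, φ' r - φ' s = ∫ q in s..r, f q φ' (α q)) {a : ℝ} (ha0 : 0 ≤ a)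
    (ha : ∀ r ∈ Icc 0 s, ‖φ r - φ' r‖ ≤ a) :
    ∀ r ∈ Icc 0 t, ‖φ r - φ' r‖ ≤ 2 * a * Real.exp (2 * Lf * T) := by
  obtain ⟨B, -, hB⟩ := Cadlag.exists_bound (Cadlag.sub hφ hφ')
  have hL := D.lip.1
  have hw : ∀ r : ℝ, 0 ≤ r → 1 ≤ Real.exp (2 * Lf * r) := fun r hr =>
    Real.one_le_exp (by positivity)
  have key : ∀ r : Icc 0 t, ‖φ r - φ' r‖ ≤ 2 * a * Real.exp (2 * Lf * r) := by
    refine gronwall_weight (D := fun r : Icc 0 t => ‖φ r - φ' r‖)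
      (w := fun r => Real.exp (2 * Lf * r)) (B := B) ha0 (fun r => hw r r.2.1)
      (fun r => hB r ⟨r.2.1, r.2.2.trans ht⟩) ?_
    intro S hS hD ⟨r, hr⟩
    simp only
    have h1 := hw r hr.1
    rcases le_total r s with hrs | hrs
    · have := ha r ⟨hr.1, hrs⟩
      nlinarith
    · have hrT := hr.2.trans ht
      have e1 : φ r - φ' r = (φ s - φ' s) + ∫ q in s..r, (f q φ (α q) - f q φ' (α q)) := by
        rw [intervalIntegral.integral_sub (D.intervalIntegrable_f hφ hα hs hrs hrT)
          (D.intervalIntegrable_f hφ' hα hs hrs hrT), ← he r ⟨hrs, hr.2⟩, ← he' r ⟨hrs, hr.2⟩]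
        abel
      have e2 : ‖∫ q in s..r, (f q φ (α q) - f q φ' (α q))‖ ≤ S / 2 * Real.exp (2 * Lf * r) := by
        refine norm_integral_le_weight hS hrs ?_
        filter_upwards [D.ae_good_Ioc hs hrT] with q hq hq'
        refine ((hq hq').f_lip φ hφ φ' hφ' _).trans (mul_le_mul_of_nonneg_left ?_ hL)
        refine runSup_le (by positivity) fun p hp => ?_
        refine (hD ⟨p, hp.1, hp.2.trans (hq'.2.trans hr.2)⟩).trans ?_
        simp only
        have := hp.2
        gcongr
      rw [e1]
      refine (norm_add_le _ _).trans ?_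
      have e3 := ha s ⟨hs, le_rfl⟩
      nlinarith
  intro r hr
  refine (key ⟨r, hr⟩).trans ?_
  simp only
  have := hr.2.trans ht
  gcongr

lemma eq_of_integral_eq (D : Data T d f lam ell h Cf Clam Lf) (hφ : φ ∈ Cadlag T d)
    (hφ' : φ' ∈ Cadlag T d) (hα : Measurable α) (hs : 0 ≤ s) (ht : t ≤ T)
    (he : ∀ r ∈ Icc s t, φ r - φ s = ∫ q in s..r, f q φ (α q))
    (he' : ∀ r ∈ Icc s t, φ' r - φ' s = ∫ q in s..r, f q φ' (α q))
    (ha : ∀ r ∈ Icc 0 s, φ r = φ' r) : ∀ r ∈ Icc 0 t, φ r = φ' r := by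
  intro r hr
  have := D.norm_sub_le_of_integral_eq hφ hφ' hα hs ht he he' le_rfl
    (fun r hr => by simp [ha r hr]) r hr
  simp only [mul_zero, zero_mul, norm_le_zero_iff] at this
  exact sub_eq_zero.1 this

/-- Trajectories only depend on the past of the control. -/
lemma traj_congr_ctrl (D : Data T d f lam ell h Cf Clam Lf) (hs : s ∈ Icc 0 T)
    (hx : x ∈ Cadlag T d) (hα : Measurable α) (hφ : IsTraj T d f s x α φ)
    (hφ' : IsTraj T d f s x α' φ') (ht : t ≤ T) (hαα : ∀ r ∈ Ioo s t, α r = α' r) :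
    ∀ r ∈ Icc 0 t, φ r = φ' r := by
  refine D.eq_of_integral_eq (traj_mem_cadlag hs hx hφ) (traj_mem_cadlag hs hx hφ') hα hs.1 ht
    (fun r hr => D.traj_sub_eq hs hx hφ le_rfl hr.1 (hr.2.trans ht)) (fun r hr => ?_)
    fun r hr => by rw [hφ.1 r hr, hφ'.1 r hr]
  rw [D.traj_sub_eq hs hx hφ' le_rfl hr.1 (hr.2.trans ht)]
  refine intervalIntegral.integral_congr_Ioo_of_le hr.1 fun q hq => ?_
  simp only [hαα q ⟨hq.1, hq.2.trans_le hr.2⟩]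

/-- The flow property of trajectories. -/
lemma traj_restart (D : Data T d f lam ell h Cf Clam Lf) (hs : s ∈ Icc 0 T)
    (hx : x ∈ Cadlag T d) (hα : Measurable α) (hφ : IsTraj T d f s x α φ) (hst : s ≤ t)
    (ht : t ≤ T) (hφ' : IsTraj T d f t φ α φ') : ∀ r ∈ Icc 0 T, φ r = φ' r := by
  have hc := traj_mem_cadlag hs hx hφ
  have ht' : t ∈ Icc 0 T := ⟨hs.1.trans hst, ht⟩
  exact D.eq_of_integral_eq hc (traj_mem_cadlag ht' hc hφ') hα ht'.1 le_rfl
    (fun r hr => D.traj_sub_eq hs hx hφ hst hr.1 hr.2)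
    (fun r hr => D.traj_sub_eq ht' hc hφ' le_rfl hr.1 hr.2) fun r hr => (hφ'.1 r hr).symm

end Data

end Trajectories

section ValueFunction

set_option linter.unusedSectionVars false

lemma Cadlag.le_stopDist {T : ℝ} {d : ℕ} {x y : Path d} (hx : x ∈ Cadlag T d)
    (hy : y ∈ Cadlag T d) {t s r : ℝ} (ht : t ∈ Icc 0 T) (hs : s ∈ Icc 0 T) (hr : r ∈ Icc 0 T) :
    ‖x (min r t) - y (min r s)‖ ≤ stopDist T d t x s y := by
  obtain ⟨R, -, hR⟩ := Cadlag.exists_bound hx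
  obtain ⟨R', -, hR'⟩ := Cadlag.exists_bound hy
  refine le_csSup ⟨R + R', ?_⟩ ⟨r, hr, rfl⟩
  rintro _ ⟨q, hq, rfl⟩
  exact (norm_sub_le _ _).trans (add_le_add (hR _ ⟨le_min hq.1 ht.1, min_le_of_left_le hq.2⟩)
    (hR' _ ⟨le_min hq.1 hs.1, min_le_of_left_le hq.2⟩))

lemma XSet.norm_sub_stop_le {T : ℝ} {d : ℕ} {L B t m : ℝ} {x x' : Path d} (hL : 0 ≤ L)
    (ht : t ∈ Icc 0 T) (hx' : x' ∈ XSet T d L t x) (hB : 1 + runSup d x' T ≤ B) (htm : t ≤ m)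
    (hm : m ≤ T) {r : ℝ} (hr : r ∈ Icc 0 m) : ‖x' r - x (min r t)‖ ≤ L * B * (m - t) := by
  obtain ⟨hc, he, hlip⟩ := (mem_XSet_iff hL ht.2).1 hx'
  have hB0 : 0 ≤ B := by linarith [runSup_nonneg x' T]
  rcases le_total r t with h | h
  · rw [min_eq_left h, he r ⟨hr.1, h⟩, sub_self, norm_zero]
    exact mul_nonneg (mul_nonneg hL hB0) (sub_nonneg.2 htm)
  · rw [min_eq_right h, ← he t ⟨ht.1, le_rfl⟩]
    refine (hlip.norm_sub_le hL hc hB ⟨le_rfl, ht.2⟩ ⟨h, hr.2.trans hm⟩).trans ?_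
    rw [abs_of_nonneg (sub_nonneg.2 h)]
    exact mul_le_mul_of_nonneg_left (sub_le_sub_right hr.2 _) (mul_nonneg hL hB0)

variable {T : ℝ} {d : ℕ} {A : Type*} [TopologicalSpace A]
  {f : ℝ → Path d → A → E d} {lam ell : ℝ → Path d → A → ℝ} {h : Path d → ℝ} {Cf Clam Lf : ℝ}
  [MeasurableSpace A] [BorelSpace A] {x x' φ φ' : Path d} {α α' : ℝ → A} {s t t' : ℝ}

/-- `Φ` maps initial conditions and controls to the corresponding trajectories. -/
def IsFlow (T : ℝ) (d : ℕ) (f : ℝ → Path d → A → E d)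
    (Φ : ℝ → Path d → (ℝ → A) → Path d) : Prop :=
  ∀ s ∈ Icc (0 : ℝ) T, ∀ x ∈ Cadlag T d, ∀ α ∈ CtrlSet A, IsTraj T d f s x α (Φ s x α)

variable {Φ : ℝ → Path d → (ℝ → A) → Path d}

namespace Data

lemma disc_congr_path (D : Data T d f lam ell h Cf Clam Lf) (hx : x ∈ Cadlag T d)
    (hx' : x' ∈ Cadlag T d) (hs : 0 ≤ s) (hst : s ≤ t) (ht : t ≤ T)
    (he : ∀ r ∈ Icc 0 t, x r = x' r) : disc lam s x α t = disc lam s x' α t := by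
  refine congrArg (fun I => Real.exp (-I)) (intervalIntegral.integral_congr_ae ?_)
  rw [uIoc_of_le hst]
  filter_upwards [D.ae_good_Ioc hs ht] with r hr hr'
  have h0 : runSup d (x - x') r ≤ 0 := runSup_le le_rfl fun q hq => by
    simp [he q ⟨hq.1, hq.2.trans hr'.2⟩]
  have h1 := (hr hr').lam_lip x hx x' hx' (α r)
  rw [le_antisymm h0 (runSup_nonneg _ _), mul_zero] at h1
  exact sub_eq_zero.1 (abs_nonpos_iff.1 h1)

lemma runCost_congr_path (D : Data T d f lam ell h Cf Clam Lf) (hx : x ∈ Cadlag T d)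
    (hx' : x' ∈ Cadlag T d) (hs : 0 ≤ s) (hst : s ≤ t) (ht : t ≤ T)
    (he : ∀ r ∈ Icc 0 t, x r = x' r) : runCost lam ell s x α t = runCost lam ell s x' α t := by
  refine intervalIntegral.integral_congr_ae ?_
  rw [uIoc_of_le hst]
  filter_upwards [D.ae_good_Ioc hs ht] with r hr hr'
  have h0 : runSup d (x - x') r ≤ 0 := runSup_le le_rfl fun q hq => by
    simp [he q ⟨hq.1, hq.2.trans hr'.2⟩]
  have h1 := (hr hr').ell_lip x hx x' hx' (α r)
  rw [le_antisymm h0 (runSup_nonneg _ _), mul_zero] at h1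
  rw [sub_eq_zero.1 (abs_nonpos_iff.1 h1), D.disc_congr_path hx hx' hs hr'.1.le (hr'.2.trans ht)
    fun q hq => he q ⟨hq.1, hq.2.trans hr'.2⟩]

lemma traj_congr (D : Data T d f lam ell h Cf Clam Lf) (hs : s ∈ Icc 0 T) (hx : x ∈ Cadlag T d)
    (hφ : IsTraj T d f s x α φ) (hα' : Measurable α') (hxx : ∀ r ∈ Icc 0 s, x r = x' r)
    (hαα : ∀ r ∈ Ioo s T, α r = α' r) : IsTraj T d f s x' α' φ := by
  have hc := traj_mem_cadlag hs hx hφ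
  refine ⟨fun t ht => (hφ.1 t ht).trans (hxx t ht), ?_, fun t ht => ?_⟩
  · have := D.intervalIntegrable_f hc hα' hs.1 hs.2 le_rfl
    rwa [intervalIntegrable_iff_integrableOn_Icc_of_le hs.2] at this
  · rw [hφ.2.2 t ht, hxx s ⟨hs.1, le_rfl⟩]
    congr 1
    refine intervalIntegral.integral_congr_Ioo_of_le ht.1 fun r hr => ?_
    simp only [hαα r ⟨hr.1, hr.2.trans_le ht.2⟩]

lemma flow_mem_xSet (D : Data T d f lam ell h Cf Clam Lf) (hΦ : IsFlow T d f Φ)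
    (hs : s ∈ Icc 0 T) (hx : x ∈ Cadlag T d) (hα : Measurable α) :
    Φ s x α ∈ XSet T d Cf s x :=
  D.traj_mem_xSet hs hx (hΦ s hs x hx α hα)

lemma exists_abs_cost_le (D : Data T d f lam ell h Cf Clam Lf) (hs : s ∈ Icc 0 T)
    (hx : x ∈ Cadlag T d) :
    ∃ C, 0 ≤ C ∧ ∀ x' ∈ XSet T d Cf s x, ∀ t ∈ Icc 0 T, ∀ α : ℝ → A,
      |pathCost T lam ell h t x' α| ≤ C := by
  obtain ⟨C, hC0, hC⟩ := D.term.bounded D.bound.1 hs hx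
  obtain ⟨R, hR0, hR⟩ := Cadlag.exists_bound hx
  have hf := D.bound.1
  have hT : 0 ≤ T := hs.1.trans hs.2
  refine ⟨Cf * (2 * (1 + R) * Real.exp (2 * Cf * T)) * T + C, by positivity,
    fun x' hx' t ht α => (D.abs_pathCost_le hx'.1 ht).trans ?_⟩
  have h2 := XSet.runSup_le hf hs hR0 (fun t ht => hR t ⟨ht.1, ht.2.trans hs.2⟩) hx'
  have h3 := hC x' hx'
  gcongr

lemma value_le (D : Data T d f lam ell h Cf Clam Lf) (hΦ : IsFlow T d f Φ) (hs : s ∈ Icc 0 T)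
    (hx : x ∈ Cadlag T d) (hα : Measurable α) :
    value T d A lam ell h Φ s x ≤ pathCost T lam ell h s (Φ s x α) α := by
  obtain ⟨C, -, hC⟩ := D.exists_abs_cost_le hs hx
  refine csInf_le ⟨-C, ?_⟩ ⟨α, hα, rfl⟩
  rintro _ ⟨β, hβ, rfl⟩
  exact (abs_le.1 (hC _ (D.flow_mem_xSet hΦ hs hx hβ) s hs β)).1

lemma le_value [Nonempty A] {c : ℝ}
    (hc : ∀ α : ℝ → A, Measurable α → c ≤ pathCost T lam ell h s (Φ s x α) α) :
    c ≤ value T d A lam ell h Φ s x := by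
  obtain ⟨a⟩ := ‹Nonempty A›
  refine le_csInf ⟨_, fun _ => a, measurable_const, rfl⟩ ?_
  rintro _ ⟨β, hβ, rfl⟩
  exact hc β hβ

lemma exists_cost_lt [Nonempty A] {c : ℝ} (hc : value T d A lam ell h Φ s x < c) :
    ∃ α : ℝ → A, Measurable α ∧ pathCost T lam ell h s (Φ s x α) α < c := by
  by_contra! H
  exact absurd (le_value H) (not_le.2 hc)

lemma value_terminal (D : Data T d f lam ell h Cf Clam Lf) [Nonempty A] (hΦ : IsFlow T d f Φ)
    (hT : 0 ≤ T) (hx : x ∈ Cadlag T d) : value T d A lam ell h Φ T x = h x := by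
  have hs : T ∈ Icc 0 T := ⟨hT, le_rfl⟩
  have key : ∀ α : ℝ → A, Measurable α → pathCost T lam ell h T (Φ T x α) α = h x := by
    intro α hα
    have h1 := hΦ T hs x hx α hα
    rw [D.pathCost_congr (traj_mem_cadlag hs hx h1) hx hα hs h1.1]
    simp [pathCost, runCost, disc]
  obtain ⟨a⟩ := ‹Nonempty A›
  refine le_antisymm ((D.value_le hΦ hs hx (α := fun _ => a) measurable_const).trans_eq
    (key _ measurable_const)) ?_
  have : Nonempty A := ⟨a⟩
  exact le_value fun α hα => (key α hα).ge

/-- One half of the dynamic programming principle. -/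
lemma value_le_add (D : Data T d f lam ell h Cf Clam Lf) [Nonempty A] (hΦ : IsFlow T d f Φ)
    (hs : s ∈ Icc 0 T) (hx : x ∈ Cadlag T d) (hα : Measurable α) (hst : s ≤ t) (ht : t ≤ T) :
    value T d A lam ell h Φ s x ≤ runCost lam ell s (Φ s x α) α t +
      disc lam s (Φ s x α) α t * value T d A lam ell h Φ t (Φ s x α) := by
  refine le_of_forall_pos_le_add fun ε hε => ?_
  have ht' : t ∈ Icc 0 T := ⟨hs.1.trans hst, ht⟩
  have hφ := hΦ s hs x hx α hα
  have hφc := traj_mem_cadlag hs hx hφ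
  set φ := Φ s x α
  obtain ⟨β, hβ, hlt⟩ := exists_cost_lt (lt_add_of_pos_right
    (value T d A lam ell h Φ t φ) hε)
  have hψ := hΦ t ht' φ hφc β hβ
  have hψc := traj_mem_cadlag ht' hφc hψ
  set ψ := Φ t φ β
  let γ : ℝ → A := fun r => if r < t then α r else β r
  have hγ : Measurable γ := Measurable.ite measurableSet_Iio hα hβ
  have hγα : ∀ r ∈ Ioo s t, γ r = α r := fun r hr => if_pos hr.2
  have hγβ : ∀ r ∈ Ioo t T, β r = γ r := fun r hr => (if_neg (not_lt.2 hr.1.le)).symm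
  have hχ := hΦ s hs x hx γ hγ
  have hχc := traj_mem_cadlag hs hx hχ
  have h1 := D.traj_congr_ctrl hs hx hα hφ hχ ht fun r hr => (hγα r hr).symm
  have h2 := D.traj_congr ht' hφc hψ hγ h1 hγβ
  have h3 := D.traj_restart hs hx hγ hχ hst ht h2
  have h4 := D.value_le hΦ hs hx hγ
  rw [D.pathCost_congr hχc hψc hγ hs h3, D.pathCost_eq_add hψc hγ hs.1 hst ht,
    runCost_congr_ctrl hst hγα, disc_congr_ctrl hst hγα,
    D.runCost_congr_path hψc hφc hs.1 hst ht hψ.1, D.disc_congr_path hψc hφc hs.1 hst ht hψ.1] at h4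
  have h5 : pathCost T lam ell h t ψ γ = pathCost T lam ell h t ψ β := by
    unfold pathCost
    rw [runCost_congr_ctrl ht hγβ, disc_congr_ctrl ht hγβ]
  rw [h5] at h4
  have h6 := D.disc_le_one (α := α) hφc hs.1 hst ht
  have h7 : 0 < disc lam s φ α t := disc_pos
  nlinarith

/-- The other half of the dynamic programming principle. -/
lemma add_value_le (D : Data T d f lam ell h Cf Clam Lf) (hΦ : IsFlow T d f Φ)
    (hs : s ∈ Icc 0 T) (hx : x ∈ Cadlag T d) (hα : Measurable α) (hst : s ≤ t) (ht : t ≤ T) :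
    runCost lam ell s (Φ s x α) α t +
      disc lam s (Φ s x α) α t * value T d A lam ell h Φ t (Φ s x α) ≤
      pathCost T lam ell h s (Φ s x α) α := by
  have ht' : t ∈ Icc 0 T := ⟨hs.1.trans hst, ht⟩
  have hφ := hΦ s hs x hx α hα
  have hφc := traj_mem_cadlag hs hx hφ
  have hψ := hΦ t ht' _ hφc α hα
  have h1 := D.value_le hΦ ht' hφc hα
  rw [← D.pathCost_congr hφc (traj_mem_cadlag ht' hφc hψ) hα ht'
    (D.traj_restart hs hx hα hφ hst ht hψ)] at h1
  rw [D.pathCost_eq_add hφc hα hs.1 hst ht]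
  have h7 : 0 < disc lam s (Φ s x α) α t := disc_pos
  gcongr

lemma abs_pathCost_sub_time_le (D : Data T d f lam ell h Cf Clam Lf) (hx : x ∈ Cadlag T d)
    (hα : Measurable α) (hs : 0 ≤ s) (hst : s ≤ t) (ht : t ≤ T) :
    |pathCost T lam ell h s x α - pathCost T lam ell h t x α| ≤
      (Cf * (1 + runSup d x T) + Clam * |pathCost T lam ell h t x α|) * (t - s) := by
  have h1 := D.abs_runCost_le (α := α) hx hs hst ht
  have h2 := D.one_sub_disc_le (α := α) hx hs hst ht
  have h3 := D.disc_le_one (α := α) hx hs hst ht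
  rw [D.pathCost_eq_add hx hα hs hst ht]
  have h4 : runCost lam ell s x α t + disc lam s x α t * pathCost T lam ell h t x α -
      pathCost T lam ell h t x α = runCost lam ell s x α t -
        (1 - disc lam s x α t) * pathCost T lam ell h t x α := by ring
  rw [h4]
  refine (abs_sub _ _).trans ?_
  rw [abs_mul, abs_of_nonneg (sub_nonneg.2 h3)]
  have := mul_le_mul_of_nonneg_right h2 (abs_nonneg (pathCost T lam ell h t x α))
  linarith

/-- Trajectories depend continuously on the initial condition, uniformly in the control. -/
lemma flow_supDist_le (D : Data T d f lam ell h Cf Clam Lf) (hΦ : IsFlow T d f Φ)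
    {t₀ B δ : ℝ} {x₀ : Path d} (ht₀ : t₀ ∈ Icc 0 T) (hx₀ : x₀ ∈ Cadlag T d) (ht : t ∈ Icc 0 T)
    (hx : x ∈ Cadlag T d) (hα : Measurable α) (hδ : dInf T d (t₀, x₀) (t, x) ≤ δ)
    (hB₀ : 1 + runSup d (Φ t₀ x₀ α) T ≤ B) (hB : 1 + runSup d (Φ t x α) T ≤ B) :
    supDist T d (Φ t₀ x₀ α) (Φ t x α) ≤
      2 * ((1 + 2 * (Cf * B)) * δ) * Real.exp (2 * Lf * T) := by
  have hf := D.bound.1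
  have hφ₀ := hΦ t₀ ht₀ x₀ hx₀ α hα
  have hφ := hΦ t ht x hx α hα
  have hm₀ := D.traj_mem_xSet ht₀ hx₀ hφ₀
  have hm := D.traj_mem_xSet ht hx hφ
  have hM : max t₀ t ≤ T := max_le ht₀.2 ht.2
  have hS : 0 ≤ stopDist T d t₀ x₀ t x :=
    Real.sSup_nonneg (by rintro _ ⟨r, -, rfl⟩; exact norm_nonneg _)
  have hB0 : 0 ≤ B := by linarith [runSup_nonneg (Φ t x α) T]
  have hd : |t₀ - t| + stopDist T d t₀ x₀ t x ≤ δ := hδ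
  have hδ0 : 0 ≤ δ := (add_nonneg (abs_nonneg _) hS).trans hd
  have e1 : max t₀ t - t₀ ≤ δ := by
    rcases max_cases t₀ t with ⟨h1, h2⟩ | ⟨h1, h2⟩ <;> rw [h1] <;>
      linarith [neg_abs_le (t₀ - t), le_abs_self (t₀ - t)]
  have e2 : max t₀ t - t ≤ δ := by
    rcases max_cases t₀ t with ⟨h1, h2⟩ | ⟨h1, h2⟩ <;> rw [h1] <;>
      linarith [neg_abs_le (t₀ - t), le_abs_self (t₀ - t)]
  have hCB : 0 ≤ Cf * B := mul_nonneg hf hB0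
  refine supDist_le (by positivity) ?_
  refine D.norm_sub_le_of_integral_eq hm₀.1 hm.1 hα (ht₀.1.trans (le_max_left _ t)) le_rfl
    (fun r hr => D.traj_sub_eq ht₀ hx₀ hφ₀ (le_max_left _ _) hr.1 hr.2)
    (fun r hr => D.traj_sub_eq ht hx hφ (le_max_right _ _) hr.1 hr.2) (by positivity)
    fun r hr => ?_
  have h1 := XSet.norm_sub_stop_le hf ht₀ hm₀ hB₀ (le_max_left _ t) hM hr
  have h2 := XSet.norm_sub_stop_le hf ht hm hB (le_max_right t₀ _) hM hr
  have h3 := Cadlag.le_stopDist hx₀ hx ht₀ ht ⟨hr.1, hr.2.trans hM⟩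
  have h4 : Φ t₀ x₀ α r - Φ t x α r = (Φ t₀ x₀ α r - x₀ (min r t₀)) +
      (x₀ (min r t₀) - x (min r t)) - (Φ t x α r - x (min r t)) := by abel
  rw [h4]
  refine (norm_sub_le _ _).trans ?_
  have h5 := norm_add_le (Φ t₀ x₀ α r - x₀ (min r t₀)) (x₀ (min r t₀) - x (min r t))
  have h6 := mul_le_mul_of_nonneg_left e1 hCB
  have h7 := mul_le_mul_of_nonneg_left e2 hCB
  have := abs_nonneg (t₀ - t)
  linarith

/-- The value function is continuous. -/
lemma value_cont2 (D : Data T d f lam ell h Cf Clam Lf) [Nonempty A] (hΦ : IsFlow T d f Φ) :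
    Cont2 T d (value T d A lam ell h Φ) := by
  intro t₀ ht₀ x₀ hx₀ ε hε
  have hf := D.bound.1
  have hCl := D.bound.2.1
  have hL := D.lip.1
  have hT : 0 ≤ T := ht₀.1.trans ht₀.2
  obtain ⟨R, hR0, hR⟩ := Cadlag.exists_bound hx₀
  obtain ⟨C, hC0, hC⟩ := D.exists_abs_cost_le ht₀ hx₀
  obtain ⟨δ₁, hδ₁, H⟩ := D.pathCost_uniform ht₀ hx₀ (show 0 < ε / 4 by positivity)
  set B := 2 * (1 + (R + 1)) * Real.exp (2 * Cf * T) with hBdef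
  have hB0 : 0 ≤ B := by positivity
  set M := 2 * (1 + 2 * (Cf * B)) * Real.exp (2 * Lf * T) with hMdef
  have hM : 0 < M := by positivity
  set N := 2 * (Cf * B) + Clam * (2 * C + ε / 4) with hNdef
  have hN : 0 ≤ N := by positivity
  refine ⟨min 1 (min (δ₁ / (2 * M)) (ε / (4 * (N + 1)))), by positivity, fun t ht x hx hd => ?_⟩
  set δ := dInf T d (t₀, x₀) (t, x)
  have hδ1 : δ < 1 := hd.trans_le (min_le_left _ _)
  have hδ2 : δ < δ₁ / (2 * M) := hd.trans_le ((min_le_right _ _).trans (min_le_left _ _))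
  have hδ3 : δ < ε / (4 * (N + 1)) := hd.trans_le ((min_le_right _ _).trans (min_le_right _ _))
  have hS : 0 ≤ stopDist T d t₀ x₀ t x :=
    Real.sSup_nonneg (by rintro _ ⟨r, -, rfl⟩; exact norm_nonneg _)
  have hdef : |t₀ - t| + stopDist T d t₀ x₀ t x = δ := rfl
  have hδ0 : 0 ≤ δ := hdef ▸ add_nonneg (abs_nonneg _) hS
  have hx' : ∀ r ∈ Icc 0 t, ‖x r‖ ≤ R + 1 := by
    intro r hr
    have h1 := Cadlag.le_stopDist hx₀ hx ht₀ ht ⟨hr.1, hr.2.trans ht.2⟩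
    rw [min_eq_left hr.2] at h1
    have h2 := hR _ ⟨le_min hr.1 ht₀.1, min_le_of_right_le ht₀.2⟩
    have h3 := norm_sub_norm_le (x r) (x₀ (min r t₀))
    rw [norm_sub_rev] at h3
    linarith [abs_nonneg (t₀ - t)]
  have key : ∀ α : ℝ → A, Measurable α →
      |pathCost T lam ell h t (Φ t x α) α - pathCost T lam ell h t₀ (Φ t₀ x₀ α) α| ≤ ε / 2 := by
    intro α hα
    have hm₀ := D.flow_mem_xSet hΦ ht₀ hx₀ hα
    have hm := D.flow_mem_xSet hΦ ht hx hα
    have hB₁ : 1 + runSup d (Φ t₀ x₀ α) T ≤ B := XSet.runSup_le hf ht₀ (by positivity)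
      (fun r hr => (hR r ⟨hr.1, hr.2.trans ht₀.2⟩).trans (by linarith)) hm₀
    have hB₂ : 1 + runSup d (Φ t x α) T ≤ B := XSet.runSup_le hf ht (by positivity) hx' hm
    have h1 := D.flow_supDist_le hΦ ht₀ hx₀ ht hx hα le_rfl hB₁ hB₂
    set m := max t₀ t
    have hmT : m ≤ T := max_le ht₀.2 ht.2
    have hm0 : 0 ≤ m := ht₀.1.trans (le_max_left _ _)
    have e1 : m - t₀ ≤ δ := by
      rcases max_cases t₀ t with ⟨h1, h2⟩ | ⟨h1, h2⟩ <;> simp only [m, h1] <;>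
        linarith [neg_abs_le (t₀ - t), le_abs_self (t₀ - t)]
    have e2 : m - t ≤ δ := by
      rcases max_cases t₀ t with ⟨h1, h2⟩ | ⟨h1, h2⟩ <;> simp only [m, h1] <;>
        linarith [neg_abs_le (t₀ - t), le_abs_self (t₀ - t)]
    have h2 : supDist T d (Φ t₀ x₀ α) (Φ t x α) < δ₁ := by
      refine h1.trans_lt ?_
      rw [lt_div_iff₀ (by positivity)] at hδ2
      have : 2 * ((1 + 2 * (Cf * B)) * δ) * Real.exp (2 * Lf * T) = δ * M := by
        rw [hMdef]; ring
      have h3 : 0 ≤ δ * M := by positivity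
      linarith
    have h3 := H _ hm₀ _ hm.1 h2 α hα m ⟨hm0, hmT⟩
    have h4 := D.abs_pathCost_sub_time_le hm₀.1 hα ht₀.1 (le_max_left t₀ t) hmT
    have h5 := D.abs_pathCost_sub_time_le hm.1 hα ht.1 (le_max_right t₀ t) hmT
    have h6 := hC _ hm₀ m ⟨hm0, hmT⟩ α
    have h7 : |pathCost T lam ell h m (Φ t x α) α| ≤ C + ε / 4 := by
      have := abs_sub_abs_le_abs_sub (pathCost T lam ell h m (Φ t x α) α)
        (pathCost T lam ell h m (Φ t₀ x₀ α) α)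
      rw [abs_sub_comm] at this
      linarith
    have h8 : (Cf * (1 + runSup d (Φ t₀ x₀ α) T) +
        Clam * |pathCost T lam ell h m (Φ t₀ x₀ α) α|) * (m - t₀) ≤ (Cf * B + Clam * C) * δ := by
      have := sub_nonneg.2 (le_max_left t₀ t)
      gcongr
    have h9 : (Cf * (1 + runSup d (Φ t x α) T) +
        Clam * |pathCost T lam ell h m (Φ t x α) α|) * (m - t) ≤
        (Cf * B + Clam * (C + ε / 4)) * δ := by
      have := sub_nonneg.2 (le_max_right t₀ t)
      gcongr
    have h10 : (Cf * B + Clam * C) * δ + (Cf * B + Clam * (C + ε / 4)) * δ ≤ ε / 4 := by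
      rw [lt_div_iff₀ (by positivity)] at hδ3
      have : (Cf * B + Clam * C) * δ + (Cf * B + Clam * (C + ε / 4)) * δ = δ * N := by
        rw [hNdef]; ring
      linarith
    have e3 := abs_sub_le (pathCost T lam ell h t (Φ t x α) α)
      (pathCost T lam ell h m (Φ t x α) α) (pathCost T lam ell h t₀ (Φ t₀ x₀ α) α)
    have e4 := abs_sub_le (pathCost T lam ell h m (Φ t x α) α)
      (pathCost T lam ell h m (Φ t₀ x₀ α) α) (pathCost T lam ell h t₀ (Φ t₀ x₀ α) α)
    rw [abs_sub_comm (pathCost T lam ell h m (Φ t x α) α) (pathCost T lam ell h m _ α),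
      abs_sub_comm (pathCost T lam ell h m (Φ t₀ x₀ α) α) (pathCost T lam ell h t₀ _ α)] at e4
    linarith
  refine lt_of_le_of_lt ?_ (half_lt_self hε)
  rw [abs_le]
  constructor
  · have : value T d A lam ell h Φ t₀ x₀ - ε / 2 ≤ value T d A lam ell h Φ t x :=
      le_value fun α hα => by
        linarith [(abs_le.1 (key α hα)).1, D.value_le hΦ ht₀ hx₀ hα]
    linarith
  · have : value T d A lam ell h Φ t x - ε / 2 ≤ value T d A lam ell h Φ t₀ x₀ :=
      le_value fun α hα => by
        linarith [(abs_le.1 (key α hα)).2, D.value_le hΦ ht hx hα]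
    linarith

end Data

lemma Cont2.lscOn {u : ℝ → Path d → ℝ} (hu : Cont2 T d u) : LscOn T d u := by
  intro t₀ ht₀ x₀ hx₀ c hc
  obtain ⟨δ, hδ, H⟩ := hu t₀ ht₀ x₀ hx₀ (u t₀ x₀ - c) (sub_pos.2 hc)
  exact ⟨δ, hδ, fun t ht x hx hd => by linarith [(abs_lt.1 (H t ht x hx hd)).1]⟩

lemma Cont2.uscOn {u : ℝ → Path d → ℝ} (hu : Cont2 T d u) : UscOn T d u := by
  intro t₀ ht₀ x₀ hx₀ c hc
  obtain ⟨δ, hδ, H⟩ := hu t₀ ht₀ x₀ hx₀ (c - u t₀ x₀) (sub_pos.2 hc)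
  exact ⟨δ, hδ, fun t ht x hx hd => by linarith [(abs_lt.1 (H t ht x hx hd)).2]⟩

lemma dInf_same_le {t : ℝ} (ht : t ∈ Icc 0 T) (hx : x ∈ Cadlag T d) (hx' : x' ∈ Cadlag T d) :
    dInf T d (t, x) (t, x') ≤ supDist T d x x' := by
  have h0 : dInf T d (t, x) (t, x') = stopDist T d t x t x' := by simp [dInf]
  rw [h0]
  refine Real.sSup_le ?_ (runSup_nonneg _ _)
  rintro _ ⟨r, hr, rfl⟩
  exact Cadlag.le_supDist hx hx' ⟨le_min hr.1 ht.1, min_le_of_left_le hr.2⟩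

lemma dInf_stop_eq_zero {t : ℝ} (ht : t ∈ Icc 0 T) (he : ∀ r ∈ Icc 0 t, x r = x' r) :
    dInf T d (t, x) (t, x') ≤ 0 := by
  have h0 : dInf T d (t, x) (t, x') = stopDist T d t x t x' := by simp [dInf]
  rw [h0]
  refine Real.sSup_le ?_ le_rfl
  rintro _ ⟨r, hr, rfl⟩
  simp [he _ ⟨le_min hr.1 ht.1, min_le_right r t⟩]

end ValueFunction

section HamiltonianBounds

set_option linter.unusedSectionVars false

variable {T : ℝ} {d : ℕ} {A : Type*} [TopologicalSpace A]
  {f : ℝ → Path d → A → E d} {lam ell : ℝ → Path d → A → ℝ} {h : Path d → ℝ} {Cf Clam Lf : ℝ}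
  {x x' x₀ : Path d} {y y' : ℝ} {z : E d} {s t t' : ℝ}

namespace Good

lemma abs_le (G : Good T d f lam ell Cf Clam Lf t) (hx : x ∈ Cadlag T d) (a : A) :
    |ell t x a + ⟪f t x a, z⟫_ℝ - lam t x a * y| ≤
      Cf * (1 + runSup d x t) * (1 + ‖z‖) + Clam * |y| := by
  have h1 := G.ell_le x hx a
  have h2 := abs_real_inner_le_norm (f t x a) z
  have h3 := mul_le_mul_of_nonneg_right (G.f_le x hx a) (norm_nonneg z)
  have h4 := mul_le_mul_of_nonneg_right (G.lam_le x hx a) (abs_nonneg y)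
  have h5 : |lam t x a * y| = lam t x a * |y| := by
    rw [abs_mul, abs_of_nonneg (G.lam_nonneg x hx a)]
  have h6 := abs_sub (ell t x a + ⟪f t x a, z⟫_ℝ) (lam t x a * y)
  have h7 := abs_add_le (ell t x a) (⟪f t x a, z⟫_ℝ)
  linarith

lemma bddBelow (G : Good T d f lam ell Cf Clam Lf t) (hx : x ∈ Cadlag T d) :
    BddBelow (range fun a => ell t x a + ⟪f t x a, z⟫_ℝ - lam t x a * y) := by
  refine ⟨-(Cf * (1 + runSup d x t) * (1 + ‖z‖) + Clam * |y|), ?_⟩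
  rintro _ ⟨a, rfl⟩
  exact (_root_.abs_le.1 (G.abs_le hx a)).1

lemma hctrl_le (G : Good T d f lam ell Cf Clam Lf t) (hx : x ∈ Cadlag T d) (a : A) :
    Hctrl d f lam ell t x y z ≤ ell t x a + ⟪f t x a, z⟫_ℝ - lam t x a * y :=
  csInf_le (G.bddBelow hx) ⟨a, rfl⟩

lemma abs_hctrl_le [Nonempty A] (G : Good T d f lam ell Cf Clam Lf t) (hx : x ∈ Cadlag T d) :
    |Hctrl d f lam ell t x y z| ≤ Cf * (1 + runSup d x t) * (1 + ‖z‖) + Clam * |y| := by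
  refine _root_.abs_le.2 ⟨?_, ?_⟩
  · refine le_csInf (range_nonempty _) ?_
    rintro _ ⟨a, rfl⟩
    exact (_root_.abs_le.1 (G.abs_le hx a)).1
  · obtain ⟨a⟩ := ‹Nonempty A›
    exact (G.hctrl_le hx a).trans (_root_.abs_le.1 (G.abs_le hx a)).2

lemma abs_sub_le (G : Good T d f lam ell Cf Clam Lf t) (hx : x ∈ Cadlag T d)
    (hx' : x' ∈ Cadlag T d) (a : A) :
    |(ell t x a + ⟪f t x a, z⟫_ℝ - lam t x a * y) -
      (ell t x' a + ⟪f t x' a, z⟫_ℝ - lam t x' a * y')| ≤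
      Lf * (1 + ‖z‖ + |y|) * runSup d (x - x') t + Clam * |y - y'| := by
  have h1 := G.ell_lip x hx x' hx' a
  have h2 := G.lam_lip x hx x' hx' a
  have h3 := G.f_lip x hx x' hx' a
  have e2 := mul_le_mul_of_nonneg_right h2 (abs_nonneg y)
  have e3 := mul_le_mul_of_nonneg_right h3 (norm_nonneg z)
  have e4 := mul_le_mul_of_nonneg_right (G.lam_le x' hx' a) (abs_nonneg (y - y'))
  have k3 := abs_real_inner_le_norm (f t x a - f t x' a) z
  have k2 : |(lam t x a - lam t x' a) * y| = |lam t x a - lam t x' a| * |y| := abs_mul _ _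
  have k4 : |lam t x' a * (y - y')| = lam t x' a * |y - y'| := by
    rw [abs_mul, abs_of_nonneg (G.lam_nonneg x' hx' a)]
  have k5 : (ell t x a + ⟪f t x a, z⟫_ℝ - lam t x a * y) -
      (ell t x' a + ⟪f t x' a, z⟫_ℝ - lam t x' a * y') = (ell t x a - ell t x' a) +
        ⟪f t x a - f t x' a, z⟫_ℝ - (lam t x a - lam t x' a) * y - lam t x' a * (y - y') := by
    rw [inner_sub_left]; ring
  rw [k5]
  have l1 := abs_sub ((ell t x a - ell t x' a) +
        ⟪f t x a - f t x' a, z⟫_ℝ - (lam t x a - lam t x' a) * y) (lam t x' a * (y - y'))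
  have l2 := abs_sub ((ell t x a - ell t x' a) +
        ⟪f t x a - f t x' a, z⟫_ℝ) ((lam t x a - lam t x' a) * y)
  have l3 := abs_add_le (ell t x a - ell t x' a) (⟪f t x a - f t x' a, z⟫_ℝ)
  linarith

lemma hctrl_sub_le [Nonempty A] (G : Good T d f lam ell Cf Clam Lf t) (hx : x ∈ Cadlag T d)
    (hx' : x' ∈ Cadlag T d) :
    Hctrl d f lam ell t x' y' z - Hctrl d f lam ell t x y z ≤
      Lf * (1 + ‖z‖ + |y|) * runSup d (x - x') t + Clam * |y - y'| := by
  rw [sub_le_comm]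
  refine le_csInf (range_nonempty _) ?_
  rintro _ ⟨a, rfl⟩
  rw [sub_le_comm]
  have h0 := G.hctrl_le (y := y') (z := z) hx' a
  have h1 := (_root_.abs_le.1 (G.abs_sub_le (y := y) (y' := y') (z := z) hx hx' a)).1
  simp only
  linarith

lemma abs_hctrl_sub_le [Nonempty A] (G : Good T d f lam ell Cf Clam Lf t) (hL : 0 ≤ Lf)
    (hx : x ∈ Cadlag T d) (hx' : x' ∈ Cadlag T d) {Y : ℝ} (hy : |y| ≤ Y) (hy' : |y'| ≤ Y) :
    |Hctrl d f lam ell t x y z - Hctrl d f lam ell t x' y' z| ≤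
      Lf * (1 + ‖z‖ + Y) * runSup d (x - x') t + Clam * |y - y'| := by
  have h1 := G.hctrl_sub_le (y := y) (y' := y') (z := z) hx hx'
  have h2 := G.hctrl_sub_le (y := y') (y' := y) (z := z) hx' hx
  have h3 : runSup d (x' - x) t = runSup d (x - x') t :=
    congrArg sSup (image_congr fun _ _ => norm_sub_rev _ _)
  have h4 := runSup_nonneg (x - x') t
  have h5 : Lf * (1 + ‖z‖ + |y|) * runSup d (x - x') t ≤
    Lf * (1 + ‖z‖ + Y) * runSup d (x - x') t := by gcongr
  have h6 : Lf * (1 + ‖z‖ + |y'|) * runSup d (x - x') t ≤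
    Lf * (1 + ‖z‖ + Y) * runSup d (x - x') t := by gcongr
  rw [h3, abs_sub_comm y' y] at h2
  exact _root_.abs_le.2 ⟨by linarith, by linarith⟩

end Good

variable [MeasurableSpace A] [BorelSpace A] [Nonempty A]

namespace Data

lemma aemeasurable_hctrl (D : Data T d f lam ell h Cf Clam Lf) (hx : x ∈ Cadlag T d) {y : ℝ → ℝ}
    (hy : Measurable y) :
    AEMeasurable (fun t => Hctrl d f lam ell t x (y t) z) (volume.restrict (Ioc 0 T)) := by
  have := D.sigma.separableSpace
  have h1 : ∀ᵐ t ∂(volume.restrict (Ioc 0 T)), Hctrl d f lam ell t x (y t) z =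
      ⨅ k, (ell t x (TopologicalSpace.denseSeq A k) +
        ⟪f t x (TopologicalSpace.denseSeq A k), z⟫_ℝ -
          lam t x (TopologicalSpace.denseSeq A k) * y t) := by
    filter_upwards [D.ae_good_restrict] with t G
    refine ciInf_dense (g := fun a => ell t x a + ⟪f t x a, z⟫_ℝ - lam t x a * y t) ?_
      (G.bddBelow hx)
    exact ((G.contEll x hx).add ((G.contF x hx).inner continuous_const)).sub
      ((G.contLam x hx).mul continuous_const)
  refine AEMeasurable.congr (Measurable.aemeasurable ?_) (h1.mono fun _ h => h.symm)
  refine Measurable.iInf fun k => ?_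
  obtain ⟨m1, m2, m3⟩ := D.meas x (TopologicalSpace.denseSeq A k)
  exact (m3.add (m1.inner measurable_const)).sub (m2.mul hy)

lemma intervalIntegrable_hctrl (D : Data T d f lam ell h Cf Clam Lf) (hx : x ∈ Cadlag T d)
    {y : ℝ → ℝ} (hy : Continuous y) (hs : 0 ≤ s) (hst : s ≤ t) (ht : t ≤ T) :
    IntervalIntegrable (fun r => Hctrl d f lam ell r x (y r) z) volume s t := by
  obtain ⟨C, hC⟩ := (isCompact_Icc (a := s) (b := t)).exists_bound_of_continuousOn hy.continuousOn
  refine intervalIntegrable_of_ae_bound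
    (C := Cf * (1 + runSup d x T) * (1 + ‖z‖) + Clam * C)
    (D.aemeasurable_hctrl hx hy.measurable).aestronglyMeasurable hs hst ht ?_
  filter_upwards [D.ae_good_Ioc hs ht] with r hr hr'
  refine ((hr hr').abs_hctrl_le hx).trans ?_
  have h1 := Cadlag.runSup_mono hx (hr'.2.trans ht) le_rfl
  have h2 := D.bound.1
  have h3 := D.bound.2.1
  have h4 : |y r| ≤ C := hC r (Ioc_subset_Icc_self hr')
  gcongr

/-- Measurable selection of nearly optimal control values. -/
lemma exists_near_optimal (D : Data T d f lam ell h Cf Clam Lf) (hx : x ∈ Cadlag T d) {y : ℝ → ℝ}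
    (hy : Measurable y) (z : E d) {ε : ℝ} (hε : 0 < ε) :
    ∃ β : ℝ → A, Measurable β ∧ ∀ᵐ t, t ∈ Ioc 0 T →
      ell t x (β t) + ⟪f t x (β t), z⟫_ℝ - lam t x (β t) * y t ≤
        Hctrl d f lam ell t x (y t) z + ε := by
  have := D.sigma.separableSpace
  obtain ⟨β, hβ, H⟩ := exists_measurable_near_min (μ := volume.restrict (Ioc 0 T))
    (g := fun t a => ell t x a + ⟪f t x a, z⟫_ℝ - lam t x a * y t)
    (fun a => by
      obtain ⟨m1, m2, m3⟩ := D.meas x a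
      exact (m3.add (m1.inner measurable_const)).sub (m2.mul hy))
    (D.ae_good_restrict.mono fun t G => ⟨((G.contEll x hx).add
      ((G.contF x hx).inner continuous_const)).sub ((G.contLam x hx).mul continuous_const),
      G.bddBelow hx⟩) hε
  exact ⟨β, hβ, (ae_restrict_iff' measurableSet_Ioc).1 H⟩

end Data

end HamiltonianBounds

section Volterra

lemma exists_volterra {K s t : ℝ} (hst : s ≤ t) {w : ℝ → ℝ}
    (hw : ContinuousOn w (Icc s t)) {q : ℝ → ℝ → ℝ}
    (hq : ∀ y : ℝ → ℝ, Continuous y → IntervalIntegrable (fun r => q r (y r)) volume s t)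
    (hlip : ∀ᵐ r, r ∈ Ioc s t → ∀ y y', |q r y - q r y'| ≤ K * |y - y'|) :
    ∃ y : ℝ → ℝ, Continuous y ∧ ∀ r ∈ Icc s t, y r = w r + ∫ p in s..r, q p (y p) := by
  let ext : C(Icc s t, ℝ) → ℝ → ℝ := fun u r => Real.exp (2 * K * r) * u (projIcc s t hst r)
  have hext : ∀ u, Continuous (ext u) := fun u => by
    have := u.continuous.comp (continuous_projIcc (h := hst))
    have h2 : Continuous fun r : ℝ => Real.exp (2 * K * r) := by fun_prop
    exact h2.mul this
  have hint : ∀ u, ∀ r ∈ Icc s t, IntervalIntegrable (fun p => q p (ext u p)) volume s r :=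
    fun u r hr => (hq _ (hext u)).mono_set (by
      rw [uIcc_of_le hst, uIcc_of_le hr.1]; exact Icc_subset_Icc le_rfl hr.2)
  let U : C(Icc s t, ℝ) → C(Icc s t, ℝ) := fun u =>
    ⟨fun r => Real.exp (-(2 * K * r)) * (w r + ∫ p in s..r, q p (ext u p)), by
      have h1 : ContinuousOn (fun r => ∫ p in s..r, q p (ext u p)) (Icc s t) := by
        have := intervalIntegral.continuousOn_primitive_interval (a := s) (b := t) (μ := volume)
          (f := fun p => q p (ext u p)) (by
            have := hq _ (hext u)
            rw [uIcc_of_le hst]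
            rwa [intervalIntegrable_iff_integrableOn_Icc_of_le hst] at this)
        rwa [uIcc_of_le hst] at this
      have h2 : Continuous fun r : Icc s t => Real.exp (-(2 * K * r)) := by fun_prop
      exact h2.mul (continuousOn_iff_continuous_domRestrict.1 (hw.add h1))⟩
  have hU : ContractingWith (1 / 2) U := by
    refine ⟨by norm_num, LipschitzWith.of_dist_le_mul fun u v => ?_⟩
    have h0 : (0 : ℝ) ≤ ((1 / 2 : NNReal) : ℝ) * dist u v := by positivity
    refine (ContinuousMap.dist_le h0).2 fun r => ?_
    have h1 : ‖∫ p in s..r, (q p (ext u p) - q p (ext v p))‖ ≤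
        dist u v / 2 * Real.exp (2 * K * r) := by
      refine norm_integral_le_weight dist_nonneg r.2.1 ?_
      filter_upwards [hlip] with p hp hp'
      refine (hp ⟨hp'.1, hp'.2.trans r.2.2⟩ _ _).trans ?_
      have h2 : |ext u p - ext v p| ≤ dist u v * Real.exp (2 * K * p) := by
        have := ContinuousMap.dist_apply_le_dist (f := u) (g := v) (projIcc s t hst p)
        rw [Real.dist_eq] at this
        simp only [ext]
        rw [← mul_sub, abs_mul, abs_of_pos (Real.exp_pos _), mul_comm]
        gcongr
      have hK : 0 ≤ K := by
        have := hp ⟨hp'.1, hp'.2.trans r.2.2⟩ 1 0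
        have h3 := (abs_nonneg _).trans this
        simpa using h3
      gcongr
    have h2 : (U u) r - (U v) r =
        Real.exp (-(2 * K * r)) * ∫ p in s..r, (q p (ext u p) - q p (ext v p)) := by
      rw [intervalIntegral.integral_sub (hint u r r.2) (hint v r r.2)]
      simp only [U, ContinuousMap.coe_mk]
      ring
    rw [Real.dist_eq, h2, abs_mul, abs_of_pos (Real.exp_pos _)]
    calc _ ≤ Real.exp (-(2 * K * r)) * (dist u v / 2 * Real.exp (2 * K * r)) := by
          rw [Real.norm_eq_abs] at h1; gcongr
      _ = (dist u v / 2) * (Real.exp (-(2 * K * r)) * Real.exp (2 * K * r)) := by ring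
      _ = _ := by
        rw [← Real.exp_add]
        simp only [neg_add_cancel, Real.exp_zero, NNReal.coe_div, NNReal.coe_one, NNReal.coe_ofNat]
        ring
  obtain ⟨u, hu⟩ : ∃ u, U u = u := ⟨_, hU.fixedPoint_isFixedPt⟩
  refine ⟨ext u, hext u, fun r hr => ?_⟩
  have h1 : U u ⟨r, hr⟩ = u ⟨r, hr⟩ := by rw [hu]
  simp only [U, ContinuousMap.coe_mk] at h1
  have h2 : ext u r = Real.exp (2 * K * r) * u ⟨r, hr⟩ := by
    simp only [ext, projIcc_of_mem hst hr]
  rw [h2, ← h1, ← mul_assoc, ← Real.exp_add]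
  simp

lemma volterra_stability {K s t a b T : ℝ} (hK : 0 ≤ K) (hs : 0 ≤ s) (ht : t ≤ T) (ha : 0 ≤ a)
    (hb : 0 ≤ b) {w w' y y' q q' : ℝ → ℝ} (hst : s ≤ t)
    (hq : IntervalIntegrable q volume s t) (hq' : IntervalIntegrable q' volume s t)
    (hy : ∀ r ∈ Icc s t, y r = w r + ∫ p in s..r, q p)
    (hy' : ∀ r ∈ Icc s t, y' r = w' r + ∫ p in s..r, q' p)
    (hw : ∀ r ∈ Icc s t, |w r - w' r| ≤ a)
    (hb' : ∃ C, ∀ r ∈ Icc s t, |y r - y' r| ≤ C)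
    (h : ∀ᵐ r, r ∈ Ioc s t → |q r - q' r| ≤ b + K * |y r - y' r|) :
    ∀ r ∈ Icc s t, |y r - y' r| ≤ 2 * (a + b * T) * Real.exp (2 * K * T) := by
  obtain ⟨C, hC⟩ := hb'
  have hT : 0 ≤ T := hs.trans (hst.trans ht)
  have hw1 : ∀ r : ℝ, 0 ≤ r → 1 ≤ Real.exp (2 * K * r) := fun r hr =>
    Real.one_le_exp (by positivity)
  have key : ∀ r : Icc s t, |y r - y' r| ≤ 2 * (a + b * T) * Real.exp (2 * K * r) := by
    refine gronwall_weight (D := fun r : Icc s t => |y r - y' r|)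
      (w := fun r => Real.exp (2 * K * r)) (B := C) (by positivity)
      (fun r => hw1 r (hs.trans r.2.1)) (fun r => hC r r.2) ?_
    intro S hS hD ⟨r, hr⟩
    simp only
    have hsub : uIcc s r ⊆ uIcc s t := by
      rw [uIcc_of_le hst, uIcc_of_le hr.1]; exact Icc_subset_Icc le_rfl hr.2
    have hI := (hq.mono_set hsub).sub (hq'.mono_set hsub)
    have e1 : y r - y' r = (w r - w' r) + ∫ p in s..r, (q p - q' p) := by
      rw [hy r hr, hy' r hr, intervalIntegral.integral_sub (hq.mono_set hsub) (hq'.mono_set hsub)]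
      ring
    have e2 : |∫ p in s..r, (q p - q' p)| ≤ ∫ p in s..r, (b + K * S * Real.exp (2 * K * p)) := by
      rw [← Real.norm_eq_abs]
      refine intervalIntegral.norm_integral_le_of_norm_le hr.1 ?_
        (Continuous.intervalIntegrable (by fun_prop) _ _)
      filter_upwards [h] with p hp hp'
      have hpt : p ≤ t := hp'.2.trans hr.2
      refine (hp ⟨hp'.1, hpt⟩).trans ?_
      have := hD ⟨p, hp'.1.le, hpt⟩
      simp only at this
      have := mul_le_mul_of_nonneg_left this hK
      linarith
    have e3 : ∫ p in s..r, (b + K * S * Real.exp (2 * K * p)) =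
        b * (r - s) + S * ∫ p in s..r, K * Real.exp (2 * K * p) := by
      rw [intervalIntegral.integral_add (by simp)
        (Continuous.intervalIntegrable (by fun_prop) _ _),
        ← intervalIntegral.integral_const_mul]
      simp only [intervalIntegral.integral_const, smul_eq_mul, mul_comm b]
      congr 2
      ext p
      ring
    have e4 := mul_le_mul_of_nonneg_left (integral_weight_le (K := K) (s := s) (t := r)) hS
    have e5 : b * (r - s) ≤ b * T := by
      have := hr.2
      gcongr
      linarith
    have e6 := hw1 r (hs.trans hr.1)
    have e7 := hw r hr
    have e8 := abs_add_le (w r - w' r) (∫ p in s..r, (q p - q' p))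
    rw [e1]
    have e9 : 0 ≤ a + b * T := by positivity
    nlinarith
  intro r hr
  refine (key ⟨r, hr⟩).trans ?_
  simp only
  have := hr.2.trans ht
  gcongr

end Volterra

section Characteristics

set_option linter.unusedSectionVars false

variable {T : ℝ} {d : ℕ} {A : Type*} [TopologicalSpace A]
  {f : ℝ → Path d → A → E d} {lam ell : ℝ → Path d → A → ℝ} {h : Path d → ℝ} {Cf Clam Lf : ℝ}
  {x x' x₀ : Path d} {y y' : ℝ → ℝ} {y₀ : ℝ} {z : E d} {s t t' : ℝ}

/-- The second component of a characteristic pair with first component `x`. -/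
def IsYSol (T : ℝ) (d : ℕ) (f : ℝ → Path d → A → E d) (lam ell : ℝ → Path d → A → ℝ)
    (s : ℝ) (x : Path d) (y₀ : ℝ) (z : E d) (y : ℝ → ℝ) : Prop :=
  Continuous y ∧ ∀ t ∈ Icc s T,
    y t = (y₀ + ⟪x t - x s, z⟫_ℝ) + ∫ r in s..t, -Hctrl d f lam ell r x (y r) z

lemma XSet.continuousOn {L : ℝ} (hL : 0 ≤ L) (hs : s ≤ T) (hx : x ∈ XSet T d L s x₀) :
    ContinuousOn x (Icc s T) := by
  obtain ⟨hc, -, hlip⟩ := (mem_XSet_iff hL hs).1 hx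
  have h0 : 0 ≤ L * (1 + runSup d x T) := mul_nonneg hL (by linarith [runSup_nonneg x T])
  refine LipschitzOnWith.continuousOn (K := Real.toNNReal (L * (1 + runSup d x T)))
    (LipschitzOnWith.of_dist_le_mul fun a ha b hb => ?_)
  rw [Real.coe_toNNReal _ h0, dist_comm, dist_comm a, dist_eq_norm, Real.dist_eq]
  exact hlip.norm_sub_le hL hc le_rfl ha hb

lemma integral_inner_const {g : ℝ → E d} (hg : IntervalIntegrable g volume s t) (z : E d) :
    ∫ r in s..t, ⟪g r, z⟫_ℝ = ⟪∫ r in s..t, g r, z⟫_ℝ := by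
  have := (innerSL ℝ z).intervalIntegral_comp_comm hg
  simpa only [innerSL_apply_apply, real_inner_comm] using this

variable [MeasurableSpace A] [BorelSpace A]

lemma intervalIntegrable_inner_const {g : ℝ → E d} (hg : IntervalIntegrable g volume s t)
    (z : E d) : IntervalIntegrable (fun r => ⟪g r, z⟫_ℝ) volume s t :=
  ⟨hg.1.inner_const z, hg.2.inner_const z⟩

namespace Data

lemma exists_isYSol (D : Data T d f lam ell h Cf Clam Lf) [Nonempty A] (hs : s ∈ Icc 0 T)
    (hx : x ∈ XSet T d Cf s x₀) (y₀ : ℝ) (z : E d) :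
    ∃ y, IsYSol T d f lam ell s x y₀ z y := by
  refine exists_volterra (K := Clam) (q := fun r y => -Hctrl d f lam ell r x y z) hs.2 ?_
    (fun y hy => (D.intervalIntegrable_hctrl hx.1 hy hs.1 hs.2 le_rfl).neg) ?_
  · have := XSet.continuousOn D.bound.1 hs.2 hx
    exact continuousOn_const.add ((this.sub continuousOn_const).inner continuousOn_const)
  · filter_upwards [D.ae_good_Ioc hs.1 le_rfl] with r hr hr' y y'
    have h0 : runSup d (x - x) r ≤ 0 := runSup_le le_rfl fun q _ => by simp
    have h1 := (hr hr').abs_hctrl_sub_le (z := z) D.lip.1 hx.1 hx.1 (le_max_left |y| |y'|)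
      (le_max_right |y| |y'|)
    rw [le_antisymm h0 (runSup_nonneg _ _), mul_zero, zero_add] at h1
    rwa [neg_sub_neg, abs_sub_comm]

/-- Uniform bounds for characteristic pairs and their continuous dependence on the path. -/
lemma isYSol_bounds (D : Data T d f lam ell h Cf Clam Lf) [Nonempty A] (hs : s ∈ Icc 0 T)
    (hx₀ : x₀ ∈ Cadlag T d) (y₀ : ℝ) (z : E d) :
    ∃ Y K : ℝ, 0 ≤ Y ∧ 0 ≤ K ∧ ∀ x ∈ XSet T d Cf s x₀, ∀ y, IsYSol T d f lam ell s x y₀ z y →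
      (∀ t ∈ Icc s T, |y t| ≤ Y) ∧
      ∀ x' ∈ XSet T d Cf s x₀, ∀ y', IsYSol T d f lam ell s x' y₀ z y' → ∀ t ∈ Icc s T,
        ∀ a, 0 ≤ a → (∀ r ∈ Icc 0 t, ‖x r - x' r‖ ≤ a) → ∀ r ∈ Icc s t, |y r - y' r| ≤ K * a := by
  have hf := D.bound.1
  have hCl := D.bound.2.1
  have hL := D.lip.1
  have hT : 0 ≤ T := hs.1.trans hs.2
  obtain ⟨R, hR0, hR⟩ := Cadlag.exists_bound hx₀
  set B := 2 * (1 + R) * Real.exp (2 * Cf * T)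
  have hB0 : 0 ≤ B := by positivity
  set Y := 2 * ((|y₀| + 2 * B * ‖z‖) + Cf * B * (1 + ‖z‖) * T) * Real.exp (2 * Clam * T)
  have hY0 : 0 ≤ Y := by positivity
  have hB : ∀ x ∈ XSet T d Cf s x₀, 1 + runSup d x T ≤ B := fun x hx =>
    XSet.runSup_le hf hs hR0 (fun t ht => hR t ⟨ht.1, ht.2.trans hs.2⟩) hx
  have hY : ∀ x ∈ XSet T d Cf s x₀, ∀ y, IsYSol T d f lam ell s x y₀ z y →
      ∀ t ∈ Icc s T, |y t| ≤ Y := by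
    intro x hx y hy t ht
    have hxB := hB x hx
    have h1 := volterra_stability (K := Clam) (s := s) (t := T) (T := T)
      (a := |y₀| + 2 * B * ‖z‖) (b := Cf * B * (1 + ‖z‖)) (y' := fun _ => 0)
      (w' := fun _ => 0) (q' := fun _ => 0) hCl hs.1 le_rfl (by positivity) (by positivity) hs.2
      (D.intervalIntegrable_hctrl hx.1 hy.1 hs.1 hs.2 le_rfl).neg (by simp) hy.2 (by simp)
      (fun r hr => ?_) ?_ ?_ t ht
    · simpa only [sub_zero] using h1
    · simp only [sub_zero]
      have e1 := Cadlag.le_runSup hx.1 (s := r) ⟨hs.1.trans hr.1, hr.2⟩ le_rfl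
      have e2 := Cadlag.le_runSup hx.1 (s := s) hs le_rfl
      have e3 : ‖x r - x s‖ ≤ 2 * B := (norm_sub_le _ _).trans (by linarith)
      have e4 := abs_real_inner_le_norm (x r - x s) z
      have e5 := mul_le_mul_of_nonneg_right e3 (norm_nonneg z)
      exact (abs_add_le _ _).trans (by linarith)
    · obtain ⟨C, hC⟩ := (isCompact_Icc (a := s) (b := T)).exists_bound_of_continuousOn
        hy.1.continuousOn
      exact ⟨C, fun r hr => by simpa using hC r hr⟩
    · filter_upwards [D.ae_good_Ioc hs.1 le_rfl] with r hr hr'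
      simp only [sub_zero, Pi.neg_apply, abs_neg]
      refine ((hr hr').abs_hctrl_le hx.1).trans ?_
      have h2 := Cadlag.runSup_mono hx.1 hr'.2 le_rfl
      have h3 : 1 + runSup d x r ≤ B := by linarith
      gcongr
  refine ⟨Y, 2 * (‖z‖ * 2 + Lf * (1 + ‖z‖ + Y) * T) * Real.exp (2 * Clam * T), hY0,
    by positivity, fun x hx y hy => ⟨hY x hx y hy, ?_⟩⟩
  intro x' hx' y' hy' t ht a ha hxx r hr
  have h1 := volterra_stability (K := Clam) (s := s) (t := t) (T := T)
    (a := ‖z‖ * 2 * a) (b := Lf * (1 + ‖z‖ + Y) * a) hCl hs.1 ht.2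
    (by positivity) (by positivity) ht.1
    (D.intervalIntegrable_hctrl hx.1 hy.1 hs.1 ht.1 ht.2).neg
    (D.intervalIntegrable_hctrl hx'.1 hy'.1 hs.1 ht.1 ht.2).neg
    (fun r hr => hy.2 r ⟨hr.1, hr.2.trans ht.2⟩) (fun r hr => hy'.2 r ⟨hr.1, hr.2.trans ht.2⟩)
    (fun r hr => ?_) ⟨Y + Y, fun r hr => ?_⟩ ?_ r hr
  · refine h1.trans (le_of_eq ?_)
    ring
  · have e1 := hxx r ⟨hs.1.trans hr.1, hr.2⟩
    have e2 := hxx s ⟨hs.1, ht.1⟩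
    have e3 : y₀ + ⟪x r - x s, z⟫_ℝ - (y₀ + ⟪x' r - x' s, z⟫_ℝ) =
        ⟪(x r - x' r) - (x s - x' s), z⟫_ℝ := by
      simp only [inner_sub_left]; ring
    rw [e3]
    refine (abs_real_inner_le_norm _ _).trans ?_
    have e4 : ‖(x r - x' r) - (x s - x' s)‖ ≤ 2 * a := (norm_sub_le _ _).trans (by linarith)
    calc _ ≤ 2 * a * ‖z‖ := by gcongr
      _ = _ := by ring
  · have hrT := hr.2.trans ht.2
    exact (abs_sub _ _).trans (add_le_add (hY x hx y hy r ⟨hr.1, hrT⟩)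
      (hY x' hx' y' hy' r ⟨hr.1, hrT⟩))
  · filter_upwards [D.ae_good_Ioc hs.1 ht.2] with r hr hr'
    have hrT := hr'.2.trans ht.2
    simp only [Pi.neg_apply]
    rw [neg_sub_neg, abs_sub_comm]
    refine ((hr hr').abs_hctrl_sub_le hL hx.1 hx'.1 (hY x hx y hy r ⟨hr'.1.le, hrT⟩)
      (hY x' hx' y' hy' r ⟨hr'.1.le, hrT⟩)).trans ?_
    have h2 : runSup d (x - x') r ≤ a := runSup_le ha fun q hq =>
      hxx q ⟨hq.1, hq.2.trans hr'.2⟩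
    gcongr

lemma mem_ySet (D : Data T d f lam ell h Cf Clam Lf) [Nonempty A] (hs : s ∈ Icc 0 T)
    (hx : x ∈ XSet T d Cf s x₀) (hy : IsYSol T d f lam ell s x y₀ z y) :
    (x, y) ∈ YSet T d (Hctrl d f lam ell) Cf s x₀ y₀ z := by
  obtain ⟨hc, he, g, hg⟩ := hx
  have hH : ∀ t ∈ Icc s T, IntervalIntegrable (fun r => Hctrl d f lam ell r x (y r) z)
      volume s t := fun t ht => D.intervalIntegrable_hctrl hc hy.1 hs.1 ht.1 ht.2
  have hgi : ∀ t ∈ Icc s T, IntervalIntegrable (fun r => ⟪g r, z⟫_ℝ) volume s t := fun t ht =>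
    intervalIntegrable_inner_const (XDeriv.intervalIntegrable hg le_rfl ht.1 ht.2) z
  refine ⟨hc, he, hy.1.continuousOn, g, hg, ?_, fun t ht => ?_⟩
  · have := (hgi T ⟨hs.2, le_rfl⟩).sub (hH T ⟨hs.2, le_rfl⟩)
    exact (intervalIntegrable_iff_integrableOn_Icc_of_le hs.2).1 this
  · simp only
    rw [hy.2 t ht, intervalIntegral.integral_sub (hgi t ht) (hH t ht),
      integral_inner_const (XDeriv.intervalIntegrable hg le_rfl ht.1 ht.2),
      ← XDeriv.sub_eq hg le_rfl ht.1 ht.2, intervalIntegral.integral_neg]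
    ring

lemma disc_mul_add_runCost_sub (D : Data T d f lam ell h Cf Clam Lf) {α : ℝ → A}
    (hx : x ∈ Cadlag T d) (hα : Measurable α) (hs : 0 ≤ s) (hst : s ≤ t) (ht : t ≤ T) {q : ℝ → ℝ}
    (hq : IntervalIntegrable q volume s t) (hy : ∀ r ∈ Icc s t, y r = y₀ + ∫ r' in s..r, q r') :
    IntervalIntegrable (fun r => disc lam s x α r *
      (q r + ell r x (α r) - lam r x (α r) * y r)) volume s t ∧
    disc lam s x α t * y t + runCost lam ell s x α t - y₀ =
      ∫ r in s..t, disc lam s x α r * (q r + ell r x (α r) - lam r x (α r) * y r) := by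
  have h1 := D.disc_mul_sub hx hα hs hst ht hq hy
  have hyc : ContinuousOn y (uIcc s t) := by
    have h2 := intervalIntegral.continuousOn_primitive_interval' hq left_mem_uIcc
    have h3 : ContinuousOn (fun b => y₀ + ∫ r in s..b, q r) (uIcc s t) :=
      continuousOn_const.add h2
    refine h3.congr fun r hr => ?_
    rw [uIcc_of_le hst] at hr
    exact hy r hr
  have hi : IntervalIntegrable (fun r => q r - lam r x (α r) * y r) volume s t :=
    hq.sub ((D.intervalIntegrable_lam hx hα hs hst ht).mul_continuousOn hyc)
  have hi1 := D.intervalIntegrable_disc_mul hx hα hs le_rfl hst ht hi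
  have hi2 := D.intervalIntegrable_disc_mul hx hα hs le_rfl hst ht
    (D.intervalIntegrable_ell hx hα hs hst ht)
  have e : (fun r => disc lam s x α r * (q r + ell r x (α r) - lam r x (α r) * y r)) =
      fun r => disc lam s x α r * (q r - lam r x (α r) * y r) +
        disc lam s x α r * ell r x (α r) := by
    ext r; ring
  rw [e]
  refine ⟨hi1.add hi2, ?_⟩
  rw [intervalIntegral.integral_add hi1 hi2, ← h1]
  unfold runCost
  ring

end Data

end Characteristics

section ValueMinimax

set_option linter.unusedSectionVars false

variable {T : ℝ} {d : ℕ} {A : Type*} [TopologicalSpace A]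
  {f : ℝ → Path d → A → E d} {lam ell : ℝ → Path d → A → ℝ} {h : Path d → ℝ} {Cf Clam Lf : ℝ}
  [MeasurableSpace A] [BorelSpace A]
  {x x' x₀ φ : Path d} {y y' : ℝ → ℝ} {y₀ : ℝ} {z : E d} {α : ℝ → A} {s t t' : ℝ}
  {Φ : ℝ → Path d → (ℝ → A) → Path d}

namespace Data

lemma traj_disc_mul_add_runCost_sub (D : Data T d f lam ell h Cf Clam Lf) [Nonempty A]
    (hs : s ∈ Icc 0 T) (hx₀ : x₀ ∈ Cadlag T d) (hα : Measurable α) (hφ : IsTraj T d f s x₀ α φ)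
    (hy : IsYSol T d f lam ell s φ y₀ z y) (ht : t ∈ Icc s T) :
    IntervalIntegrable (fun r => disc lam s φ α r * (ell r φ (α r) + ⟪f r φ (α r), z⟫_ℝ -
      lam r φ (α r) * y r - Hctrl d f lam ell r φ (y r) z)) volume s t ∧
    disc lam s φ α t * y t + runCost lam ell s φ α t - y₀ =
      ∫ r in s..t, disc lam s φ α r * (ell r φ (α r) + ⟪f r φ (α r), z⟫_ℝ -
        lam r φ (α r) * y r - Hctrl d f lam ell r φ (y r) z) := by
  have hc := traj_mem_cadlag hs hx₀ hφ
  have hf : ∀ r ∈ Icc s T, IntervalIntegrable (fun q => f q φ (α q)) volume s r := fun r hr =>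
    D.intervalIntegrable_f hc hα hs.1 hr.1 hr.2
  have hH : ∀ r ∈ Icc s T, IntervalIntegrable (fun q => Hctrl d f lam ell q φ (y q) z)
      volume s r := fun r hr => D.intervalIntegrable_hctrl hc hy.1 hs.1 hr.1 hr.2
  have key := D.disc_mul_add_runCost_sub (y := y) (y₀ := y₀)
    (q := fun r => ⟪f r φ (α r), z⟫_ℝ - Hctrl d f lam ell r φ (y r) z) hc hα hs.1 ht.1 ht.2
    ((intervalIntegrable_inner_const (hf t ht) z).sub (hH t ht)) fun r hr => by
      have hr' : r ∈ Icc s T := ⟨hr.1, hr.2.trans ht.2⟩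
      rw [hy.2 r hr', intervalIntegral.integral_sub
        (intervalIntegrable_inner_const (hf r hr') z) (hH r hr'),
        integral_inner_const (hf r hr'), ← D.traj_sub_eq hs hx₀ hφ le_rfl hr'.1 hr'.2,
        intervalIntegral.integral_neg]
      ring
  have e : (fun r => disc lam s φ α r * (ell r φ (α r) + ⟪f r φ (α r), z⟫_ℝ -
      lam r φ (α r) * y r - Hctrl d f lam ell r φ (y r) z)) =
      fun r => disc lam s φ α r * (⟪f r φ (α r), z⟫_ℝ - Hctrl d f lam ell r φ (y r) z +
        ell r φ (α r) - lam r φ (α r) * y r) := by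
    ext r; ring
  rwa [e]

/-- Approximate characteristic inequalities pass to the limit. The sign `σ` treats upper and lower
inequalities simultaneously. -/
lemma exists_mem_ySet_of_approx (D : Data T d f lam ell h Cf Clam Lf) [Nonempty A]
    (hs : s ∈ Icc 0 T) (hx₀ : x₀ ∈ Cadlag T d) {u : ℝ → Path d → ℝ} (hu : Cont2 T d u) (σ : ℝ)
    (H : ∀ ε > 0, ∃ x ∈ XSet T d Cf s x₀, ∃ y, IsYSol T d f lam ell s x y₀ z y ∧
      ∀ t ∈ Icc s T, σ * u t x ≤ σ * y t + ε) :
    ∃ p ∈ YSet T d (Hctrl d f lam ell) Cf s x₀ y₀ z, ∀ t ∈ Icc s T,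
      σ * u t p.1 ≤ σ * p.2 t := by
  choose x hx y hy hxy using fun n : ℕ => H (1 / ((n : ℝ) + 1)) Nat.one_div_pos_of_nat
  obtain ⟨x', hx', k, hk, hlim⟩ := XSet.exists_tendsto_subseq D.bound.1 hs hx₀ hx
  obtain ⟨y', hy'⟩ := D.exists_isYSol hs hx' y₀ z
  obtain ⟨Y, K, hY0, hK0, hYK⟩ := D.isYSol_bounds hs hx₀ y₀ z
  refine ⟨(x', y'), D.mem_ySet hs hx' hy', fun t ht => ?_⟩
  have ht0 : t ∈ Icc 0 T := ⟨hs.1.trans ht.1, ht.2⟩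
  have hylim : Tendsto (fun n => y (k n) t) atTop (𝓝 (y' t)) := by
    rw [tendsto_iff_dist_tendsto_zero]
    refine squeeze_zero (fun n => dist_nonneg) (fun n => ?_) (by simpa using hlim.const_mul K)
    have h0 : 0 ≤ supDist T d (x (k n)) x' := runSup_nonneg (x (k n) - x') T
    exact (hYK _ (hx (k n)) _ (hy (k n))).2 x' hx' y' hy' T ⟨hs.2, le_rfl⟩ _ h0
      (fun r hr => Cadlag.le_supDist (hx (k n)).1 hx'.1 hr) t ht
  have hulim : Tendsto (fun n => u t (x (k n))) atTop (𝓝 (u t x')) := by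
    rw [Metric.tendsto_atTop]
    intro ε hε
    obtain ⟨δ, hδ, hd⟩ := hu t ht0 x' hx'.1 ε hε
    obtain ⟨N, hN⟩ := (hlim.eventually (gt_mem_nhds hδ)).exists_forall_of_atTop
    refine ⟨N, fun n hn => hd t ht0 _ (hx (k n)).1 ?_⟩
    refine (dInf_same_le ht0 hx'.1 (hx (k n)).1).trans_lt ?_
    rw [supDist_comm]
    exact hN n hn
  have hε : Tendsto (fun n => 1 / ((k n : ℝ) + 1)) atTop (𝓝 0) :=
    tendsto_one_div_add_atTop_nhds_zero_nat.comp hk.tendsto_atTop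
  have := le_of_tendsto_of_tendsto' (hulim.const_mul σ) ((hylim.const_mul σ).add hε)
    fun n => hxy (k n) t ht
  simpa using this

lemma value_minimaxSuper (D : Data T d f lam ell h Cf Clam Lf) [Nonempty A]
    (hΦ : IsFlow T d f Φ) (hT : 0 ≤ T) :
    MinimaxSuper T d (Hctrl d f lam ell) h Cf (value T d A lam ell h Φ) := by
  have hv := D.value_cont2 hΦ
  refine ⟨hv.lscOn, fun x hx => (D.value_terminal hΦ hT hx).ge, fun s hs' x₀ hx₀ z y₀ hy₀ => ?_⟩
  have hs : s ∈ Icc 0 T := ⟨hs'.1, hs'.2.le⟩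
  have := D.exists_mem_ySet_of_approx (z := z) (y₀ := y₀) hs hx₀ hv 1 fun ε hε => ?_
  · simpa using this
  have hε' : 0 < ε * Real.exp (-(Clam * T)) := by positivity
  obtain ⟨α, hα, hlt⟩ := exists_cost_lt (lt_of_le_of_lt hy₀ (lt_add_of_pos_right y₀ hε'))
  have hφ := hΦ s hs x₀ hx₀ α hα
  have hX := D.flow_mem_xSet hΦ hs hx₀ hα
  obtain ⟨y, hy⟩ := D.exists_isYSol hs hX y₀ z
  refine ⟨_, hX, y, hy, fun t ht => ?_⟩
  obtain ⟨-, h2⟩ := D.traj_disc_mul_add_runCost_sub hs hx₀ hα hφ hy ht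
  have h3 : 0 ≤ disc lam s (Φ s x₀ α) α t * y t + runCost lam ell s (Φ s x₀ α) α t - y₀ := by
    rw [h2]
    refine intervalIntegral.integral_nonneg_of_ae_restrict ht.1 ?_
    rw [← restrict_Ioc_eq_restrict_Icc]
    refine (ae_restrict_iff' measurableSet_Ioc).2 ?_
    filter_upwards [D.ae_good_Ioc hs.1 ht.2] with r G hr
    exact mul_nonneg disc_pos.le (sub_nonneg.2 ((G hr).hctrl_le hX.1 (α r)))
  have h4 := D.add_value_le hΦ hs hx₀ hα ht.1 ht.2
  have h5 := D.le_disc (α := α) hX.1 hs.1 ht.1 ht.2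
  have h6 : (0 : ℝ) < disc lam s (Φ s x₀ α) α t := disc_pos
  rw [one_mul, one_mul]
  refine le_of_mul_le_mul_left ?_ h6
  have h7 := mul_le_mul_of_nonneg_left h5 hε.le
  linarith

end Data

end ValueMinimax

/-- Controls obtained by applying a feedback map with a short delay. -/
lemma exists_delayed_feedback {A : Type*} [MeasurableSpace A] [Nonempty A]
    (B : (ℝ → A) → ℝ → A) (hB : ∀ α, Measurable α → Measurable (B α)) (s T : ℝ) {δ : ℝ}
    (hδ : 0 < δ) :
    ∃ (α : ℝ → A) (a : ℕ → ℝ → A), Measurable α ∧ (∀ i, Measurable (a i)) ∧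
      ∀ r ∈ Icc s T, ∃ i τ, s ≤ τ ∧ τ ≤ r ∧ r ≤ τ + δ ∧ (∀ q < τ, α q = a i q) ∧
        α r = B (a i) r := by
  classical
  obtain ⟨a₀⟩ := ‹Nonempty A›
  let a : ℕ → ℝ → A := fun n => Nat.rec (fun _ => a₀)
    (fun i b r => if r < s + i * δ then b r else B b r) n
  have ha0 : a 0 = fun _ => a₀ := rfl
  have ha1 : ∀ i r, a (i + 1) r = if r < s + i * δ then a i r else B (a i) r := fun _ _ => rfl
  have hm : ∀ i, Measurable (a i) := by
    intro i
    induction i with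
    | zero => exact measurable_const
    | succ i ih => exact Measurable.ite measurableSet_Iio ih (hB _ ih)
  have hag : ∀ i j : ℕ, i ≤ j → ∀ q < s + i * δ, a j q = a i q := by
    intro i j hij
    induction j, hij using Nat.le_induction with
    | base => exact fun q _ => rfl
    | succ j hij ih =>
      intro q hq
      have : (i : ℝ) * δ ≤ j * δ := by gcongr
      rw [ha1, if_pos (by linarith), ih q hq]
  obtain ⟨N, hN⟩ := exists_nat_gt ((T - s) / δ)
  refine ⟨a N, a, hm N, hm, fun r hr => ?_⟩
  have h0 : 0 ≤ (r - s) / δ := div_nonneg (sub_nonneg.2 hr.1) hδ.le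
  have h1 := Nat.floor_le h0
  have h2 := Nat.lt_floor_add_one ((r - s) / δ)
  set i := ⌊(r - s) / δ⌋₊
  rw [le_div_iff₀ hδ] at h1
  have h3 : i < N := by
    rw [Nat.floor_lt h0]
    refine lt_of_le_of_lt ?_ hN
    gcongr
    exact hr.2
  rw [div_lt_iff₀ hδ] at h2
  have hi : (0 : ℝ) ≤ i * δ := by positivity
  refine ⟨i, s + i * δ, by linarith, by linarith, by linarith, hag i N h3.le, ?_⟩
  rw [hag (i + 1) N h3 r (by push_cast; linarith), ha1, if_neg (by linarith)]

section ValueSubsolution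

set_option linter.unusedSectionVars false

variable {T : ℝ} {d : ℕ} {A : Type*} [TopologicalSpace A]
  {f : ℝ → Path d → A → E d} {lam ell : ℝ → Path d → A → ℝ} {h : Path d → ℝ} {Cf Clam Lf : ℝ}
  [MeasurableSpace A] [BorelSpace A]
  {x x' x₀ φ : Path d} {y y' : ℝ → ℝ} {y₀ : ℝ} {z : E d} {α β : ℝ → A} {s t t' : ℝ}
  {Φ : ℝ → Path d → (ℝ → A) → Path d}

namespace Data

/-- Trajectories for controls which agree up to a time `τ` stay close shortly after `τ`. -/
lemma flow_sub_le_of_agree (D : Data T d f lam ell h Cf Clam Lf) (hΦ : IsFlow T d f Φ)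
    (hs : s ∈ Icc 0 T) (hx₀ : x₀ ∈ Cadlag T d) (hα : Measurable α) (hβ : Measurable β)
    {B τ δ r : ℝ} (hB : ∀ x ∈ XSet T d Cf s x₀, 1 + runSup d x T ≤ B) (hsτ : s ≤ τ) (hτr : τ ≤ r)
    (hr : r ≤ τ + δ) (hrT : r ≤ T) (he : ∀ q < τ, α q = β q) :
    ∀ q ∈ Icc 0 r, ‖Φ s x₀ α q - Φ s x₀ β q‖ ≤ 2 * (Cf * B) * δ := by
  have hf := D.bound.1
  have hXα := D.flow_mem_xSet hΦ hs hx₀ hα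
  have hXβ := D.flow_mem_xSet hΦ hs hx₀ hβ
  have hB0 : 0 ≤ B := by linarith [runSup_nonneg (Φ s x₀ α) T, hB _ hXα]
  have hδ : 0 ≤ δ := by linarith
  have hag := D.traj_congr_ctrl hs hx₀ hα (hΦ s hs x₀ hx₀ α hα) (hΦ s hs x₀ hx₀ β hβ)
    (hτr.trans hrT) fun q hq => he q hq.2
  intro q hq
  rcases le_total q τ with hqτ | hqτ
  · rw [hag q ⟨hq.1, hqτ⟩, sub_self, norm_zero]
    positivity
  · have hm : ∀ x ∈ XSet T d Cf s x₀, ‖x q - x τ‖ ≤ Cf * B * δ := by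
      intro x hx
      obtain ⟨hc, -, hlip⟩ := (mem_XSet_iff hf hs.2).1 hx
      refine (hlip.norm_sub_le hf hc (hB x hx) ⟨hsτ, hτr.trans hrT⟩
        ⟨hsτ.trans hqτ, hq.2.trans hrT⟩).trans ?_
      rw [abs_of_nonneg (sub_nonneg.2 hqτ)]
      gcongr
      linarith [hq.2]
    have h1 := hm _ hXα
    have h2 := hm _ hXβ
    have h3 := hag τ ⟨hs.1.trans hsτ, le_rfl⟩
    rw [← h3] at h2
    have h4 : Φ s x₀ α q - Φ s x₀ β q =
        (Φ s x₀ α q - Φ s x₀ α τ) - (Φ s x₀ β q - Φ s x₀ α τ) := by abel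
    rw [h4]
    exact (norm_sub_le _ _).trans (by linarith)

/-- Almost optimal controls along the own trajectory, obtained from delayed feedback. -/
lemma exists_almost_feedback (D : Data T d f lam ell h Cf Clam Lf) [Nonempty A]
    (hΦ : IsFlow T d f Φ) (hs : s ∈ Icc 0 T) (hx₀ : x₀ ∈ Cadlag T d) (y₀ : ℝ) (z : E d) {ε : ℝ}
    (hε : 0 < ε) :
    ∃ α : ℝ → A, Measurable α ∧ ∃ y, IsYSol T d f lam ell s (Φ s x₀ α) y₀ z y ∧
      ∀ᵐ r, r ∈ Ioc s T → ell r (Φ s x₀ α) (α r) + ⟪f r (Φ s x₀ α) (α r), z⟫_ℝ -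
        lam r (Φ s x₀ α) (α r) * y r - Hctrl d f lam ell r (Φ s x₀ α) (y r) z ≤ ε := by
  classical
  have hf := D.bound.1
  have hCl := D.bound.2.1
  have hL := D.lip.1
  obtain ⟨R, hR0, hR⟩ := Cadlag.exists_bound hx₀
  set B := 2 * (1 + R) * Real.exp (2 * Cf * T)
  have hB : ∀ x ∈ XSet T d Cf s x₀, 1 + runSup d x T ≤ B := fun x hx =>
    XSet.runSup_le hf hs hR0 (fun t ht => hR t ⟨ht.1, ht.2.trans hs.2⟩) hx
  obtain ⟨Y, K, hY0, hK0, hYK⟩ := D.isYSol_bounds hs hx₀ y₀ z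
  have hX : ∀ α : ℝ → A, Measurable α → Φ s x₀ α ∈ XSet T d Cf s x₀ := fun α hα =>
    D.flow_mem_xSet hΦ hs hx₀ hα
  have hex : ∀ α : ℝ → A, ∃ y : ℝ → ℝ, ∃ β : ℝ → A, Measurable α →
      IsYSol T d f lam ell s (Φ s x₀ α) y₀ z y ∧ Measurable β ∧ ∀ᵐ t, t ∈ Ioc 0 T →
        ell t (Φ s x₀ α) (β t) + ⟪f t (Φ s x₀ α) (β t), z⟫_ℝ - lam t (Φ s x₀ α) (β t) * y t ≤
          Hctrl d f lam ell t (Φ s x₀ α) (y t) z + ε / 2 := by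
    intro α
    by_cases hα : Measurable α
    · obtain ⟨y, hy⟩ := D.exists_isYSol hs (hX α hα) y₀ z
      obtain ⟨β, hβ, h⟩ := D.exists_near_optimal (hX α hα).1 hy.1.measurable z (half_pos hε)
      exact ⟨y, β, fun _ => ⟨hy, hβ, h⟩⟩
    · exact ⟨0, α, fun h => absurd h hα⟩
  choose y b hyb using hex
  set C := 2 * (Lf * (1 + ‖z‖ + Y) + Clam * K) * (2 * (Cf * B))
  have hC0 : 0 ≤ C := by positivity
  set δ := ε / (2 * (C + 1))
  have hδ : 0 < δ := by positivity
  have hCδ : C * δ ≤ ε / 2 := by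
    have : (C + 1) * δ = ε / 2 := by simp only [δ]; field_simp
    nlinarith
  obtain ⟨α, a, hα, ha, H⟩ := exists_delayed_feedback b (fun α hα => (hyb α hα).2.1) s T hδ
  refine ⟨α, hα, y α, (hyb α hα).1, ?_⟩
  have hall : ∀ᵐ t, ∀ i, t ∈ Ioc 0 T →
        ell t (Φ s x₀ (a i)) (b (a i) t) + ⟪f t (Φ s x₀ (a i)) (b (a i) t), z⟫_ℝ -
          lam t (Φ s x₀ (a i)) (b (a i) t) * y (a i) t ≤
          Hctrl d f lam ell t (Φ s x₀ (a i)) (y (a i) t) z + ε / 2 :=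
    ae_all_iff.2 fun i => (hyb _ (ha i)).2.2
  filter_upwards [hall, D.ae_good_Ioc hs.1 le_rfl] with r hr G hrs
  obtain ⟨i, τ, hsτ, hτr, hrτ, he, hb⟩ := H r ⟨hrs.1.le, hrs.2⟩
  have G := G hrs
  have hr0 := hr i ⟨hs.1.trans_lt hrs.1, hrs.2⟩
  rw [← hb] at hr0
  have hd := D.flow_sub_le_of_agree hΦ hs hx₀ hα (ha i) hB hsτ hτr hrτ hrs.2 he
  have hφ := hX α hα
  have hφ' := hX (a i) (ha i)
  have hB0 : 0 ≤ B := by positivity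
  have hy1 := (hYK _ hφ _ (hyb α hα).1).1 r ⟨hrs.1.le, hrs.2⟩
  have hy2 := (hYK _ hφ' _ (hyb _ (ha i)).1).1 r ⟨hrs.1.le, hrs.2⟩
  have hyd := (hYK _ hφ _ (hyb α hα).1).2 _ hφ' _ (hyb _ (ha i)).1 r ⟨hrs.1.le, hrs.2⟩
    (2 * (Cf * B) * δ) (by positivity) hd r ⟨hrs.1.le, le_rfl⟩
  have hxd : runSup d (Φ s x₀ α - Φ s x₀ (a i)) r ≤ 2 * (Cf * B) * δ :=
    runSup_le (by positivity) hd
  have h1 := G.abs_sub_le (z := z) (y := y α r) (y' := y (a i) r) hφ.1 hφ'.1 (α r)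
  have h2 := G.abs_hctrl_sub_le (z := z) hL hφ.1 hφ'.1 hy1 hy2
  have h3 : Lf * (1 + ‖z‖ + |y α r|) * runSup d (Φ s x₀ α - Φ s x₀ (a i)) r ≤
      Lf * (1 + ‖z‖ + Y) * (2 * (Cf * B) * δ) := by
    have := runSup_nonneg (Φ s x₀ α - Φ s x₀ (a i)) r
    gcongr
  have h4 : Lf * (1 + ‖z‖ + Y) * runSup d (Φ s x₀ α - Φ s x₀ (a i)) r ≤
      Lf * (1 + ‖z‖ + Y) * (2 * (Cf * B) * δ) := by gcongr
  have h5 : Clam * |y α r - y (a i) r| ≤ Clam * (K * (2 * (Cf * B) * δ)) := by gcongr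
  have h6 : C * δ = 2 * (Lf * (1 + ‖z‖ + Y) * (2 * (Cf * B) * δ) +
      Clam * (K * (2 * (Cf * B) * δ))) := by simp only [C]; ring
  have h7 := (abs_le.1 h1).2
  have h8 := (abs_le.1 h2).1
  linarith

lemma value_minimaxSub (D : Data T d f lam ell h Cf Clam Lf) [Nonempty A]
    (hΦ : IsFlow T d f Φ) (hT : 0 ≤ T) :
    MinimaxSub T d (Hctrl d f lam ell) h Cf (value T d A lam ell h Φ) := by
  have hv := D.value_cont2 hΦ
  refine ⟨hv.uscOn, fun x hx => (D.value_terminal hΦ hT hx).le, fun s hs' x₀ hx₀ z y₀ hy₀ => ?_⟩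
  have hs : s ∈ Icc 0 T := ⟨hs'.1, hs'.2.le⟩
  have := D.exists_mem_ySet_of_approx (z := z) (y₀ := y₀) hs hx₀ hv (-1) fun ε hε => ?_
  · simpa using this
  set ε' := ε * Real.exp (-(Clam * T)) / (T + 1)
  have hε' : 0 < ε' := by positivity
  obtain ⟨α, hα, y, hy, hopt⟩ := D.exists_almost_feedback hΦ hs hx₀ y₀ z hε'
  have hφ := hΦ s hs x₀ hx₀ α hα
  have hX := D.flow_mem_xSet hΦ hs hx₀ hα
  refine ⟨_, hX, y, hy, fun t ht => ?_⟩
  obtain ⟨h1, h2⟩ := D.traj_disc_mul_add_runCost_sub hs hx₀ hα hφ hy ht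
  have h3 : disc lam s (Φ s x₀ α) α t * y t + runCost lam ell s (Φ s x₀ α) α t - y₀ ≤
      ∫ _ in s..t, ε' := by
    rw [h2]
    refine intervalIntegral.integral_mono_ae_restrict ht.1 h1 intervalIntegrable_const ?_
    rw [← restrict_Ioc_eq_restrict_Icc]
    refine (ae_restrict_iff' measurableSet_Ioc).2 ?_
    filter_upwards [hopt] with r hr hr'
    have e1 := hr ⟨hr'.1, hr'.2.trans ht.2⟩
    have e2 := D.disc_le_one (α := α) hX.1 hs.1 hr'.1.le (hr'.2.trans ht.2)
    have e3 : (0 : ℝ) < disc lam s (Φ s x₀ α) α r := disc_pos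
    nlinarith
  rw [intervalIntegral.integral_const, smul_eq_mul] at h3
  have h4 := D.value_le_add hΦ hs hx₀ hα ht.1 ht.2
  have h5 := D.le_disc (α := α) hX.1 hs.1 ht.1 ht.2
  have h6 : (0 : ℝ) < disc lam s (Φ s x₀ α) α t := disc_pos
  have h8 : (t - s) * ε' ≤ ε * Real.exp (-(Clam * T)) := by
    have : (T + 1) * ε' = ε * Real.exp (-(Clam * T)) := by simp only [ε']; field_simp
    nlinarith [hs.1, ht.2]
  refine le_of_mul_le_mul_left ?_ h6
  have h7 := mul_le_mul_of_nonneg_left h5 hε.le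
  linarith

end Data

end ValueSubsolution

section Steps

set_option linter.unusedSectionVars false

variable {T : ℝ} {d : ℕ} {A : Type*} [TopologicalSpace A]
  {f : ℝ → Path d → A → E d} {lam ell : ℝ → Path d → A → ℝ} {h : Path d → ℝ} {Cf Clam Lf : ℝ}
  [MeasurableSpace A] [BorelSpace A]
  {x x₀ : Path d} {y : ℝ → ℝ} {y₀ : ℝ} {z : E d} {α β : ℝ → A} {s t t' : ℝ}
  {Φ : ℝ → Path d → (ℝ → A) → Path d} {u : ℝ → Path d → ℝ} {B : ℝ}

/-- A one-sided bound `σ y ≤ σ u` can be propagated from `t` to `t'` along some path, with a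
control in `𝓑`, up to a small error; `p` is the direction in which the path is steered. -/
def HasStep (T : ℝ) (d : ℕ) (f : ℝ → Path d → A → E d) (lam ell : ℝ → Path d → A → ℝ)
    (Cf : ℝ) (u : ℝ → Path d → ℝ) (σ s : ℝ) (x₀ : Path d) (𝓑 : Set (ℝ → A)) (C : ℝ) : Prop :=
  ∀ t t', s ≤ t → t < t' → t' ≤ T → ∀ x ∈ XSet T d Cf s x₀, ∀ y : ℝ, σ * y ≤ σ * u t x →
    ∀ β ∈ 𝓑, ∀ p : E d, ∀ e > 0, ∃ x' ∈ XSet T d Cf s x₀, ∃ y' : ℝ, ∃ β' ∈ 𝓑,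
      (∀ r ∈ Icc 0 t, x' r = x r) ∧ (∀ r < t, β' r = β r) ∧ σ * y' ≤ σ * u t' x' ∧
      ⟪p, x' t' - x' t - ∫ r in t..t', f r x' (β' r)⟫_ℝ -
          (C * ‖p‖ * (t' - t) ^ 2 + e * (t' - t)) ≤
        σ * (disc lam t x' β' t' * y' + runCost lam ell t x' β' t' - y)

namespace Data

lemma le_disc_mul_add_runCost_sub (D : Data T d f lam ell h Cf Clam Lf) {g : Path d}
    (hx : x ∈ Cadlag T d) (hβ : Measurable β) (ht : 0 ≤ t) (htt : t ≤ t') (ht' : t' ≤ T)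
    (hg : XDeriv T d Cf t x g)
    (hq : IntegrableOn (fun r => ⟪g r, z⟫_ℝ - Hctrl d f lam ell r x (y r) z) (Icc t T) volume)
    (hy : ∀ r ∈ Icc t T, y r = y₀ + ∫ q in t..r, (⟪g q, z⟫_ℝ - Hctrl d f lam ell q x (y q) z))
    {σ e : ℝ} {p : E d} (hσ : σ * σ = 1) (hz : z = σ • p) (he : 0 ≤ e)
    (hB : 1 + runSup d x T ≤ B)
    (hopt : ∀ᵐ r, r ∈ Ioc t t' → -e ≤ σ * (ell r x (β r) + ⟪f r x (β r), z⟫_ℝ -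
      lam r x (β r) * y r - Hctrl d f lam ell r x (y r) z)) :
    ⟪p, x t' - x t - ∫ r in t..t', f r x (β r)⟫_ℝ -
        (Clam * (2 * (Cf * B)) * ‖p‖ * (t' - t) ^ 2 + e * (t' - t)) ≤
      σ * (disc lam t x β t' * y t' + runCost lam ell t x β t' - y₀) := by
  have hf := D.bound.1
  have hCl := D.bound.2.1
  have hB0 : 0 ≤ B := by linarith [runSup_nonneg x T]
  have hqi : IntervalIntegrable (fun r => ⟪g r, z⟫_ℝ - Hctrl d f lam ell r x (y r) z)
      volume t t' := by
    rw [intervalIntegrable_iff_integrableOn_Icc_of_le htt]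
    exact hq.mono_set (Icc_subset_Icc_right ht')
  obtain ⟨h1, h2⟩ := D.disc_mul_add_runCost_sub hx hβ ht htt ht' hqi
    fun r hr => hy r ⟨hr.1, hr.2.trans ht'⟩
  have hgi := XDeriv.intervalIntegrable hg le_rfl htt ht'
  have hfi := D.intervalIntegrable_f hx hβ ht htt ht'
  set c := Clam * (2 * (Cf * B)) * ‖p‖ * (t' - t) + e
  have hI : IntervalIntegrable (fun r => ⟪g r - f r x (β r), p⟫_ℝ - c) volume t t' :=
    (intervalIntegrable_inner_const (hgi.sub hfi) p).sub intervalIntegrable_const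
  have h3 : ⟪p, x t' - x t - ∫ r in t..t', f r x (β r)⟫_ℝ -
        (Clam * (2 * (Cf * B)) * ‖p‖ * (t' - t) ^ 2 + e * (t' - t)) =
      ∫ r in t..t', (⟪g r - f r x (β r), p⟫_ℝ - c) := by
    rw [intervalIntegral.integral_sub (intervalIntegrable_inner_const (hgi.sub hfi) p)
      intervalIntegrable_const, integral_inner_const (hgi.sub hfi),
      intervalIntegral.integral_sub hgi hfi, ← XDeriv.sub_eq hg le_rfl htt ht',
      intervalIntegral.integral_const, smul_eq_mul, real_inner_comm]
    simp only [c]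
    ring
  rw [h2, h3, ← intervalIntegral.integral_const_mul]
  refine intervalIntegral.integral_mono_ae_restrict htt hI (h1.const_mul σ) ?_
  rw [← restrict_Ioc_eq_restrict_Icc]
  refine (ae_restrict_iff' measurableSet_Ioc).2 ?_
  filter_upwards [hopt, D.ae_good_Ioc ht ht', XDeriv.ae_bound hg] with r hr G hgr hrt
  have hr := hr hrt
  have G := G hrt
  have hgr := hgr ⟨hrt.1, hrt.2.trans ht'⟩
  have hrT := hrt.2.trans ht'
  have hrB : 1 + runSup d x r ≤ B := by
    linarith [Cadlag.runSup_mono hx hrT le_rfl]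
  have e1 := D.disc_le_one (α := β) hx ht hrt.1.le hrT
  have e2 := D.one_sub_disc_le (α := β) hx ht hrt.1.le hrT
  have e3 : (0 : ℝ) < disc lam t x β r := disc_pos
  set χ := disc lam t x β r
  have e4 : ‖g r - f r x (β r)‖ ≤ 2 * (Cf * B) := by
    have i1 : Cf * (1 + runSup d x r) ≤ Cf * B := by gcongr
    have i2 := G.f_le x hx (β r)
    exact (norm_sub_le _ _).trans (by linarith)
  have e5 : |⟪g r - f r x (β r), p⟫_ℝ| ≤ 2 * (Cf * B) * ‖p‖ :=
    (abs_real_inner_le_norm _ _).trans (by gcongr)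
  have e6 : σ * (χ * (⟪g r, z⟫_ℝ - Hctrl d f lam ell r x (y r) z + ell r x (β r) -
      lam r x (β r) * y r)) = χ * ⟪g r - f r x (β r), p⟫_ℝ +
        χ * (σ * (ell r x (β r) + ⟪f r x (β r), z⟫_ℝ -
          lam r x (β r) * y r - Hctrl d f lam ell r x (y r) z)) := by
    have i1 : ⟪g r - f r x (β r), p⟫_ℝ = σ * (⟪g r, z⟫_ℝ - ⟪f r x (β r), z⟫_ℝ) := by
      rw [hz, inner_smul_right, inner_smul_right, inner_sub_left]
      linear_combination (-⟪g r, p⟫_ℝ + ⟪f r x (β r), p⟫_ℝ) * hσ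
    rw [i1]
    ring
  rw [e6]
  have e7 : -e ≤ χ * (σ * (ell r x (β r) + ⟪f r x (β r), z⟫_ℝ -
      lam r x (β r) * y r - Hctrl d f lam ell r x (y r) z)) := by
    nlinarith [mul_le_mul_of_nonneg_left hr e3.le]
  have e8 : (1 - χ) * |⟪g r - f r x (β r), p⟫_ℝ| ≤
      Clam * (t' - t) * (2 * (Cf * B) * ‖p‖) := by
    have i1 : 1 - χ ≤ Clam * (t' - t) := e2.trans (by gcongr; exact hrt.2)
    have i2 : 0 ≤ Clam * (t' - t) := mul_nonneg hCl (sub_nonneg.2 htt)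
    gcongr
  have e9 : (1 - χ) * ⟪g r - f r x (β r), p⟫_ℝ ≤ (1 - χ) * |⟪g r - f r x (β r), p⟫_ℝ| :=
    mul_le_mul_of_nonneg_left (le_abs_self _) (by linarith)
  have e10 : c = Clam * (t' - t) * (2 * (Cf * B) * ‖p‖) + e := by simp only [c]; ring
  linarith

lemma hasStep_sub (D : Data T d f lam ell h Cf Clam Lf) (hs : 0 ≤ s)
    (hu : MinimaxSub T d (Hctrl d f lam ell) h Cf u)
    (hB : ∀ x ∈ XSet T d Cf s x₀, 1 + runSup d x T ≤ B) (hα : Measurable α) :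
    HasStep T d f lam ell Cf u 1 s x₀ {α} (Clam * (2 * (Cf * B))) := by
  intro t t' hst htt ht' x hx y hy β hβ p e he
  have ht0 := hs.trans hst
  obtain ⟨⟨x', y'⟩, ⟨hc, hag, hyc, g, hg, hq, hy'⟩, hle⟩ := hu.2.2 t ⟨ht0, htt.trans_le ht'⟩ x hx.1
    p y (by simpa using hy)
  have hX := XSet.trans D.bound.1 hst (htt.le.trans ht') hs hx ⟨hc, hag, g, hg⟩
  refine ⟨x', hX, y' t', β, hβ, hag, fun _ _ => rfl, by simpa using hle t' ⟨htt.le, ht'⟩, ?_⟩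
  rw [mem_singleton_iff] at hβ
  subst hβ
  refine D.le_disc_mul_add_runCost_sub hc hα ht0 htt.le ht' hg hq hy' (one_mul 1)
    (one_smul ℝ p).symm he.le (hB _ hX) ?_
  filter_upwards [D.ae_good_Ioc ht0 ht'] with r G hr
  have := (G hr).hctrl_le (y := y' r) (z := p) hc (β r)
  linarith

lemma hasStep_super (D : Data T d f lam ell h Cf Clam Lf) [Nonempty A] (hs : 0 ≤ s)
    (hu : MinimaxSuper T d (Hctrl d f lam ell) h Cf u)
    (hB : ∀ x ∈ XSet T d Cf s x₀, 1 + runSup d x T ≤ B) :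
    HasStep T d f lam ell Cf u (-1) s x₀ {β | Measurable β} (Clam * (2 * (Cf * B))) := by
  classical
  intro t t' hst htt ht' x hx y hy β hβ p e he
  have ht0 := hs.trans hst
  have htT := htt.le.trans ht'
  obtain ⟨⟨x', y'⟩, ⟨hc, hag, hyc, g, hg, hq, hy'⟩, hle⟩ := hu.2.2 t ⟨ht0, htt.trans_le ht'⟩ x hx.1
    (-p) y (by simpa using hy)
  have hX := XSet.trans D.bound.1 hst (htt.le.trans ht') hs hx ⟨hc, hag, g, hg⟩
  have hext : Continuous (IccExtend htT ((Icc t T).domRestrict y')) :=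
    (continuousOn_iff_continuous_domRestrict.1 hyc).Icc_extend'
  obtain ⟨γ, hγ, hopt⟩ := D.exists_near_optimal hc hext.measurable (-p) he
  set β' : ℝ → A := fun r => if r < t then β r else γ r
  have hβ' : Measurable β' := Measurable.ite measurableSet_Iio hβ hγ
  refine ⟨x', hX, y' t', β', hβ', hag, fun r hr => if_pos hr,
    by simpa using hle t' ⟨htt.le, ht'⟩, ?_⟩
  refine D.le_disc_mul_add_runCost_sub hc hβ' ht0 htt.le ht' hg hq hy' (by norm_num)
    (neg_one_smul ℝ p).symm he.le (hB _ hX) ?_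
  filter_upwards [hopt] with r hr hrt
  have hrT : r ∈ Icc t T := ⟨hrt.1.le, hrt.2.trans ht'⟩
  have h1 := hr ⟨ht0.trans_lt hrt.1, hrT.2⟩
  rw [IccExtend_of_mem _ _ hrT, domRestrict_apply] at h1
  have h2 : β' r = γ r := if_neg (not_lt.2 hrt.1.le)
  rw [h2]
  linarith

end Data

end Steps

/-- A smooth substitute for the squared running maximum: increments of
`c ^ 2 + ‖w‖ ^ 4 / c ^ 2`, where `c` is the running maximum, are controlled by a linear term in the
increment of `w`. -/
lemma running_max_increment_le {V : Type*} [NormedAddCommGroup V] [InnerProductSpace ℝ V]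
    {w v : V} {c K : ℝ} (hc : 0 < c) (hw : ‖w‖ ≤ c) (hv : ‖v‖ ≤ K * c) :
    max c ‖w + v‖ ^ 2 + ‖w + v‖ ^ 4 / max c ‖w + v‖ ^ 2 ≤
      c ^ 2 + ‖w‖ ^ 4 / c ^ 2 + 4 * ‖w‖ ^ 2 * ⟪w, v⟫_ℝ / c ^ 2 +
        (2 + (2 + K) ^ 2) * ‖v‖ ^ 2 := by
  have hn := norm_add_sq_real w v
  have hin := abs_real_inner_le_norm w v
  have hw0 := norm_nonneg w
  have hv0 := norm_nonneg v
  have hc2 : 0 < c ^ 2 := by positivity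
  set a := ‖w‖
  set b := ‖v‖
  set m := ‖w + v‖
  set i := ⟪w, v⟫_ℝ
  have h1 : max c m ^ 2 + m ^ 4 / max c m ^ 2 ≤ c ^ 2 + m ^ 4 / c ^ 2 := by
    rcases le_total m c with h | h
    · rw [max_eq_left h]
    · rw [max_eq_right h]
      have hm : 0 < m := hc.trans_le h
      have e1 : m ^ 4 / m ^ 2 = m ^ 2 := by field_simp
      rw [e1, ← sub_nonneg]
      have e2 : c ^ 2 + m ^ 4 / c ^ 2 - (m ^ 2 + m ^ 2) = (m ^ 2 - c ^ 2) ^ 2 / c ^ 2 := by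
        field_simp
        ring
      rw [e2]
      positivity
  refine h1.trans ?_
  have h2 : |2 * i + b ^ 2| ≤ (2 + K) * c * b := by
    have := abs_le.1 hin
    refine abs_le.2 ⟨?_, ?_⟩ <;> nlinarith
  have h3 : (2 * i + b ^ 2) ^ 2 ≤ (2 + K) ^ 2 * b ^ 2 * c ^ 2 := by
    rw [← sq_abs]
    calc _ ≤ ((2 + K) * c * b) ^ 2 := by gcongr
      _ = _ := by ring
  have h4 : m ^ 4 ≤ a ^ 4 + 4 * a ^ 2 * i + (2 + (2 + K) ^ 2) * b ^ 2 * c ^ 2 := by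
    have e1 : m ^ 4 = (a ^ 2 + 2 * i + b ^ 2) ^ 2 := by rw [← hn]; ring
    have e2 : a ^ 2 * b ^ 2 ≤ c ^ 2 * b ^ 2 := by gcongr
    rw [e1]
    nlinarith
  have h5 : m ^ 4 / c ^ 2 ≤
      (a ^ 4 + 4 * a ^ 2 * i + (2 + (2 + K) ^ 2) * b ^ 2 * c ^ 2) / c ^ 2 := by gcongr
  have h6 : (a ^ 4 + 4 * a ^ 2 * i + (2 + (2 + K) ^ 2) * b ^ 2 * c ^ 2) / c ^ 2 =
      a ^ 4 / c ^ 2 + 4 * a ^ 2 * i / c ^ 2 + (2 + (2 + K) ^ 2) * b ^ 2 := by field_simp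
  linarith

lemma exp_neg_two_mul_le {r : ℝ} (h0 : 0 ≤ r) (h1 : r ≤ 1 / 2) :
    Real.exp (-(2 * r)) ≤ 1 - r := by
  rw [Real.exp_neg, inv_le_comm₀ (Real.exp_pos _) (by linarith)]
  have h2 := Real.add_one_le_exp (2 * r)
  refine le_trans ?_ h2
  rw [inv_le_iff_one_le_mul₀ (by linarith)]
  nlinarith

/-- The scalar estimate behind one step of the comparison argument. -/
lemma gain_step {G S χ χ' θ θ' F F' c₂ ε K₀ C₂ C₃ e k κ b : ℝ} (hε : 0 < ε) (hχ : 0 ≤ χ)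
    (hχ1 : χ ≤ 1) (hχχ : χ' ≤ χ) (hθ : 0 < θ) (hθ1 : θ ≤ 1) (hθ' : 0 ≤ θ')
    (hθθ : θ' ≤ θ * (1 - K₀ * k)) (hF' : 0 ≤ F') (hc : c₂ ≤ F') (hK : 0 ≤ K₀ * k) (hk : 0 ≤ k)
    (hC₂ : 0 ≤ C₂) (hC₃ : 0 ≤ C₃) (he : 0 ≤ e)
    (hG : b ≤ G - χ * θ * F / ε)
    (hS : θ / ε * (F' - F - C₂ * k ^ 2) - θ / ε * (K₀ * c₂ * k) -
      (C₃ * (θ / ε) * k ^ 2 + e * k) ≤ S)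
    (hκ : (C₂ + C₃) * k / ε + e ≤ κ) :
    b - k * κ ≤ G + χ * S - χ' * θ' * F' / ε := by
  have hθε : 0 ≤ θ / ε := by positivity
  have hθε1 : θ / ε ≤ 1 / ε := by gcongr
  have h1 : χ' * θ' * F' / ε ≤ χ * (θ / ε * (1 - K₀ * k) * F') := by
    have e1 : χ' * θ' ≤ χ * (θ * (1 - K₀ * k)) :=
      mul_le_mul hχχ hθθ hθ' hχ
    calc χ' * θ' * F' / ε ≤ χ * (θ * (1 - K₀ * k)) * F' / ε := by gcongr
      _ = _ := by field_simp
  have h2 : θ / ε * (K₀ * c₂ * k) ≤ θ / ε * (K₀ * k * F') := by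
    refine mul_le_mul_of_nonneg_left ?_ hθε
    nlinarith
  have h3 : θ / ε * ((C₂ + C₃) * k ^ 2) + e * k ≤ k * κ := by
    calc θ / ε * ((C₂ + C₃) * k ^ 2) + e * k ≤ 1 / ε * ((C₂ + C₃) * k ^ 2) + e * k := by gcongr
      _ = k * ((C₂ + C₃) * k / ε + e) := by field_simp
      _ ≤ k * κ := by gcongr
  have h4 : 0 ≤ θ / ε * ((C₂ + C₃) * k ^ 2) + e * k := by positivity
  have h5 : θ / ε * (1 - K₀ * k) * F' - θ / ε * F - (θ / ε * ((C₂ + C₃) * k ^ 2) + e * k) ≤ S := by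
    linarith
  have h6 := mul_le_mul_of_nonneg_left h5 hχ
  have h7 : χ * (θ / ε * ((C₂ + C₃) * k ^ 2) + e * k) ≤
      θ / ε * ((C₂ + C₃) * k ^ 2) + e * k := by nlinarith
  have h8 : χ * θ * F / ε = χ * (θ / ε * F) := by field_simp
  rw [h8] at hG
  nlinarith

section Doubling

set_option linter.unusedSectionVars false

variable {T : ℝ} {d : ℕ} {A : Type*} [TopologicalSpace A]
  {f : ℝ → Path d → A → E d} {lam ell : ℝ → Path d → A → ℝ} {h : Path d → ℝ} {Cf Clam Lf : ℝ}
  [MeasurableSpace A] [BorelSpace A]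
  {x x₀ φ : Path d} {y y₀ : ℝ} {β : ℝ → A} {𝓑 : Set (ℝ → A)} {s t t' : ℝ}
  {Φ : ℝ → Path d → (ℝ → A) → Path d} {u : ℝ → Path d → ℝ} {B C : ℝ}

lemma XSet.norm_increment_sub_le {L : ℝ} (hL : 0 ≤ L) (hst : s ≤ t) (htt : t ≤ t') (ht' : t' ≤ T)
    (hx : x ∈ XSet T d L s x₀) (hφ : φ ∈ XSet T d L s x₀) (hB : 1 + runSup d x T ≤ B)
    (hB' : 1 + runSup d φ T ≤ B) :
    ‖(x t' - x t) - (φ t' - φ t)‖ ≤ 2 * (L * B) * (t' - t) := by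
  have hsT : s ≤ T := hst.trans (htt.trans ht')
  obtain ⟨hc, -, hlip⟩ := (mem_XSet_iff hL hsT).1 hx
  obtain ⟨hc', -, hlip'⟩ := (mem_XSet_iff hL hsT).1 hφ
  have h1 := hlip.norm_sub_le hL hc hB ⟨hst, htt.trans ht'⟩ ⟨hst.trans htt, ht'⟩
  have h2 := hlip'.norm_sub_le hL hc' hB' ⟨hst, htt.trans ht'⟩ ⟨hst.trans htt, ht'⟩
  rw [abs_of_nonneg (sub_nonneg.2 htt)] at h1 h2
  linarith [norm_sub_le (x t' - x t) (φ t' - φ t)]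

lemma XSet.norm_sub_le_of_runSup {L : ℝ} (hx : x ∈ XSet T d L s x₀)
    (hφ : φ ∈ XSet T d L s x₀) (hB : 1 + runSup d x T ≤ B) (hB' : 1 + runSup d φ T ≤ B)
    (ht : t ∈ Icc 0 T) : ‖x t - φ t‖ ≤ 2 * B := by
  have h1 := Cadlag.le_runSup hx.1 ht le_rfl
  have h2 := Cadlag.le_runSup hφ.1 ht le_rfl
  linarith [norm_sub_le (x t) (φ t)]

lemma Data.norm_integral_f_sub_le (D : Data T d f lam ell h Cf Clam Lf) (hx : x ∈ Cadlag T d)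
    (hφ : φ ∈ Cadlag T d) (hβ : Measurable β) (ht : 0 ≤ t) (htt : t ≤ t') (ht' : t' ≤ T) {a : ℝ}
    (ha : ∀ r ∈ Icc 0 t', ‖φ r - x r‖ ≤ a) :
    ‖(∫ r in t..t', f r φ (β r)) - ∫ r in t..t', f r x (β r)‖ ≤ Lf * a * (t' - t) := by
  have hL := D.lip.1
  have ha0 : 0 ≤ a := (norm_nonneg _).trans (ha 0 ⟨le_rfl, ht.trans htt⟩)
  rw [← intervalIntegral.integral_sub (D.intervalIntegrable_f hφ hβ ht htt ht')
    (D.intervalIntegrable_f hx hβ ht htt ht')]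
  have := intervalIntegral.norm_integral_le_of_norm_le_const_ae (a := t) (b := t')
    (C := Lf * a) (f := fun r => f r φ (β r) - f r x (β r)) (by
      filter_upwards [D.ae_good_Ioc ht ht'] with r hr hr'
      rw [uIoc_of_le htt] at hr'
      refine ((hr hr').f_lip φ hφ x hx _).trans (mul_le_mul_of_nonneg_left ?_ hL)
      exact runSup_le ha0 fun q hq => ha q ⟨hq.1, hq.2.trans hr'.2⟩)
  rwa [abs_of_nonneg (sub_nonneg.2 htt)] at this

/-- A state `(x, y, β, c)` of the doubling scheme at time `t`: the path `x` stays close to the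
trajectory `φ` driven by the control `β`, where `c` is a running maximum of the distance between
them, and the gain `σ (cost - y₀)` is at least `b` plus a penalty for this distance. -/
structure IsTrack (T : ℝ) (d : ℕ) {A : Type*} (lam ell : ℝ → Path d → A → ℝ) (Cf : ℝ)
    (Φ : ℝ → Path d → (ℝ → A) → Path d) (𝓑 : Set (ℝ → A)) (u : ℝ → Path d → ℝ)
    (σ s : ℝ) (x₀ : Path d) (y₀ ε K M B b t : ℝ) (x : Path d) (y : ℝ) (β : ℝ → A) (c : ℝ) :
    Prop where
  mem : x ∈ XSet T d Cf s x₀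
  ctrl : β ∈ 𝓑
  le : σ * y ≤ σ * u t x
  eps_le : ε ≤ c
  le_max : c ≤ 1 + 2 * B
  near : ∀ r ∈ Icc 0 t, ‖x r - Φ s x₀ β r‖ ≤ M * c
  end_le : ‖x t - Φ s x₀ β t‖ ≤ c
  gain : b ≤ σ * (disc lam s x β t * y + runCost lam ell s x β t - y₀) -
    disc lam s x β t * Real.exp (-(2 * (K * (t - s)))) *
      (c ^ 2 + ‖x t - Φ s x₀ β t‖ ^ 4 / c ^ 2) / ε

lemma inner_penalty_lower_bound {V : Type*} [NormedAddCommGroup V] [InnerProductSpace ℝ V]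
    {w v R : V} {c κ ε θ M k q : ℝ} (hε : 0 < ε) (hc : 0 < c) (hθ : 0 ≤ θ) (hw : ‖w‖ ≤ c)
    (hκ : 0 ≤ κ) (hv : ‖v‖ ≤ κ * k) (hkc : k ≤ c) (hR : ‖R‖ ≤ M * c * k)
    (hq : q = max c ‖w + v‖) :
    ‖(4 * θ * ‖w‖ ^ 2 / (c ^ 2 * ε)) • w‖ ≤ θ / ε * (4 * c) ∧
    θ / ε * (q ^ 2 + ‖w + v‖ ^ 4 / q ^ 2 - (c ^ 2 + ‖w‖ ^ 4 / c ^ 2) -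
        (2 + (2 + κ) ^ 2) * κ ^ 2 * k ^ 2) - θ / ε * (4 * M * c ^ 2 * k) ≤
      ⟪(4 * θ * ‖w‖ ^ 2 / (c ^ 2 * ε)) • w, v + R⟫_ℝ := by
  have hp : ‖(4 * θ * ‖w‖ ^ 2 / (c ^ 2 * ε)) • w‖ ≤ θ / ε * (4 * c) := by
    rw [norm_smul, Real.norm_of_nonneg (by positivity)]
    calc 4 * θ * ‖w‖ ^ 2 / (c ^ 2 * ε) * ‖w‖ ≤ 4 * θ * c ^ 2 / (c ^ 2 * ε) * c := by gcongr
      _ = _ := by field_simp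
  refine ⟨hp, ?_⟩
  have h1 := running_max_increment_le hc hw (hv.trans (mul_le_mul_of_nonneg_left hkc hκ))
  rw [← hq] at h1
  have h2 : ‖v‖ ^ 2 ≤ κ ^ 2 * k ^ 2 := by
    rw [← mul_pow]
    gcongr
  have h3 : (2 + (2 + κ) ^ 2) * ‖v‖ ^ 2 ≤ (2 + (2 + κ) ^ 2) * (κ ^ 2 * k ^ 2) := by gcongr
  have h4 : θ / ε * (q ^ 2 + ‖w + v‖ ^ 4 / q ^ 2 - (c ^ 2 + ‖w‖ ^ 4 / c ^ 2) -
      (2 + (2 + κ) ^ 2) * κ ^ 2 * k ^ 2) ≤ θ / ε * (4 * ‖w‖ ^ 2 * ⟪w, v⟫_ℝ / c ^ 2) :=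
    mul_le_mul_of_nonneg_left (by linarith) (by positivity)
  have h5 : -(θ / ε * (4 * M * c ^ 2 * k)) ≤ ⟪(4 * θ * ‖w‖ ^ 2 / (c ^ 2 * ε)) • w, R⟫_ℝ := by
    have h6 := (abs_le.1 (abs_real_inner_le_norm ((4 * θ * ‖w‖ ^ 2 / (c ^ 2 * ε)) • w) R)).1
    have h7 := mul_le_mul hp hR (norm_nonneg _) (by positivity)
    have h8 : θ / ε * (4 * c) * (M * c * k) = θ / ε * (4 * M * c ^ 2 * k) := by ring
    linarith
  have h6 : ⟪(4 * θ * ‖w‖ ^ 2 / (c ^ 2 * ε)) • w, v⟫_ℝ =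
      θ / ε * (4 * ‖w‖ ^ 2 * ⟪w, v⟫_ℝ / c ^ 2) := by
    rw [real_inner_smul_left]
    field_simp
  rw [inner_add_right, h6]
  linarith

lemma IsTrack.exists_step (D : Data T d f lam ell h Cf Clam Lf) (hΦ : IsFlow T d f Φ)
    (hs : s ∈ Icc 0 T) (hx₀ : x₀ ∈ Cadlag T d) (h𝓑 : ∀ β ∈ 𝓑, Measurable β) {σ ε e b c : ℝ}
    (hstep : HasStep T d f lam ell Cf u σ s x₀ 𝓑 C) (hC : 0 ≤ C)
    (hB : ∀ x ∈ XSet T d Cf s x₀, 1 + runSup d x T ≤ B) (hε : 0 < ε) (he : 0 < e)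
    {M K κ : ℝ} (hM : M = 1 + 2 * (Cf * B)) (hK : K = 4 * (Lf * M))
    (hst : s ≤ t) (htt : t < t') (ht' : t' ≤ T) (hkε : t' - t ≤ ε)
    (hkK : K * (t' - t) ≤ 1 / 2)
    (hkκ : ((2 + (2 + 2 * (Cf * B)) ^ 2) * (2 * (Cf * B)) ^ 2 + C * (4 * (1 + 2 * B))) *
      (t' - t) / ε + e ≤ κ)
    (h : IsTrack T d lam ell Cf Φ 𝓑 u σ s x₀ y₀ ε K M B b t x y β c) :
    ∃ x' y' β' c', IsTrack T d lam ell Cf Φ 𝓑 u σ s x₀ y₀ ε K M B (b - (t' - t) * κ) t'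
      x' y' β' c' := by
  have hf := D.bound.1
  have hLf := D.lip.1
  have hB0 : 0 ≤ B := by linarith [hB x h.mem, runSup_nonneg x T]
  have hk : 0 < t' - t := sub_pos.2 htt
  have hs0 := hs.1
  have hc : 0 < c := hε.trans_le h.eps_le
  have hβ := h𝓑 _ h.ctrl
  set θ := Real.exp (-(2 * (K * (t - s)))) with hθ
  set w := x t - Φ s x₀ β t with hw
  obtain ⟨x', hx', y', β', hβ', hxx, hββ, hle, hgain⟩ := hstep t t' hst htt ht' x h.mem y h.le β
    h.ctrl ((4 * θ * ‖w‖ ^ 2 / (c ^ 2 * ε)) • w) e he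
  have hβm := h𝓑 _ hβ'
  have hφ := D.flow_mem_xSet hΦ hs hx₀ hβm
  have hφφ : ∀ r ∈ Icc 0 t, Φ s x₀ β' r = Φ s x₀ β r :=
    D.traj_congr_ctrl hs hx₀ hβm (hΦ s hs x₀ hx₀ β' hβm) (hΦ s hs x₀ hx₀ β hβ)
      (htt.le.trans ht') fun r hr => hββ r hr.2
  set φ := Φ s x₀ β' with hφdef
  have ht0 : 0 ≤ t := hs0.trans hst
  have htm : t ∈ Icc 0 t := ⟨ht0, le_rfl⟩
  have hw' : x' t - φ t = w := by rw [hxx t htm, hφφ t htm]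
  set v := (x' t' - x' t) - (φ t' - φ t) with hv
  have hwv : x' t' - φ t' = w + v := by rw [← hw', hv]; abel
  have hvn := XSet.norm_increment_sub_le hf hst htt.le ht' hx' hφ (hB _ hx') (hB _ hφ)
  have hnear : ∀ r ∈ Icc 0 t', ‖x' r - φ r‖ ≤ M * c := by
    intro r hr
    rcases le_total r t with hrt | hrt
    · rw [hxx r ⟨hr.1, hrt⟩, hφφ r ⟨hr.1, hrt⟩]
      exact h.near r ⟨hr.1, hrt⟩
    · have h1 := XSet.norm_increment_sub_le hf hst hrt (hr.2.trans ht') hx' hφ (hB _ hx')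
        (hB _ hφ)
      have h2 : x' r - φ r = w + ((x' r - x' t) - (φ r - φ t)) := by rw [← hw']; abel
      rw [h2]
      have h3 : 2 * (Cf * B) * (r - t) ≤ 2 * (Cf * B) * c := by
        gcongr
        linarith [hr.2, h.eps_le]
      rw [hM]
      linarith [norm_add_le w ((x' r - x' t) - (φ r - φ t)), h.end_le]
  have hM0 : 0 ≤ M := by rw [hM]; positivity
  set R := (∫ r in t..t', f r φ (β' r)) - ∫ r in t..t', f r x' (β' r) with hR
  have hRn : ‖R‖ ≤ Lf * M * c * (t' - t) := by
    have := D.norm_integral_f_sub_le hx'.1 hφ.1 hβm ht0 htt.le ht' (a := M * c) fun r hr => by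
      rw [norm_sub_rev]
      exact hnear r hr
    rwa [← mul_assoc] at this
  have hvR : x' t' - x' t - ∫ r in t..t', f r x' (β' r) = v + R := by
    rw [hv, hR, D.traj_sub_eq hs hx₀ (hΦ s hs x₀ hx₀ β' hβm) hst htt.le ht']
    abel
  obtain ⟨hpn, hin⟩ := inner_penalty_lower_bound (θ := θ) (κ := 2 * (Cf * B)) hε hc
    (Real.exp_nonneg _) h.end_le (by positivity) hvn (hkε.trans h.eps_le) hRn rfl
  rw [hvR] at hgain
  have hdx : disc lam s x' β' t = disc lam s x β t := by
    rw [D.disc_congr_path hx'.1 h.mem.1 hs0 hst (htt.le.trans ht') hxx,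
      disc_congr_ctrl hst fun r hr => hββ r hr.2]
  have hrx : runCost lam ell s x' β' t = runCost lam ell s x β t := by
    rw [D.runCost_congr_path hx'.1 h.mem.1 hs0 hst (htt.le.trans ht') hxx,
      runCost_congr_ctrl hst fun r hr => hββ r hr.2]
  have hdm := D.disc_mul hx'.1 hβm hs0 hst htt.le ht'
  have hra := D.runCost_add hx'.1 hβm hs0 hst htt.le ht'
  have hd1 := D.disc_le_one (α := β') hx'.1 ht0 htt.le ht'
  have hdp : 0 < disc lam s x β t := disc_pos
  refine ⟨x', y', β', max c ‖w + v‖, hx', hβ', hle, h.eps_le.trans (le_max_left _ _),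
    max_le h.le_max ?_, fun r hr => (hnear r hr).trans (mul_le_mul_of_nonneg_left
      (le_max_left _ _) hM0), ?_, ?_⟩
  · rw [← hwv]
    linarith [XSet.norm_sub_le_of_runSup hx' hφ (hB _ hx') (hB _ hφ) ⟨ht0.trans htt.le, ht'⟩]
  · rw [hwv]
    exact le_max_right _ _
  rw [hwv]
  have hcq : 0 < max c ‖w + v‖ := hc.trans_le (le_max_left _ _)
  have key := gain_step (S := σ * (disc lam t x' β' t' * y' + runCost lam ell t x' β' t' - y))
    (χ' := disc lam s x' β' t') (θ' := Real.exp (-(2 * (K * (t' - s)))))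
    (F' := max c ‖w + v‖ ^ 2 + ‖w + v‖ ^ 4 / max c ‖w + v‖ ^ 2) (c₂ := c ^ 2) (K₀ := K)
    (C₂ := (2 + (2 + 2 * (Cf * B)) ^ 2) * (2 * (Cf * B)) ^ 2) (C₃ := C * (4 * (1 + 2 * B)))
    (k := t' - t) (e := e) (κ := κ) hε hdp.le
    (D.disc_le_one h.mem.1 hs0 hst (htt.le.trans ht')) ?_ (Real.exp_pos _) ?_
    (Real.exp_nonneg _) ?_ (by positivity) ?_ ?_ hk.le (by positivity) (by positivity) he.le
    h.gain ?_ hkκ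
  · refine key.trans (le_of_eq ?_)
    rw [← hdm, hra, hdx, hrx]
    ring
  · rw [← hdm, hdx]
    exact mul_le_of_le_one_right hdp.le hd1
  · rw [Real.exp_le_one_iff, neg_nonpos, hK]
    have := sub_nonneg.2 hst
    positivity
  · have h1 := exp_neg_two_mul_le (r := K * (t' - t)) (by rw [hK]; positivity) hkK
    have h2 : Real.exp (-(2 * (K * (t' - s)))) = θ * Real.exp (-(2 * (K * (t' - t)))) := by
      rw [hθ, ← Real.exp_add]
      ring_nf
    rw [h2]
    exact mul_le_mul_of_nonneg_left h1 (Real.exp_nonneg _)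
  · have h1 : c ^ 2 ≤ max c ‖w + v‖ ^ 2 := by
      gcongr
      exact le_max_left _ _
    have h2 : 0 ≤ ‖w + v‖ ^ 4 / max c ‖w + v‖ ^ 2 := by positivity
    linarith
  · rw [hK]; positivity
  · refine le_trans ?_ hgain
    have h1 : C * ‖(4 * θ * ‖w‖ ^ 2 / (c ^ 2 * ε)) • w‖ * (t' - t) ^ 2 ≤
        C * (4 * (1 + 2 * B)) * (θ / ε) * (t' - t) ^ 2 := by
      have h2 : θ / ε * (4 * c) ≤ θ / ε * (4 * (1 + 2 * B)) := by
        have := h.le_max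
        have h0 : 0 ≤ θ / ε := div_nonneg (Real.exp_nonneg _) hε.le
        gcongr
      calc _ ≤ C * (θ / ε * (4 * (1 + 2 * B))) * (t' - t) ^ 2 := by
            gcongr
            exact hpn.trans h2
        _ = _ := by ring
    have h3 : 4 * (Lf * M) * c ^ 2 * (t' - t) = K * c ^ 2 * (t' - t) := by rw [hK]
    rw [h3] at hin
    linarith

end Doubling

section Comparison

set_option linter.unusedSectionVars false

variable {T : ℝ} {d : ℕ} {A : Type*} [TopologicalSpace A]
  {f : ℝ → Path d → A → E d} {lam ell : ℝ → Path d → A → ℝ} {h : Path d → ℝ} {Cf Clam Lf : ℝ}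
  [MeasurableSpace A] [BorelSpace A]
  {x x₀ φ : Path d} {y y₀ : ℝ} {β : ℝ → A} {𝓑 : Set (ℝ → A)} {s t t' : ℝ}
  {Φ : ℝ → Path d → (ℝ → A) → Path d} {u : ℝ → Path d → ℝ} {B C : ℝ}

lemma exists_step_size {l k₀ : ℝ} (hl : 0 < l) (hk : 0 < k₀) :
    ∃ N : ℕ, ∃ k, 0 < k ∧ k ≤ k₀ ∧ N * k = l := by
  obtain ⟨N, hN⟩ := exists_nat_gt (l / k₀)
  have hN0 : (0 : ℝ) < N := (div_pos hl hk).trans hN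
  refine ⟨N, l / N, div_pos hl hN0, ?_, by field_simp⟩
  rw [div_lt_iff₀ hk] at hN
  rw [div_le_iff₀ hN0]
  linarith

lemma IsTrack.exists_terminal (D : Data T d f lam ell h Cf Clam Lf) (hΦ : IsFlow T d f Φ)
    (hs : s ∈ Ico 0 T) (hx₀ : x₀ ∈ Cadlag T d) (h𝓑 : ∀ β ∈ 𝓑, Measurable β)
    (hne : 𝓑.Nonempty) {σ ε κ : ℝ}
    (hstep : HasStep T d f lam ell Cf u σ s x₀ 𝓑 C) (hC : 0 ≤ C)
    (hB : ∀ x ∈ XSet T d Cf s x₀, 1 + runSup d x T ≤ B)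
    (hu : ∀ x ∈ XSet T d Cf s x₀, σ * u s x₀ ≤ σ * u s x)
    (hε : 0 < ε) (hε1 : ε ≤ 1) (hκ : 0 < κ)
    {M K : ℝ} (hM : M = 1 + 2 * (Cf * B)) (hK : K = 4 * (Lf * M)) :
    ∃ x y β c, IsTrack T d lam ell Cf Φ 𝓑 u σ s x₀ (u s x₀) ε K M B (-ε - (T - s) * κ) T
      x y β c := by
  have hf := D.bound.1
  have hLf := D.lip.1
  have hs' : s ∈ Icc 0 T := Ico_subset_Icc_self hs
  obtain ⟨β, hβ⟩ := hne
  have hφ := D.flow_mem_xSet hΦ hs' hx₀ (h𝓑 β hβ)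
  have hB0 : 0 ≤ B := by linarith [hB _ hφ, runSup_nonneg (Φ s x₀ β) T]
  have hM0 : 0 ≤ M := by rw [hM]; positivity
  have hK0 : 0 ≤ K := by rw [hK]; positivity
  set Q := (2 + (2 + 2 * (Cf * B)) ^ 2) * (2 * (Cf * B)) ^ 2 + C * (4 * (1 + 2 * B)) with hQ
  have hQ0 : 0 ≤ Q := by positivity
  obtain ⟨N, k, hk, hkk, hNk⟩ := exists_step_size (sub_pos.2 hs.2)
    (lt_min hε (lt_min (show 0 < 1 / (2 * (K + 1)) by positivity)
      (show 0 < κ * ε / (2 * (Q + 1)) by positivity)))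
  have hk1 : k ≤ ε := hkk.trans (min_le_left _ _)
  have hk2 : K * k ≤ 1 / 2 := by
    have h1 := hkk.trans ((min_le_right _ _).trans (min_le_left _ _))
    rw [le_div_iff₀ (by positivity)] at h1
    linarith
  have hk3 : Q * k / ε + κ / 2 ≤ κ := by
    have h1 := hkk.trans ((min_le_right _ _).trans (min_le_right _ _))
    rw [le_div_iff₀ (by positivity)] at h1
    have h2 : Q * k / ε ≤ κ / 2 := by
      rw [div_le_iff₀ hε]
      linarith
    linarith
  have key : ∀ i : ℕ, i ≤ N → ∃ x y β c, IsTrack T d lam ell Cf Φ 𝓑 u σ s x₀ (u s x₀) ε K M B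
      (-ε - i * k * κ) (s + i * k) x y β c := by
    intro i
    induction i with
    | zero =>
      intro _
      refine ⟨Φ s x₀ β, u s x₀, β, ε, hφ, hβ, ?_, le_rfl, by linarith, fun r _ => ?_, ?_, ?_⟩
      · simpa using hu _ hφ
      · rw [sub_self, norm_zero]
        positivity
      · rw [sub_self, norm_zero]
        exact hε.le
      · have h1 : ε ^ 2 / ε = ε := by field_simp
        simp [disc_self, runCost, h1]
    | succ i ih =>
      intro hi
      obtain ⟨x, y, β, c, htr⟩ := ih (by omega)
      have hiN : ((i + 1 : ℕ) : ℝ) * k ≤ N * k :=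
        mul_le_mul_of_nonneg_right (by exact_mod_cast hi) hk.le
      have hsub : s + ((i + 1 : ℕ) : ℝ) * k - (s + i * k) = k := by push_cast; ring
      obtain ⟨x', y', β', c', htr'⟩ := htr.exists_step (e := κ / 2) (κ := κ)
        (t' := s + ((i + 1 : ℕ) : ℝ) * k) D hΦ hs' hx₀ h𝓑
        hstep hC hB hε (by positivity) hM hK (by simpa using by positivity) (by linarith)
        (by linarith) (by rwa [hsub]) (by rwa [hsub]) (by rwa [hsub])
      refine ⟨x', y', β', c', ?_⟩
      rw [hsub] at htr'
      convert htr' using 1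
      push_cast
      ring
  obtain ⟨x, y, β, c, htr⟩ := key N le_rfl
  refine ⟨x, y, β, c, ?_⟩
  rwa [hNk, add_sub_cancel] at htr

lemma HasStep.exists_le_pathCost (D : Data T d f lam ell h Cf Clam Lf) (hΦ : IsFlow T d f Φ)
    (hs : s ∈ Ico 0 T) (hx₀ : x₀ ∈ Cadlag T d) (h𝓑 : ∀ β ∈ 𝓑, Measurable β)
    (hne : 𝓑.Nonempty) {σ : ℝ} (hσ : |σ| = 1)
    (hstep : HasStep T d f lam ell Cf u σ s x₀ 𝓑 C) (hC : 0 ≤ C)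
    (hB : ∀ x ∈ XSet T d Cf s x₀, 1 + runSup d x T ≤ B)
    (hu : ∀ x ∈ XSet T d Cf s x₀, σ * u s x₀ ≤ σ * u s x)
    (huT : ∀ x ∈ Cadlag T d, σ * u T x ≤ σ * h x) {η : ℝ} (hη : 0 < η) :
    ∃ β ∈ 𝓑, σ * u s x₀ ≤ σ * pathCost T lam ell h s (Φ s x₀ β) β + η := by
  have hf := D.bound.1
  have hLf := D.lip.1
  have hT : 0 < T := hs.1.trans_lt hs.2
  have hs' : s ∈ Icc 0 T := Ico_subset_Icc_self hs
  obtain ⟨J, hJ0, hJ⟩ := D.exists_abs_cost_le hs' hx₀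
  obtain ⟨δ, hδ, hunif⟩ := D.pathCost_uniform hs' hx₀ (half_pos hη)
  have hB0 : 0 ≤ B := by
    obtain ⟨β, hβ⟩ := hne
    linarith [hB _ (D.flow_mem_xSet hΦ hs' hx₀ (h𝓑 β hβ)), runSup_nonneg (Φ s x₀ β) T]
  obtain ⟨M, hM⟩ : ∃ M, M = 1 + 2 * (Cf * B) := ⟨_, rfl⟩
  obtain ⟨K, hK⟩ : ∃ K, K = 4 * (Lf * M) := ⟨_, rfl⟩
  have hM0 : 0 < M := by rw [hM]; positivity
  have hK0 : 0 ≤ K := by rw [hK]; positivity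
  set Q := J + |u s x₀| + η with hQ
  have hQ0 : 0 < Q := by positivity
  set W := Real.exp (Clam * T + 2 * (K * T)) with hW
  have hW0 : 0 < W := Real.exp_pos _
  set ε := min 1 (min (η / 4) (δ ^ 2 / (2 * (M ^ 2 * (Q * W))))) with hεdef
  have hε : 0 < ε := lt_min one_pos (lt_min (by positivity) (by positivity))
  have hε1 : ε ≤ 1 := min_le_left _ _
  have hε2 : ε ≤ η / 4 := (min_le_right _ _).trans (min_le_left _ _)
  have hε3 : ε ≤ δ ^ 2 / (2 * (M ^ 2 * (Q * W))) := (min_le_right _ _).trans (min_le_right _ _)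
  obtain ⟨x, y, β, c, htr⟩ := IsTrack.exists_terminal (ε := ε) (κ := η / (4 * T)) D hΦ hs hx₀ h𝓑
    hne hstep hC hB hu hε hε1 (by positivity) hM hK
  have hβ := h𝓑 β htr.ctrl
  have hφ := D.flow_mem_xSet hΦ hs' hx₀ hβ
  have hc : 0 < c := hε.trans_le htr.eps_le
  refine ⟨β, htr.ctrl, ?_⟩
  have hκ : (T - s) * (η / (4 * T)) ≤ η / 4 := by
    calc (T - s) * (η / (4 * T)) ≤ T * (η / (4 * T)) := by
          gcongr
          linarith [hs.1]
      _ = η / 4 := by field_simp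
  have hdp : 0 < disc lam s x β T := disc_pos
  set P := disc lam s x β T * Real.exp (-(2 * (K * (T - s)))) *
    (c ^ 2 + ‖x T - Φ s x₀ β T‖ ^ 4 / c ^ 2) / ε with hP
  have hgain : P - η / 2 ≤ σ * (pathCost T lam ell h s x β - u s x₀) := by
    have h1 := htr.gain
    have h2 := mul_le_mul_of_nonneg_left (htr.le.trans (huT x htr.mem.1)) hdp.le
    have h3 : σ * (pathCost T lam ell h s x β - u s x₀) =
      σ * (disc lam s x β T * y + runCost lam ell s x β T - u s x₀) +
        (disc lam s x β T * (σ * h x) - disc lam s x β T * (σ * y)) := by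
      rw [pathCost]
      ring
    linarith
  have hcost : |σ * (pathCost T lam ell h s x β - u s x₀)| ≤ J + |u s x₀| := by
    rw [abs_mul, hσ, one_mul]
    exact (abs_sub _ _).trans (by linarith [hJ x htr.mem s hs' β])
  have hP1 : P ≤ Q := by linarith [(abs_le.1 hcost).2]
  have hWP : c ^ 2 ≤ W * (P * ε) := by
    have h1 : 1 ≤ W * (disc lam s x β T * Real.exp (-(2 * (K * (T - s))))) := by
      have h2 := D.le_disc (α := β) htr.mem.1 hs.1 hs.2.le le_rfl
      have h3 : Real.exp (-(2 * (K * T))) ≤ Real.exp (-(2 * (K * (T - s)))) := by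
        rw [Real.exp_le_exp]
        nlinarith [hs.1]
      calc (1 : ℝ) = W * (Real.exp (-(Clam * T)) * Real.exp (-(2 * (K * T)))) := by
            rw [hW, ← Real.exp_add, ← Real.exp_add, ← Real.exp_zero]
            ring_nf
        _ ≤ _ := by gcongr
    have h2 : W * (P * ε) = W * (disc lam s x β T * Real.exp (-(2 * (K * (T - s))))) *
        (c ^ 2 + ‖x T - Φ s x₀ β T‖ ^ 4 / c ^ 2) := by
      rw [hP]
      field_simp
    have h3 : 0 ≤ ‖x T - Φ s x₀ β T‖ ^ 4 / c ^ 2 := by positivity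
    rw [h2]
    nlinarith [sq_nonneg c]
  have hMc : M * c < δ := by
    refine lt_of_pow_lt_pow_left₀ 2 hδ.le ?_
    rw [le_div_iff₀ (by positivity)] at hε3
    calc (M * c) ^ 2 = M ^ 2 * c ^ 2 := by ring
      _ ≤ M ^ 2 * (W * (Q * ε)) := by
          gcongr
          exact hWP.trans (by gcongr)
      _ < δ ^ 2 := by nlinarith [sq_pos_of_pos hδ]
  have hdist : supDist T d x (Φ s x₀ β) < δ :=
    (supDist_le (by positivity) fun r hr => htr.near r hr).trans_lt hMc
  have hdiff := hunif x htr.mem _ hφ.1 hdist β hβ s hs'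
  have hdiff' : |σ * (pathCost T lam ell h s x β - pathCost T lam ell h s (Φ s x₀ β) β)| <
      η / 2 := by
    rwa [abs_mul, hσ, one_mul]
  have hP0 : 0 ≤ P := by positivity
  linarith [(abs_lt.1 hdiff').2]

lemma UscOn.le_of_eqOn (hu : UscOn T d u) (ht : t ∈ Icc 0 T) (hx : x ∈ Cadlag T d)
    (hx₀ : x₀ ∈ Cadlag T d) (he : ∀ r ∈ Icc 0 t, x r = x₀ r) : u t x₀ ≤ u t x := by
  refine le_of_forall_gt_imp_ge_of_dense fun c hc => ?_
  obtain ⟨δ, hδ, h⟩ := hu t ht x hx c hc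
  exact (h t ht x₀ hx₀ ((dInf_stop_eq_zero ht he).trans_lt hδ)).le

lemma LscOn.le_of_eqOn (hu : LscOn T d u) (ht : t ∈ Icc 0 T) (hx : x ∈ Cadlag T d)
    (hx₀ : x₀ ∈ Cadlag T d) (he : ∀ r ∈ Icc 0 t, x r = x₀ r) : u t x ≤ u t x₀ := by
  refine le_of_forall_lt_imp_le_of_dense fun c hc => ?_
  obtain ⟨δ, hδ, h⟩ := hu t ht x hx c hc
  exact (h t ht x₀ hx₀ ((dInf_stop_eq_zero ht he).trans_lt hδ)).le

namespace Data

lemma exists_runSup_bound (D : Data T d f lam ell h Cf Clam Lf) (hs : s ∈ Icc 0 T)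
    (hx₀ : x₀ ∈ Cadlag T d) :
    ∃ B, 0 ≤ B ∧ ∀ x ∈ XSet T d Cf s x₀, 1 + runSup d x T ≤ B := by
  obtain ⟨R, hR0, hR⟩ := Cadlag.exists_bound hx₀
  exact ⟨2 * (1 + R) * Real.exp (2 * Cf * T), by positivity, fun x hx =>
    XSet.runSup_le D.bound.1 hs hR0 (fun t ht => hR t ⟨ht.1, ht.2.trans hs.2⟩) hx⟩

/-- Comparison: every minimax subsolution lies below the value function. -/
theorem minimaxSub_le_value [Nonempty A] (D : Data T d f lam ell h Cf Clam Lf)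
    (hΦ : IsFlow T d f Φ) (hu : MinimaxSub T d (Hctrl d f lam ell) h Cf u) (ht : t ∈ Icc 0 T)
    (hx : x ∈ Cadlag T d) : u t x ≤ value T d A lam ell h Φ t x := by
  rcases ht.2.eq_or_lt with rfl | hlt
  · rw [D.value_terminal hΦ ht.1 hx]
    exact hu.2.1 x hx
  obtain ⟨B, hB0, hB⟩ := D.exists_runSup_bound ht hx
  refine le_value fun α hα => le_of_forall_pos_le_add fun η hη => ?_
  obtain ⟨β, rfl, hle⟩ := (D.hasStep_sub ht.1 hu hB hα).exists_le_pathCost D hΦ ⟨ht.1, hlt⟩ hx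
    (fun β hβ => by rwa [mem_singleton_iff.1 hβ]) (singleton_nonempty α) abs_one
    (mul_nonneg D.bound.2.1 (mul_nonneg zero_le_two (mul_nonneg D.bound.1 hB0))) hB
    (fun x' hx' => by simpa using UscOn.le_of_eqOn hu.1 ht hx'.1 hx hx'.2.1)
    (fun x' hx' => by simpa using hu.2.1 x' hx') hη
  simpa using hle

/-- Comparison: every minimax supersolution lies above the value function. -/
theorem value_le_minimaxSuper [Nonempty A] (D : Data T d f lam ell h Cf Clam Lf)
    (hΦ : IsFlow T d f Φ) (hu : MinimaxSuper T d (Hctrl d f lam ell) h Cf u) (ht : t ∈ Icc 0 T)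
    (hx : x ∈ Cadlag T d) : value T d A lam ell h Φ t x ≤ u t x := by
  rcases ht.2.eq_or_lt with rfl | hlt
  · rw [D.value_terminal hΦ ht.1 hx]
    exact hu.2.1 x hx
  obtain ⟨B, hB0, hB⟩ := D.exists_runSup_bound ht hx
  refine le_of_forall_pos_le_add fun η hη => ?_
  obtain ⟨β, hβ, hle⟩ := (D.hasStep_super ht.1 hu hB).exists_le_pathCost D hΦ ⟨ht.1, hlt⟩ hx
    (fun β hβ => hβ) ⟨fun _ => Classical.arbitrary A, measurable_const⟩ (by simp)
    (mul_nonneg D.bound.2.1 (mul_nonneg zero_le_two (mul_nonneg D.bound.1 hB0))) hB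
    (fun x' hx' => by simpa using LscOn.le_of_eqOn hu.1 ht hx'.1 hx hx'.2.1)
    (fun x' hx' => by simpa using hu.2.1 x' hx') hη
  linarith [D.value_le hΦ ht hx hβ]

end Data

end Comparison

/-- The value function is the unique minimax `C_f`-solution of the
HJB terminal-value problem. -/
theorem value_unique_minimax_solution (T : ℝ) (hT : 0 < T) (d : ℕ) (hd : 1 ≤ d)
    (A : Type*) [TopologicalSpace A] [MeasurableSpace A] [BorelSpace A] [Nonempty A]
    (hA : SigmaCompactMetrizable A)
    (f : ℝ → Path d → A → E d) (lam ell : ℝ → Path d → A → ℝ) (h : Path d → ℝ)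
    (Cf Clam Lf : ℝ)
    (hD1 : DocCont T d f lam ell) (hD2 : DocMeas d f lam ell)
    (hD3 : DocBound T d f lam ell Cf Clam) (hD4 : DocLip T d f lam ell Lf)
    (hh : TermCont T d h)
    (Φ : ℝ → Path d → (ℝ → A) → Path d)
    (hΦ : ∀ s ∈ Icc (0 : ℝ) T, ∀ x ∈ Cadlag T d, ∀ α ∈ CtrlSet A,
      IsTraj T d f s x α (Φ s x α)) :
    MinimaxSol T d (Hctrl d f lam ell) h Cf (value T d A lam ell h Φ) ∧
    ∀ u : ℝ → Path d → ℝ, MinimaxSol T d (Hctrl d f lam ell) h Cf u →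
      ∀ t ∈ Icc (0 : ℝ) T, ∀ x ∈ Cadlag T d, u t x = value T d A lam ell h Φ t x := by
  have D : Data T d f lam ell h Cf Clam Lf := ⟨hA, hD1, hD2, hD3, hD4, hh⟩
  exact ⟨⟨D.value_minimaxSuper hΦ hT.le, D.value_minimaxSub hΦ hT.le⟩, fun u hu t ht x hx =>
    le_antisymm (D.minimaxSub_le_value hΦ hu.2 ht hx) (D.value_le_minimaxSuper hΦ hu.1 ht hx)⟩

end PHJ
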